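/- arXiv:1310.7728 — 4 statements merged into one kernel-verified Lean document; each statement's English description precedes it below -/
import Mathlib

section
/- Let K be continuous on C_T := {(t,s) ∈ (0,T)×(0,T) : s < t} with |K(t,s)| ≤ M/√(t−s), define H₁(t,s) = K(t,s)·1_{(0,t)}(s), H_n(t,s) = ∫_0^T H_{n−1}(t,z) H₁(z,s) dz for n ≥ 2, and G(t,s) = Σ_{n=2}^∞ H_n(t,s) (the series converging uniformly on [0,T]×[0,T]). Suppose in addition that h₁(t,s) := H₁(t,s)·√(t−s) has partial derivatives on C_T satisfying |∂_t h₁(t,s)| ≤ S/(t−s)^α and |∂_s h₁(t,s)| ≤ S/(t−s)^α for some constants S > 0 and α < 1/2. Then G has partial derivatives on C_T and there exists a constant S̄ > 0 with |∂_t G(t,s)| ≤ S̄/(t−s)^{1/2} and |∂_s G(t,s)| ≤ S̄/(t−s)^{1/2} for all (t,s) ∈ C_T. -/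
open MeasureTheory

namespace VolterraKernel

open Set Filter Topology

theorem rpow_neg_le_mul_rpow_neg {x T a b : ℝ} (hx : 0 < x) (hxT : x ≤ T) (hab : a ≤ b) :
    x ^ (-a) ≤ T ^ (b - a) * x ^ (-b) := by
  have h : x ^ (-a) = x ^ (b - a) * x ^ (-b) := by
    rw [← Real.rpow_add hx]; congr 1; ring
  rw [h]
  gcongr

theorem intervalIntegrable_of_abs_le {f g : ℝ → ℝ} {s t : ℝ} (hst : s ≤ t)
    (hf : AEStronglyMeasurable f (volume.restrict (Ioo s t)))
    (hfg : ∀ z ∈ Ioo s t, |f z| ≤ g z) (hg : IntervalIntegrable g volume s t) :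
    IntervalIntegrable f volume s t := by
  rw [intervalIntegrable_iff_integrableOn_Ioo_of_le hst] at hg ⊢
  exact Integrable.mono' hg hf ((ae_restrict_iff' measurableSet_Ioo).2 (ae_of_all _ hfg))

theorem abs_integral_le_of_abs_le {f g : ℝ → ℝ} {s t : ℝ} (hst : s ≤ t)
    (hfg : ∀ z ∈ Ioo s t, |f z| ≤ g z) (hg : IntervalIntegrable g volume s t) :
    |∫ z in s..t, f z| ≤ ∫ z in s..t, g z := by
  rw [intervalIntegrable_iff_integrableOn_Ioo_of_le hst] at hg
  rw [intervalIntegral.integral_of_le hst, intervalIntegral.integral_of_le hst,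
    integral_Ioc_eq_integral_Ioo, integral_Ioc_eq_integral_Ioo, ← Real.norm_eq_abs]
  exact norm_integral_le_of_norm_le hg
    ((ae_restrict_iff' measurableSet_Ioo).2 (ae_of_all _ fun z hz => hfg z hz))

theorem integral_congr_Ioo {f g : ℝ → ℝ} {s t : ℝ} (hst : s ≤ t)
    (hfg : ∀ z ∈ Ioo s t, f z = g z) : ∫ z in s..t, f z = ∫ z in s..t, g z := by
  rw [intervalIntegral.integral_of_le hst, intervalIntegral.integral_of_le hst,
    integral_Ioc_eq_integral_Ioo, integral_Ioc_eq_integral_Ioo]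
  exact setIntegral_congr_fun measurableSet_Ioo hfg

theorem intervalIntegrable_sub_rpow_neg {b : ℝ} (hb : b < 1) (c s t : ℝ) :
    IntervalIntegrable (fun z => (z - c) ^ (-b)) volume s t := by
  have := (intervalIntegral.intervalIntegrable_rpow' (a := s - c) (b := t - c)
    (r := -b) (by linarith)).comp_sub_right c
  simpa using this

theorem intervalIntegrable_rpow_neg_sub {a : ℝ} (ha : a < 1) (c s t : ℝ) :
    IntervalIntegrable (fun z => (c - z) ^ (-a)) volume s t := by
  have := (intervalIntegral.intervalIntegrable_rpow' (a := c - s) (b := c - t)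
    (r := -a) (by linarith)).comp_sub_left c
  simpa using this

theorem integral_sub_rpow_neg {b : ℝ} (hb : b < 1) {s t : ℝ} :
    ∫ z in s..t, (z - s) ^ (-b) = (t - s) ^ (1 - b) / (1 - b) := by
  rw [intervalIntegral.integral_comp_sub_right (fun x => x ^ (-b)) s,
    integral_rpow (Or.inl (by linarith))]
  have : -b + 1 ≠ 0 := by linarith
  rw [sub_self, Real.zero_rpow this, sub_zero, show -b + 1 = 1 - b by ring]

theorem integral_rpow_neg_sub {a : ℝ} (ha : a < 1) {s t : ℝ} :
    ∫ z in s..t, (t - z) ^ (-a) = (t - s) ^ (1 - a) / (1 - a) := by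
  rw [intervalIntegral.integral_comp_sub_left (fun x => x ^ (-a)) t,
    integral_rpow (Or.inl (by linarith))]
  have : -a + 1 ≠ 0 := by linarith
  rw [sub_self, Real.zero_rpow this, sub_zero, show -a + 1 = 1 - a by ring]

theorem rpow_neg_mul_rpow_neg_le {a b s t z : ℝ} (ha : 0 ≤ a) (hb : 0 ≤ b) (hs : s < z)
    (ht : z < t) :
    (t - z) ^ (-a) * (z - s) ^ (-b) ≤
      ((t - s) / 2) ^ (-a) * (z - s) ^ (-b) + ((t - s) / 2) ^ (-b) * (t - z) ^ (-a) := by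
  have h1 : 0 < t - z := by linarith
  have h2 : 0 < z - s := by linarith
  have h3 : 0 < (t - s) / 2 := by linarith
  rcases le_total ((t - s) / 2) (t - z) with h | h
  · have := Real.rpow_le_rpow_of_nonpos h3 h (neg_nonpos.2 ha)
    have h4 : 0 ≤ ((t - s) / 2) ^ (-b) * (t - z) ^ (-a) := by positivity
    have h5 := mul_le_mul_of_nonneg_right this (Real.rpow_nonneg h2.le (-b))
    linarith
  · have := Real.rpow_le_rpow_of_nonpos h3 (show (t - s) / 2 ≤ z - s by linarith)
      (neg_nonpos.2 hb)
    have h4 : 0 ≤ ((t - s) / 2) ^ (-a) * (z - s) ^ (-b) := by positivity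
    have h5 := mul_le_mul_of_nonneg_right this (Real.rpow_nonneg h1.le (-a))
    linarith

theorem continuousOn_rpow_neg_mul (a b s t : ℝ) :
    ContinuousOn (fun z => (t - z) ^ (-a) * (z - s) ^ (-b)) (Ioo s t) := by
  refine ContinuousOn.mul (ContinuousOn.rpow_const (by fun_prop) ?_)
    (ContinuousOn.rpow_const (by fun_prop) ?_)
  · intro z hz; left; have := hz.2; simp only [ne_eq]; intro h; linarith
  · intro z hz; left; have := hz.1; simp only [ne_eq]; intro h; linarith

theorem intervalIntegrable_beta {a b s t : ℝ} (ha : 0 ≤ a) (ha1 : a < 1) (hb : 0 ≤ b)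
    (hb1 : b < 1) (hst : s ≤ t) :
    IntervalIntegrable (fun z => (t - z) ^ (-a) * (z - s) ^ (-b)) volume s t := by
  refine intervalIntegrable_of_abs_le hst
    ((continuousOn_rpow_neg_mul a b s t).aestronglyMeasurable measurableSet_Ioo)
    (fun z hz => ?_)
    (((intervalIntegrable_sub_rpow_neg hb1 s s t).const_mul (((t - s) / 2) ^ (-a))).add
      ((intervalIntegrable_rpow_neg_sub ha1 t s t).const_mul (((t - s) / 2) ^ (-b))))
  have h1 : 0 < t - z := by linarith [hz.2]
  have h2 : 0 < z - s := by linarith [hz.1]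
  rw [abs_of_nonneg (by positivity)]
  exact rpow_neg_mul_rpow_neg_le ha hb hz.1 hz.2

theorem exists_integral_beta_le {a b : ℝ} (ha : 0 ≤ a) (ha1 : a < 1) (hb : 0 ≤ b)
    (hb1 : b < 1) : ∃ C : ℝ, 0 < C ∧ ∀ s t : ℝ, s < t →
      ∫ z in s..t, (t - z) ^ (-a) * (z - s) ^ (-b) ≤ C * (t - s) ^ (1 - a - b) := by
  refine ⟨2 ^ a / (1 - b) + 2 ^ b / (1 - a), ?_, fun s t hst => ?_⟩
  · have h1 : 0 < 1 - a := by linarith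
    have h2 : 0 < 1 - b := by linarith
    positivity
  · have hl : 0 < t - s := by linarith
    have h1 : IntervalIntegrable (fun z => ((t - s) / 2) ^ (-a) * (z - s) ^ (-b)) volume s t :=
      (intervalIntegrable_sub_rpow_neg hb1 s s t).const_mul (((t - s) / 2) ^ (-a))
    have h2 : IntervalIntegrable (fun z => ((t - s) / 2) ^ (-b) * (t - z) ^ (-a)) volume s t :=
      (intervalIntegrable_rpow_neg_sub ha1 t s t).const_mul (((t - s) / 2) ^ (-b))
    have h3 := intervalIntegral.integral_mono_on_of_le_Ioo hst.le
      (intervalIntegrable_beta ha ha1 hb hb1 hst.le) (h1.add h2)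
      (fun z hz => rpow_neg_mul_rpow_neg_le ha hb hz.1 hz.2)
    refine h3.trans (le_of_eq ?_)
    rw [intervalIntegral.integral_add h1 h2, intervalIntegral.integral_const_mul,
      intervalIntegral.integral_const_mul, integral_sub_rpow_neg hb1, integral_rpow_neg_sub ha1]
    have key : ∀ c d : ℝ, ((t - s) / 2) ^ (-c) * ((t - s) ^ (1 - d) / (1 - d)) =
        2 ^ c / (1 - d) * (t - s) ^ (1 - c - d) := by
      intro c d
      rw [Real.div_rpow hl.le (by norm_num), Real.rpow_neg (by norm_num : (0:ℝ) ≤ 2),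
        show (1 - c - d : ℝ) = -c + (1 - d) by ring, Real.rpow_add hl]
      field_simp
    rw [key, key, show 1 - b - a = 1 - a - b by ring]
    ring

/-- The open triangle `0 < s < t < T`, as a set of pairs `(t, s)`. -/
def triangle (T : ℝ) : Set (ℝ × ℝ) := {p | 0 < p.2 ∧ p.2 < p.1 ∧ p.1 < T}

theorem isOpen_triangle (T : ℝ) : IsOpen (triangle T) :=
  (isOpen_lt continuous_const continuous_snd).inter
    ((isOpen_lt continuous_snd continuous_fst).inter (isOpen_lt continuous_fst continuous_const))

/-- A kernel that is continuous on the triangle with at most an inverse square root singularity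
on the diagonal. -/
structure IsWeaklySingular (T : ℝ) (A : ℝ → ℝ → ℝ) : Prop where
  cont : ContinuousOn (fun p : ℝ × ℝ => A p.1 p.2) (triangle T)
  bdd : ∃ C : ℝ, 0 < C ∧ ∀ t s, 0 < s → s < t → t < T → |A t s| ≤ C * (t - s) ^ (-(1 / 2) : ℝ)

/-- The Volterra composition of two kernels. -/
noncomputable def comp (A B : ℝ → ℝ → ℝ) (t s : ℝ) : ℝ := ∫ z in s..t, A t z * B z s

variable {T : ℝ} {A B D : ℝ → ℝ → ℝ}

theorem continuousOn_right (hA : ContinuousOn (fun p : ℝ × ℝ => A p.1 p.2) (triangle T))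
    {t : ℝ} (ht : t < T) : ContinuousOn (fun z => A t z) (Ioo 0 t) :=
  hA.comp (f := fun z => (t, z)) (by fun_prop) fun _ hz => ⟨hz.1, hz.2, ht⟩

theorem continuousOn_left (hA : ContinuousOn (fun p : ℝ × ℝ => A p.1 p.2) (triangle T))
    {s : ℝ} (hs : 0 < s) : ContinuousOn (fun z => A z s) (Ioo s T) :=
  hA.comp (f := fun z => (z, s)) (by fun_prop) fun _ hz => ⟨hs, hz.1, hz.2⟩

theorem continuousOn_comp_integrand
    (hA : ContinuousOn (fun p : ℝ × ℝ => A p.1 p.2) (triangle T))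
    (hB : ContinuousOn (fun p : ℝ × ℝ => B p.1 p.2) (triangle T)) {t s : ℝ} (hs : 0 < s)
    (ht : t < T) : ContinuousOn (fun z => A t z * B z s) (Ioo s t) :=
  ((continuousOn_right hA ht).mono (Ioo_subset_Ioo_left hs.le)).mul
    ((continuousOn_left hB hs).mono (Ioo_subset_Ioo_right ht.le))

theorem intervalIntegrable_comp (hA : IsWeaklySingular T A) (hB : IsWeaklySingular T B)
    {t s : ℝ} (hs : 0 < s) (hst : s ≤ t) (ht : t < T) :
    IntervalIntegrable (fun z => A t z * B z s) volume s t := by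
  obtain ⟨C, hC, hCA⟩ := hA.bdd
  obtain ⟨C', hC', hCB⟩ := hB.bdd
  refine intervalIntegrable_of_abs_le hst
    ((continuousOn_comp_integrand hA.cont hB.cont hs ht).aestronglyMeasurable measurableSet_Ioo)
    (fun z hz => ?_) ((intervalIntegrable_beta (a := 1 / 2) (b := 1 / 2) (by norm_num)
      (by norm_num) (by norm_num) (by norm_num) hst).const_mul (C * C'))
  rw [abs_mul]
  calc _ ≤ (C * (t - z) ^ (-(1 / 2) : ℝ)) * (C' * (z - s) ^ (-(1 / 2) : ℝ)) :=
        mul_le_mul (hCA t z (hs.trans hz.1) hz.2 ht) (hCB z s hs hz.1 (hz.2.trans ht))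
          (abs_nonneg _) ((abs_nonneg _).trans (hCA t z (hs.trans hz.1) hz.2 ht))
    _ = _ := by ring

theorem exists_abs_comp_le (hA : IsWeaklySingular T A) (hB : IsWeaklySingular T B) :
    ∃ C : ℝ, 0 < C ∧ ∀ t s, 0 < s → s < t → t < T → |comp A B t s| ≤ C := by
  obtain ⟨C, hC, hCA⟩ := hA.bdd
  obtain ⟨C', hC', hCB⟩ := hB.bdd
  obtain ⟨c, hc, hcb⟩ := exists_integral_beta_le (a := 1 / 2) (b := 1 / 2) (by norm_num)
      (by norm_num) (by norm_num) (by norm_num)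
  refine ⟨C * C' * c, by positivity, fun t s hs hst ht => ?_⟩
  refine (abs_integral_le_of_abs_le (g := fun z => C * C' * ((t - z) ^ (-(1 / 2) : ℝ) *
    (z - s) ^ (-(1 / 2) : ℝ))) hst.le (fun z hz => ?_)
    ((intervalIntegrable_beta (a := 1 / 2) (b := 1 / 2) (by norm_num)
      (by norm_num) (by norm_num) (by norm_num) hst.le).const_mul (C * C'))).trans ?_
  · rw [abs_mul]
    calc _ ≤ (C * (t - z) ^ (-(1 / 2) : ℝ)) * (C' * (z - s) ^ (-(1 / 2) : ℝ)) :=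
          mul_le_mul (hCA t z (hs.trans hz.1) hz.2 ht) (hCB z s hs hz.1 (hz.2.trans ht))
            (abs_nonneg _) ((abs_nonneg _).trans (hCA t z (hs.trans hz.1) hz.2 ht))
      _ = _ := by ring
  · rw [intervalIntegral.integral_const_mul]
    have := hcb s t hst
    rw [show (1 - 1 / 2 - 1 / 2 : ℝ) = 0 by norm_num, Real.rpow_zero, mul_one] at this
    gcongr

theorem comp_eq_integral_unit (A B : ℝ → ℝ → ℝ) (t s : ℝ) :
    comp A B t s =
      ∫ u in (0 : ℝ)..1, (t - s) * (A t (s + (t - s) * u) * B (s + (t - s) * u) s) := by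
  have := intervalIntegral.smul_integral_comp_add_mul (a := 0) (b := 1)
    (fun z => A t z * B z s) (t - s) s
  rw [intervalIntegral.integral_const_mul]
  simp only [smul_eq_mul, mul_zero, add_zero, mul_one, add_sub_cancel] at this
  rw [this, comp]

theorem continuousOn_comp (hA : IsWeaklySingular T A) (hB : IsWeaklySingular T B) :
    ContinuousOn (fun p : ℝ × ℝ => comp A B p.1 p.2) (triangle T) := by
  obtain ⟨C, hC, hCA⟩ := hA.bdd
  obtain ⟨C', hC', hCB⟩ := hB.bdd
  simp only [comp_eq_integral_unit]
  have hmem1 : ∀ p ∈ triangle T, ∀ u ∈ Ioo (0 : ℝ) 1,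
      (p.1, p.2 + (p.1 - p.2) * u) ∈ triangle T := by
    rintro p ⟨h1, h2, h3⟩ u ⟨hu0, hu1⟩
    have : 0 < p.1 - p.2 := by linarith
    refine ⟨?_, ?_, h3⟩
    · simp only; positivity
    · simp only; nlinarith
  have hmem2 : ∀ p ∈ triangle T, ∀ u ∈ Ioo (0 : ℝ) 1,
      (p.2 + (p.1 - p.2) * u, p.2) ∈ triangle T := by
    rintro p ⟨h1, h2, h3⟩ u ⟨hu0, hu1⟩
    have : 0 < p.1 - p.2 := by linarith
    refine ⟨h1, ?_, ?_⟩
    · simp only; nlinarith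
    · simp only; nlinarith
  intro p hp
  refine ContinuousAt.continuousWithinAt ?_
  have hnhds := (isOpen_triangle T).mem_nhds hp
  have hae : ∀ᵐ u : ℝ, u ≠ 1 := by
    simp [ae_iff]
  refine intervalIntegral.continuousAt_of_dominated_interval
    (bound := fun u => C * C' * ((1 - u) ^ (-(1 / 2) : ℝ) * (u - 0) ^ (-(1 / 2) : ℝ))) ?_ ?_ ?_ ?_
  · filter_upwards [hnhds] with p hp
    rw [uIoc_of_le zero_le_one, ← Measure.restrict_congr_set Ioo_ae_eq_Ioc]
    refine ContinuousOn.aestronglyMeasurable ?_ measurableSet_Ioo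
    refine continuousOn_const.mul (ContinuousOn.mul ?_ ?_)
    · exact hA.cont.comp (f := fun u => (p.1, p.2 + (p.1 - p.2) * u)) (by fun_prop) (hmem1 p hp)
    · exact hB.cont.comp (f := fun u => (p.2 + (p.1 - p.2) * u, p.2)) (by fun_prop) (hmem2 p hp)
  · filter_upwards [hnhds] with p hp
    filter_upwards [hae] with u hu hu'
    rw [uIoc_of_le zero_le_one] at hu'
    have hu : u ∈ Ioo (0 : ℝ) 1 := ⟨hu'.1, lt_of_le_of_ne hu'.2 hu⟩
    have h1 := hmem1 p hp u hu
    have h2 := hmem2 p hp u hu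
    have hl : 0 < p.1 - p.2 := by linarith [hp.2.1]
    have hu1 : 0 < 1 - u := by linarith [hu.2]
    have hu0 : 0 < u := hu.1
    have b1 := hCA _ _ h1.1 h1.2.1 h1.2.2
    have b2 := hCB _ _ h2.1 h2.2.1 h2.2.2
    simp only at b1 b2
    rw [show p.1 - (p.2 + (p.1 - p.2) * u) = (p.1 - p.2) * (1 - u) by ring,
      Real.mul_rpow hl.le hu1.le] at b1
    rw [show p.2 + (p.1 - p.2) * u - p.2 = (p.1 - p.2) * u by ring,
      Real.mul_rpow hl.le hu0.le] at b2
    rw [Real.norm_eq_abs, abs_mul, abs_mul, abs_of_pos hl, sub_zero]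
    have hll : (p.1 - p.2) * ((p.1 - p.2) ^ (-(1 / 2) : ℝ) * (p.1 - p.2) ^ (-(1 / 2) : ℝ)) = 1 := by
      rw [← Real.rpow_add hl, show (-(1 / 2) + -(1 / 2) : ℝ) = -1 by norm_num, Real.rpow_neg_one]
      exact mul_inv_cancel₀ hl.ne'
    calc _ ≤ (p.1 - p.2) * ((C * ((p.1 - p.2) ^ (-(1 / 2) : ℝ) * (1 - u) ^ (-(1 / 2) : ℝ))) *
          (C' * ((p.1 - p.2) ^ (-(1 / 2) : ℝ) * u ^ (-(1 / 2) : ℝ)))) := by gcongr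
      _ = ((p.1 - p.2) * ((p.1 - p.2) ^ (-(1 / 2) : ℝ) * (p.1 - p.2) ^ (-(1 / 2) : ℝ))) *
          (C * C' * ((1 - u) ^ (-(1 / 2) : ℝ) * u ^ (-(1 / 2) : ℝ))) := by ring
      _ = _ := by rw [hll, one_mul]
  · exact (intervalIntegrable_beta (a := 1 / 2) (b := 1 / 2) (by norm_num)
      (by norm_num) (by norm_num) (by norm_num) zero_le_one).const_mul (C * C')
  · filter_upwards [hae] with u hu hu'
    rw [uIoc_of_le zero_le_one] at hu'
    have hu : u ∈ Ioo (0 : ℝ) 1 := ⟨hu'.1, lt_of_le_of_ne hu'.2 hu⟩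
    have h1 := hA.cont.continuousAt ((isOpen_triangle T).mem_nhds (hmem1 p hp u hu))
    have h2 := hB.cont.continuousAt ((isOpen_triangle T).mem_nhds (hmem2 p hp u hu))
    refine ContinuousAt.mul (by fun_prop) (ContinuousAt.mul ?_ ?_)
    · exact ContinuousAt.comp (f := fun p : ℝ × ℝ => (p.1, p.2 + (p.1 - p.2) * u)) h1
        (by fun_prop)
    · exact ContinuousAt.comp (f := fun p : ℝ × ℝ => (p.2 + (p.1 - p.2) * u, p.2)) h2
        (by fun_prop)

theorem IsWeaklySingular.of_bounded
    (hA : ContinuousOn (fun p : ℝ × ℝ => A p.1 p.2) (triangle T)) {C : ℝ}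
    (hC : ∀ t s, 0 < s → s < t → t < T → |A t s| ≤ C) : IsWeaklySingular T A := by
  refine ⟨hA, (|C| + 1) * (|T| + 1) ^ (1 / 2 : ℝ), by positivity, fun t s hs hst ht => ?_⟩
  have h := rpow_neg_le_mul_rpow_neg (x := t - s) (T := |T| + 1) (a := 0) (b := 1 / 2)
    (by linarith) (by linarith [le_abs_self T]) (by norm_num)
  rw [neg_zero, Real.rpow_zero, sub_zero] at h
  calc |A t s| ≤ (|C| + 1) * 1 := by linarith [hC t s hs hst ht, le_abs_self C]
    _ ≤ (|C| + 1) * ((|T| + 1) ^ (1 / 2 : ℝ) * (t - s) ^ (-(1 / 2) : ℝ)) := by gcongr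
    _ = _ := by ring

theorem IsWeaklySingular.comp (hA : IsWeaklySingular T A) (hB : IsWeaklySingular T B) :
    IsWeaklySingular T (comp A B) :=
  (exists_abs_comp_le hA hB).elim fun _ h => .of_bounded (continuousOn_comp hA hB) h.2

theorem IsWeaklySingular.add (hA : IsWeaklySingular T A) (hB : IsWeaklySingular T B) :
    IsWeaklySingular T (fun t s => A t s + B t s) := by
  obtain ⟨C, hC, hCA⟩ := hA.bdd
  obtain ⟨C', hC', hCB⟩ := hB.bdd
  refine ⟨hA.cont.add hB.cont, C + C', by positivity, fun t s hs hst ht => ?_⟩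
  rw [add_mul]
  exact (abs_add_le _ _).trans (add_le_add (hCA t s hs hst ht) (hCB t s hs hst ht))

theorem comp_congr {A' B' : ℝ → ℝ → ℝ}
    (hA : ∀ t s, 0 < s → s < t → t < T → A t s = A' t s)
    (hB : ∀ t s, 0 < s → s < t → t < T → B t s = B' t s) {t s : ℝ} (hs : 0 < s) (hst : s < t)
    (ht : t < T) : comp A B t s = comp A' B' t s :=
  integral_congr_Ioo hst.le fun z hz => by
    rw [hA t z (hs.trans hz.1) hz.2 ht, hB z s hs hz.1 (hz.2.trans ht)]

theorem comp_add_left (hA : IsWeaklySingular T A) (hB : IsWeaklySingular T B)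
    (hD : IsWeaklySingular T D) {t s : ℝ} (hs : 0 < s) (hst : s < t) (ht : t < T) :
    comp (fun t s => A t s + B t s) D t s = comp A D t s + comp B D t s := by
  simp only [VolterraKernel.comp, add_mul]
  exact intervalIntegral.integral_add (intervalIntegrable_comp hA hD hs hst.le ht)
    (intervalIntegrable_comp hB hD hs hst.le ht)

theorem comp_add_right (hA : IsWeaklySingular T A) (hB : IsWeaklySingular T B)
    (hD : IsWeaklySingular T D) {t s : ℝ} (hs : 0 < s) (hst : s < t) (ht : t < T) :
    comp A (fun t s => B t s + D t s) t s = comp A B t s + comp A D t s := by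
  simp only [VolterraKernel.comp, mul_add]
  exact intervalIntegral.integral_add (intervalIntegrable_comp hA hB hs hst.le ht)
    (intervalIntegrable_comp hA hD hs hst.le ht)

theorem comp_reflect (A B : ℝ → ℝ → ℝ) (t s : ℝ) :
    comp (fun t s => B (T - s) (T - t)) (fun t s => A (T - s) (T - t)) t s =
      comp A B (T - s) (T - t) := by
  simp only [VolterraKernel.comp]
  rw [← intervalIntegral.integral_comp_sub_left (fun z => A (T - s) z * B z (T - t)) T]
  simp only [mul_comm]

theorem IsWeaklySingular.reflect (hA : IsWeaklySingular T A) :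
    IsWeaklySingular T (fun t s => A (T - s) (T - t)) := by
  obtain ⟨C, hC, hCA⟩ := hA.bdd
  refine ⟨?_, C, hC, fun t s hs hst ht => ?_⟩
  · refine hA.cont.comp (f := fun p : ℝ × ℝ => (T - p.2, T - p.1)) (by fun_prop) ?_
    rintro p ⟨h1, h2, h3⟩
    exact ⟨by simp only; linarith, by simp only; linarith, by simp only; linarith⟩
  · have := hCA (T - s) (T - t) (by linarith) (by linarith) (by linarith)
    rwa [show T - s - (T - t) = t - s by ring] at this

theorem IsWeaklySingular.abs (hA : IsWeaklySingular T A) :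
    IsWeaklySingular T (fun t s => |A t s|) := by
  obtain ⟨C, hC, hCA⟩ := hA.bdd
  exact ⟨hA.cont.abs, C, hC, fun t s hs hst ht => by simpa using hCA t s hs hst ht⟩

theorem comp_eq_setIntegral (A B : ℝ → ℝ → ℝ) {t s : ℝ} (hst : s ≤ t) :
    VolterraKernel.comp A B t s = ∫ z in Ioo s t, A t z * B z s := by
  rw [VolterraKernel.comp, intervalIntegral.integral_of_le hst, integral_Ioc_eq_integral_Ioo]

theorem comp_assoc (hA : IsWeaklySingular T A) (hB : IsWeaklySingular T B)
    (hD : IsWeaklySingular T D) {t s : ℝ} (hs : 0 < s) (hst : s < t) (ht : t < T) :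
    VolterraKernel.comp (VolterraKernel.comp A B) D t s =
      VolterraKernel.comp A (VolterraKernel.comp B D) t s := by
  set I : ℝ → ℝ → ℝ := fun z => (Ioi z).indicator fun w => A t w * B w z * D z s with hI
  have hrestr : ∀ {z}, z ∈ Ioo s t → ∀ f : ℝ → ℝ,
      ∫ w in Ioo s t, (Ioi z).indicator f w = ∫ w in Ioo z t, f w := by
    intro z hz f
    rw [integral_indicator measurableSet_Ioi, Measure.restrict_restrict measurableSet_Ioi]
    congr 2
    ext w
    simp only [mem_inter_iff, mem_Ioi, mem_Ioo]
    exact ⟨fun h => ⟨h.1, h.2.2⟩, fun h => ⟨h.1, hz.1.trans h.1, h.2⟩⟩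
  have hmeas : AEStronglyMeasurable (Function.uncurry I)
      ((volume.restrict (Ioo s t)).prod (volume.restrict (Ioo s t))) := by
    have hset : MeasurableSet {p : ℝ × ℝ | p.1 < p.2} :=
      measurableSet_lt measurable_fst measurable_snd
    have : Function.uncurry I = {p : ℝ × ℝ | p.1 < p.2}.indicator
        (fun p => A t p.2 * B p.2 p.1 * D p.1 s) := by
      ext ⟨z, w⟩
      simp [hI, indicator]
    rw [this, aestronglyMeasurable_indicator_iff hset, Measure.prod_restrict,
      Measure.restrict_restrict hset]
    refine ContinuousOn.aestronglyMeasurable ?_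
      (hset.inter (measurableSet_Ioo.prod measurableSet_Ioo))
    refine ContinuousOn.mul (ContinuousOn.mul ?_ ?_) ?_
    · refine hA.cont.comp (f := fun p : ℝ × ℝ => (t, p.2)) (by fun_prop) ?_
      rintro ⟨z, w⟩ ⟨h, hz, hw⟩
      exact ⟨hs.trans hw.1, hw.2, ht⟩
    · refine hB.cont.comp (f := fun p : ℝ × ℝ => (p.2, p.1)) (by fun_prop) ?_
      rintro ⟨z, w⟩ ⟨h, hz, hw⟩
      exact ⟨hs.trans hz.1, h, hw.2.trans ht⟩
    · refine hD.cont.comp (f := fun p : ℝ × ℝ => (p.1, s)) (by fun_prop) ?_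
      rintro ⟨z, w⟩ ⟨h, hz, hw⟩
      exact ⟨hs, hz.1, hz.2.trans ht⟩
  have hint : Integrable (Function.uncurry I)
      ((volume.restrict (Ioo s t)).prod (volume.restrict (Ioo s t))) := by
    rw [integrable_prod_iff hmeas]
    constructor
    · refine (ae_restrict_iff' measurableSet_Ioo).2 (ae_of_all _ fun z hz => ?_)
      have h := (intervalIntegrable_comp hA hB (hs.trans hz.1) hz.2.le ht).mul_const (D z s)
      rw [intervalIntegrable_iff_integrableOn_Ioo_of_le hz.2.le] at h
      have : IntegrableOn ((Ioi z).indicator fun w => A t w * B w z * D z s) (Ioo s t) := by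
        rw [IntegrableOn, integrable_indicator_iff measurableSet_Ioi, IntegrableOn,
          Measure.restrict_restrict measurableSet_Ioi]
        exact h.mono_set fun w hw => ⟨hw.1, hw.2.2⟩
      exact this
    · have h := intervalIntegrable_comp (hA.abs.comp hB.abs) hD.abs hs hst.le ht
      rw [intervalIntegrable_iff_integrableOn_Ioo_of_le hst.le] at h
      refine h.congr ((ae_restrict_iff' measurableSet_Ioo).2 (ae_of_all _ fun z hz => ?_))
      simp only [Function.uncurry, hI, norm_indicator_eq_indicator_norm, Real.norm_eq_abs]
      rw [hrestr hz (fun w => |A t w * B w z * D z s|), comp_eq_setIntegral _ _ hz.2.le,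
        ← integral_mul_const]
      simp only [abs_mul]
  have hswap := integral_integral_swap hint
  rw [comp_eq_setIntegral _ _ hst.le, comp_eq_setIntegral _ _ hst.le]
  calc _ = ∫ z in Ioo s t, ∫ w in Ioo s t, I z w := by
        refine setIntegral_congr_fun measurableSet_Ioo fun z hz => ?_
        simp only [hI]
        rw [hrestr hz, comp_eq_setIntegral _ _ hz.2.le, integral_mul_const]
    _ = ∫ w in Ioo s t, ∫ z in Ioo s t, I z w := hswap
    _ = _ := by
        refine setIntegral_congr_fun measurableSet_Ioo fun w hw => ?_
        have : ∀ z, I z w = (Iio w).indicator (fun z => A t w * (B w z * D z s)) z := by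
          intro z
          simp [hI, indicator, mul_assoc]
        simp only [this]
        rw [integral_indicator measurableSet_Iio, Measure.restrict_restrict measurableSet_Iio,
          comp_eq_setIntegral _ _ hw.1.le, ← integral_const_mul]
        congr 2
        ext z
        simp only [mem_inter_iff, mem_Iio, mem_Ioo]
        exact ⟨fun h => ⟨h.2.1, h.1⟩, fun h => ⟨h.2, h.1, h.2.trans hw.2⟩⟩

/-- Pointwise convergence with a uniform bound passes to compositions from the left. -/
theorem tendsto_comp_left {P : ℕ → ℝ → ℝ → ℝ} {G : ℝ → ℝ → ℝ} {C : ℝ}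
    (hP : ∀ n, IsWeaklySingular T (P n)) (hB : IsWeaklySingular T B)
    (hC : ∀ᶠ n in atTop, ∀ t s, 0 < s → s < t → t < T → |P n t s| ≤ C)
    (hlim : ∀ t s, 0 < s → s < t → t < T → Tendsto (fun n => P n t s) atTop (𝓝 (G t s)))
    {t s : ℝ} (hs : 0 < s) (hst : s < t) (ht : t < T) :
    Tendsto (fun n => VolterraKernel.comp (P n) B t s) atTop (𝓝 (VolterraKernel.comp G B t s)) := by
  simp only [comp_eq_setIntegral _ _ hst.le]
  have hone : IsWeaklySingular T (fun _ _ => (1 : ℝ)) :=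
    .of_bounded continuousOn_const (C := 1) (by simp)
  have hb := (intervalIntegrable_comp hone hB.abs hs hst.le ht).const_mul C
  rw [intervalIntegrable_iff_integrableOn_Ioo_of_le hst.le] at hb
  refine tendsto_integral_filter_of_dominated_convergence _ ?_ ?_ hb ?_
  · exact Eventually.of_forall fun n => (continuousOn_comp_integrand (hP n).cont hB.cont hs
      ht).aestronglyMeasurable measurableSet_Ioo
  · filter_upwards [hC] with n hn
    refine (ae_restrict_iff' measurableSet_Ioo).2 (ae_of_all _ fun z hz => ?_)
    rw [Real.norm_eq_abs, abs_mul, one_mul]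
    exact mul_le_mul_of_nonneg_right (hn t z (hs.trans hz.1) hz.2 ht) (abs_nonneg _)
  · refine (ae_restrict_iff' measurableSet_Ioo).2 (ae_of_all _ fun z hz => ?_)
    exact (hlim t z (hs.trans hz.1) hz.2 ht).mul_const _

/-- Pointwise convergence with a uniform bound passes to compositions from the right. -/
theorem tendsto_comp_right {P : ℕ → ℝ → ℝ → ℝ} {G : ℝ → ℝ → ℝ} {C : ℝ}
    (hP : ∀ n, IsWeaklySingular T (P n)) (hB : IsWeaklySingular T B)
    (hC : ∀ᶠ n in atTop, ∀ t s, 0 < s → s < t → t < T → |P n t s| ≤ C)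
    (hlim : ∀ t s, 0 < s → s < t → t < T → Tendsto (fun n => P n t s) atTop (𝓝 (G t s)))
    {t s : ℝ} (hs : 0 < s) (hst : s < t) (ht : t < T) :
    Tendsto (fun n => VolterraKernel.comp B (P n) t s) atTop (𝓝 (VolterraKernel.comp B G t s)) := by
  have key : ∀ Q : ℝ → ℝ → ℝ, VolterraKernel.comp B Q t s =
      VolterraKernel.comp (fun t s => Q (T - s) (T - t)) (fun t s => B (T - s) (T - t))
        (T - s) (T - t) := by
    intro Q
    rw [comp_reflect]
    simp
  simp only [key]
  refine tendsto_comp_left (T := T) (C := C) (fun n => (hP n).reflect) hB.reflect ?_ ?_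
    (by linarith) (by linarith) (by linarith)
  · filter_upwards [hC] with n hn t s hs hst ht
    exact hn _ _ (by linarith) (by linarith) (by linarith)
  · intro t s hs hst ht
    exact hlim _ _ (by linarith) (by linarith) (by linarith)

theorem hasDerivAt_integral_endpoint {Q : ℝ → ℝ → ℝ} {c : ℝ → ℝ} {c' t : ℝ}
    (hQ : ContinuousAt (fun p : ℝ × ℝ => Q p.1 p.2) (t, c t)) (hc : HasDerivAt c c' t)
    (hint : ∀ᶠ τ in 𝓝 t, IntervalIntegrable (Q τ) volume (c t) (c τ)) :
    HasDerivAt (fun τ => ∫ z in c t..c τ, Q τ z) (Q t (c t) * c') t := by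
  have h1 : HasDerivAt (fun τ => (c τ - c t) * Q t (c t)) (c' * Q t (c t)) t :=
    (hc.sub_const (c t)).mul_const _
  have h2 : HasDerivAt (fun τ => (∫ z in c t..c τ, Q τ z) - (c τ - c t) * Q t (c t)) 0 t := by
    rw [hasDerivAt_iff_isLittleO]
    simp only [intervalIntegral.integral_same, sub_self, zero_mul, sub_zero, smul_zero]
    refine Asymptotics.IsLittleO.trans_isBigO ?_ hc.isBigO_sub
    rw [Asymptotics.isLittleO_iff]
    intro δ hδ
    obtain ⟨U, hU, V, hV, hUV⟩ := mem_nhds_prod_iff.1 (Metric.continuousAt_iff'.1 hQ δ hδ)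
    obtain ⟨r, hr, hrV⟩ := Metric.mem_nhds_iff.1 hV
    filter_upwards [hU, hint, Metric.continuousAt_iff'.1 hc.continuousAt r hr] with τ hτU hτ hτr
    have h3 : ∫ z in c t..c τ, (Q τ z - Q t (c t)) =
        (∫ z in c t..c τ, Q τ z) - (c τ - c t) * Q t (c t) := by
      rw [intervalIntegral.integral_sub hτ (by simp), intervalIntegral.integral_const, smul_eq_mul]
    rw [← h3]
    refine intervalIntegral.norm_integral_le_of_norm_le_const fun z hz => ?_
    have hzV : z ∈ V := by
      refine hrV ?_
      rw [Metric.mem_ball, Real.dist_eq] at *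
      refine lt_of_le_of_lt ?_ hτr
      have := abs_sub_left_of_mem_uIcc (uIoc_subset_uIcc hz)
      exact this
    exact (le_of_lt (hUV (mk_mem_prod hτU hzV)))
  have h3 := h2.add h1
  rw [zero_add, mul_comm] at h3
  refine h3.congr_of_eventuallyEq (Eventually.of_forall fun τ => ?_)
  simp

theorem aestronglyMeasurable_deriv_left {P P' : ℝ → ℝ → ℝ}
    (hP : ContinuousOn (fun p : ℝ × ℝ => P p.1 p.2) (triangle T))
    (hP' : ∀ t z, 0 < z → z < t → t < T → HasDerivAt (fun τ => P τ z) (P' t z) t) {t : ℝ}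
    (ht : t < T) : AEStronglyMeasurable (P' t) (volume.restrict (Ioo 0 t)) := by
  have hpos : 0 < T - t := by linarith
  set u : ℕ → ℝ := fun n => (T - t) / (n + 2) with hu
  have hu0 : ∀ n, 0 < u n := fun n => by positivity
  have huT : ∀ n, t + u n < T := by
    intro n
    have : u n < T - t := by
      rw [hu]
      simp only
      rw [div_lt_iff₀ (by positivity)]
      nlinarith [(Nat.cast_nonneg n : (0 : ℝ) ≤ n)]
    linarith
  have hulim : Tendsto u atTop (𝓝[>] 0) := by
    refine tendsto_nhdsWithin_iff.2 ⟨?_, Eventually.of_forall hu0⟩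
    exact Tendsto.div_atTop tendsto_const_nhds
      (tendsto_atTop_add_const_right _ _ tendsto_natCast_atTop_atTop)
  refine aestronglyMeasurable_of_tendsto_ae atTop
    (f := fun n z => (u n)⁻¹ • (P (t + u n) z - P t z)) (fun n => ?_) ?_
  · refine ContinuousOn.aestronglyMeasurable ?_ measurableSet_Ioo
    exact (((continuousOn_right hP (huT n)).mono (Ioo_subset_Ioo_right
      (by linarith [hu0 n]))).sub (continuousOn_right hP ht)).const_smul (u n)⁻¹
  · refine (ae_restrict_iff' measurableSet_Ioo).2 (ae_of_all _ fun z hz => ?_)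
    exact (hP' t z hz.1 hz.2 ht).tendsto_slope_zero_right.comp hulim

theorem intervalIntegrable_deriv_mul {P P' : ℝ → ℝ → ℝ}
    (hP : ContinuousOn (fun p : ℝ × ℝ => P p.1 p.2) (triangle T))
    (hB : IsWeaklySingular T B)
    (hP' : ∀ t z, 0 < z → z < t → t < T → HasDerivAt (fun τ => P τ z) (P' t z) t) {C κ : ℝ}
    (hC : 0 ≤ C) (hκ : 0 ≤ κ)
    (hP'C : ∀ t z, 0 < z → z < t → t < T → |P' t z| ≤ C * (t - z) ^ (-κ)) {t s c : ℝ}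
    (hs : 0 < s) (hsc : s < c) (hct : c < t) (ht : t < T) :
    IntervalIntegrable (fun z => P' t z * B z s) volume s c := by
  obtain ⟨C', hC', hCB⟩ := hB.bdd
  refine intervalIntegrable_of_abs_le hsc.le (g := fun z => C * (t - c) ^ (-κ) * (C' *
    (z - s) ^ (-(1 / 2) : ℝ))) ?_ ?_ ?_
  · refine ((aestronglyMeasurable_deriv_left hP hP' ht).mono_measure
      (Measure.restrict_mono (Ioo_subset_Ioo hs.le hct.le) le_rfl)).mul ?_
    exact ((continuousOn_left hB.cont hs).mono
      (Ioo_subset_Ioo_right (by linarith))).aestronglyMeasurable measurableSet_Ioo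
  · intro z hz
    have h1 := hP'C t z (by linarith [hz.1]) (by linarith [hz.2]) ht
    have h2 := hCB z s hs hz.1 (by linarith [hz.2])
    have h3 : (t - z) ^ (-κ) ≤ (t - c) ^ (-κ) :=
      Real.rpow_le_rpow_of_nonpos (by linarith) (by linarith [hz.2]) (by linarith)
    rw [abs_mul]
    have hct' : 0 < t - c := by linarith
    have h4 := h1.trans (mul_le_mul_of_nonneg_left h3 hC)
    exact mul_le_mul h4 h2 (abs_nonneg _) (by positivity)
  · exact ((intervalIntegrable_sub_rpow_neg (by norm_num) s s c).const_mul C').const_mul _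

/-- Leibniz rule for a composition integral truncated away from the diagonal. -/
theorem hasDerivAt_truncated {P P' : ℝ → ℝ → ℝ} (hP : IsWeaklySingular T P)
    (hB : IsWeaklySingular T B)
    (hP' : ∀ t z, 0 < z → z < t → t < T → HasDerivAt (fun τ => P τ z) (P' t z) t) {C κ : ℝ}
    (hC : 0 ≤ C) (hκ : 0 ≤ κ)
    (hP'C : ∀ t z, 0 < z → z < t → t < T → |P' t z| ≤ C * (t - z) ^ (-κ)) {t s ε : ℝ}
    (hs : 0 < s) (hst : s < t) (ht : t < T) (hε : 0 < ε) (hε1 : ε < 1) :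
    HasDerivAt (fun τ => ∫ z in s..s + (1 - ε) * (τ - s), P τ z * B z s)
      ((1 - ε) * (P t (s + (1 - ε) * (t - s)) * B (s + (1 - ε) * (t - s)) s) +
        ∫ z in s..s + (1 - ε) * (t - s), P' t z * B z s) t := by
  set c : ℝ → ℝ := fun τ => s + (1 - ε) * (τ - s) with hcdef
  have hsc : s < c t := by
    simp only [hcdef]; nlinarith [mul_pos (sub_pos.2 hε1) (sub_pos.2 hst)]
  have hct : c t < t := by
    simp only [hcdef]; nlinarith [mul_pos hε (sub_pos.2 hst)]
  have hcderiv : HasDerivAt c (1 - ε) t :=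
    ((((hasDerivAt_id t).sub_const s).const_mul (1 - ε)).const_add s).congr_deriv (mul_one _)
  have hccont : ContinuousAt c t := hcderiv.continuousAt
  obtain ⟨C', hC', hCB⟩ := hB.bdd
  have hUmem : Ioo ((c t + t) / 2) T ∈ 𝓝 t := Ioo_mem_nhds (by linarith) ht
  have hcU : ∀ᶠ τ in 𝓝 t, c τ < (c t + t) / 2 ∧ s < c τ :=
    (hccont.eventually (gt_mem_nhds (by linarith))).and (hccont.eventually (lt_mem_nhds hsc))
  have hintf : ∀ τ ∈ Ioo ((c t + t) / 2) T, ∀ b ∈ Ioo s ((c t + t) / 2),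
      IntervalIntegrable (fun z => P τ z * B z s) volume s b := by
    intro τ hτ b hb
    refine (intervalIntegrable_comp hP hB hs (by linarith [hb.1, hb.2, hτ.1]) hτ.2).mono_set ?_
    rw [uIcc_of_le hb.1.le, uIcc_of_le (by linarith [hb.1, hb.2, hτ.1])]
    exact Icc_subset_Icc_right (by linarith [hb.2, hτ.1])
  have h1 : HasDerivAt (fun τ => ∫ z in s..c t, P τ z * B z s)
      (∫ z in s..c t, P' t z * B z s) t := by
    have hne : ∀ᵐ z : ℝ, z ≠ c t := by simp [ae_iff]
    have hI : ∀ z, z ≠ c t → z ∈ uIoc s (c t) → z ∈ Ioo s (c t) := by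
      intro z hz hz'
      rw [uIoc_of_le hsc.le] at hz'
      exact ⟨hz'.1, lt_of_le_of_ne hz'.2 hz⟩
    refine (intervalIntegral.hasDerivAt_integral_of_dominated_loc_of_deriv_le (𝕜 := ℝ)
      (F' := fun τ z => P' τ z * B z s)
      (bound := fun z => C * ((t - c t) / 2) ^ (-κ) * (C' * (z - s) ^ (-(1 / 2) : ℝ)))
      hUmem ?_ ?_ ?_ ?_ ?_ ?_).2
    · filter_upwards [hUmem] with τ hτ
      have := (hintf τ hτ (c t) ⟨hsc, by linarith⟩).aestronglyMeasurable
      rwa [uIoc_of_le hsc.le]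
    · exact hintf t ⟨by linarith, ht⟩ (c t) ⟨hsc, by linarith⟩
    · have := (intervalIntegrable_deriv_mul hP.cont hB hP' hC hκ hP'C hs hsc hct
        ht).aestronglyMeasurable
      rwa [uIoc_of_le hsc.le]
    · filter_upwards [hne] with z hz hz' τ hτ
      replace hz := hI z hz hz'
      have h1 := hP'C τ z (by linarith [hz.1]) (by linarith [hz.2, hτ.1]) hτ.2
      have h2 := hCB z s hs hz.1 (by linarith [hz.2])
      have h3 : (τ - z) ^ (-κ) ≤ ((t - c t) / 2) ^ (-κ) :=
        Real.rpow_le_rpow_of_nonpos (by linarith) (by linarith [hz.2, hτ.1]) (by linarith)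
      rw [Real.norm_eq_abs, abs_mul]
      have hct' : 0 < t - c t := by linarith
      have h4 := h1.trans (mul_le_mul_of_nonneg_left h3 hC)
      exact mul_le_mul h4 h2 (abs_nonneg _) (by positivity)
    · exact ((intervalIntegrable_sub_rpow_neg (by norm_num) s s _).const_mul C').const_mul _
    · filter_upwards [hne] with z hz hz' τ hτ
      replace hz := hI z hz hz'
      exact (hP' τ z (by linarith [hz.1]) (by linarith [hz.2, hτ.1]) hτ.2).mul_const _
  have h2 : HasDerivAt (fun τ => ∫ z in c t..c τ, P τ z * B z s)
      (P t (c t) * B (c t) s * (1 - ε)) t := by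
    refine hasDerivAt_integral_endpoint (Q := fun τ z => P τ z * B z s) ?_ hcderiv ?_
    · refine ContinuousAt.mul ?_ ?_
      · exact hP.cont.continuousAt
          ((isOpen_triangle T).mem_nhds ⟨by simp only; linarith, hct, ht⟩)
      · refine ContinuousAt.comp (f := fun p : ℝ × ℝ => (p.2, s))
          (g := fun p : ℝ × ℝ => B p.1 p.2) ?_ (by fun_prop)
        exact hB.cont.continuousAt
          ((isOpen_triangle T).mem_nhds ⟨hs, hsc, by simp only; linarith⟩)
    · filter_upwards [hUmem, hcU] with τ hτ hcτ
      exact (hintf τ hτ (c t) ⟨hsc, by linarith⟩).symm.trans (hintf τ hτ (c τ) ⟨hcτ.2, hcτ.1⟩)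
  have h3 := h2.add h1
  rw [mul_comm _ (1 - ε)] at h3
  refine h3.congr_of_eventuallyEq ?_
  filter_upwards [hUmem, hcU] with τ hτ hcτ
  have e1 := hintf τ hτ (c t) ⟨hsc, by linarith⟩
  have e2 := hintf τ hτ (c τ) ⟨hcτ.2, hcτ.1⟩
  have := intervalIntegral.integral_add_adjacent_intervals e1 (e1.symm.trans e2)
  simp only [Pi.add_apply]
  linarith

/-- If the derivatives of the truncated compositions converge locally uniformly, then the
composition is differentiable and its derivative is their limit. -/
theorem hasDerivAt_comp_of_tendsto {P P' : ℝ → ℝ → ℝ} (hP : IsWeaklySingular T P)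
    (hB : IsWeaklySingular T B)
    (hP' : ∀ t z, 0 < z → z < t → t < T → HasDerivAt (fun τ => P τ z) (P' t z) t) {C κ : ℝ}
    (hC : 0 ≤ C) (hκ : 0 ≤ κ)
    (hP'C : ∀ t z, 0 < z → z < t → t < T → |P' t z| ≤ C * (t - z) ^ (-κ)) {t s : ℝ}
    (hs : 0 < s) (hst : s < t) (ht : t < T) {g : ℝ → ℝ}
    (hg : Tendsto (fun p : ℝ × ℝ =>
      (1 - p.1) * (P p.2 (s + (1 - p.1) * (p.2 - s)) * B (s + (1 - p.1) * (p.2 - s)) s) +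
        (∫ z in s..s + (1 - p.1) * (p.2 - s), P' p.2 z * B z s) - g p.2)
      (𝓝[>] 0 ×ˢ 𝓝 t) (𝓝 0)) :
    HasDerivAt (fun τ => VolterraKernel.comp P B τ s) (g t) t := by
  refine hasDerivAt_of_tendstoUniformlyOnFilter (l := 𝓝[>] (0 : ℝ))
    (f := fun ε τ => ∫ z in s..s + (1 - ε) * (τ - s), P τ z * B z s) (g' := g)
    (f' := fun ε τ => (1 - ε) * (P τ (s + (1 - ε) * (τ - s)) * B (s + (1 - ε) * (τ - s)) s) +
        ∫ z in s..s + (1 - ε) * (τ - s), P' τ z * B z s) ?_ ?_ ?_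
  · rw [Metric.tendstoUniformlyOnFilter_iff]
    intro δ hδ
    filter_upwards [Metric.tendsto_nhds.1 hg δ hδ] with p hp
    rw [dist_comm, Real.dist_eq]
    simpa using hp
  · have h1 : ∀ᶠ ε in 𝓝[>] (0 : ℝ), ε ∈ Ioo (0 : ℝ) 1 := Ioo_mem_nhdsGT one_pos
    have h2 : ∀ᶠ τ in 𝓝 t, τ ∈ Ioo s T := Ioo_mem_nhds hst ht
    filter_upwards [h1.prod_mk h2] with p hp
    exact hasDerivAt_truncated hP hB hP' hC hκ hP'C hs hp.2.1 hp.2.2 hp.1.1 hp.1.2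
  · filter_upwards [Ioo_mem_nhds hst ht] with τ hτ
    have hint := intervalIntegrable_comp hP hB hs hτ.1.le hτ.2
    have hcont := intervalIntegral.continuousOn_primitive_interval' hint left_mem_uIcc
    rw [uIcc_of_le hτ.1.le] at hcont
    have hτt := hcont τ (right_mem_Icc.2 hτ.1.le)
    refine Tendsto.comp (g := fun x => ∫ z in s..x, P τ z * B z s) hτt ?_
    refine tendsto_nhdsWithin_iff.2 ⟨?_, ?_⟩
    · have : Tendsto (fun ε : ℝ => s + (1 - ε) * (τ - s)) (𝓝 0) (𝓝 (s + (1 - 0) * (τ - s))) :=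
        Continuous.tendsto (by fun_prop) 0
      rw [show s + (1 - 0) * (τ - s) = τ by ring] at this
      exact this.mono_left nhdsWithin_le_nhds
    · filter_upwards [Ioo_mem_nhdsGT (one_pos : (0 : ℝ) < 1)] with ε hε
      have : 0 < τ - s := by linarith [hτ.1]
      exact ⟨by nlinarith [mul_pos (sub_pos.2 hε.2) this], by nlinarith [mul_pos hε.1 this]⟩

theorem tendsto_integral_tail {E : ℝ → ℝ → ℝ} {C γ s t : ℝ} (hC : 0 ≤ C) (hγ : 0 ≤ γ)
    (hγ1 : γ < 1) (hst : s < t) (htT : t < T)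
    (hE : ∀ τ ∈ Ioo s T, ∀ z ∈ Ioo s τ, |E τ z| ≤ C * ((τ - z) ^ (-γ) * (z - s) ^ (-γ))) :
    Tendsto (fun p : ℝ × ℝ => ∫ z in s + (1 - p.1) * (p.2 - s)..p.2, E p.2 z)
      (𝓝[>] 0 ×ˢ 𝓝 t) (𝓝 0) := by
  have hlim : Tendsto (fun p : ℝ × ℝ => C * ((p.2 - s) / 2) ^ (-γ) *
      ((p.1 * (p.2 - s)) ^ (1 - γ) / (1 - γ))) (𝓝[>] 0 ×ˢ 𝓝 t) (𝓝 0) := by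
    have : ContinuousAt (fun p : ℝ × ℝ => C * ((p.2 - s) / 2) ^ (-γ) *
      ((p.1 * (p.2 - s)) ^ (1 - γ) / (1 - γ))) (0, t) := by
      refine ContinuousAt.mul (continuousAt_const.mul ?_) (ContinuousAt.div_const ?_ _)
      · refine ContinuousAt.rpow_const (by fun_prop) (Or.inl ?_)
        simp only; linarith
      · exact ContinuousAt.rpow_const (by fun_prop) (Or.inr (by linarith))
    have h2 := this.tendsto
    simp only [zero_mul, Real.zero_rpow (by linarith : 1 - γ ≠ 0), zero_div, mul_zero] at h2
    rw [nhds_prod_eq] at h2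
    exact h2.mono_left (prod_mono_left _ nhdsWithin_le_nhds)
  refine squeeze_zero_norm' ?_ hlim
  have h1 : ∀ᶠ ε in 𝓝[>] (0 : ℝ), ε ∈ Ioo (0 : ℝ) (1 / 2) := Ioo_mem_nhdsGT (by norm_num)
  have h2 : ∀ᶠ τ in 𝓝 t, τ ∈ Ioo s T := Ioo_mem_nhds hst htT
  filter_upwards [h1.prod_mk h2] with ⟨ε, τ⟩ ⟨hε, hτ⟩
  simp only at hε hτ ⊢
  have hl : 0 < τ - s := by linarith [hτ.1]
  have hcm : s + (τ - s) / 2 ≤ s + (1 - ε) * (τ - s) := by nlinarith [hε.2]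
  have hcτ : s + (1 - ε) * (τ - s) ≤ τ := by nlinarith [hε.1]
  have := abs_integral_le_of_abs_le hcτ (f := E τ)
    (g := fun z => C * ((τ - s) / 2) ^ (-γ) * (τ - z) ^ (-γ)) (fun z hz => ?_)
    ((intervalIntegrable_rpow_neg_sub hγ1 τ _ _).const_mul _)
  · rw [intervalIntegral.integral_const_mul, integral_rpow_neg_sub hγ1,
      show τ - (s + (1 - ε) * (τ - s)) = ε * (τ - s) by ring] at this
    exact this
  · have hz1 : (τ - s) / 2 ≤ z - s := by linarith [hz.1]
    have h3 : (z - s) ^ (-γ) ≤ ((τ - s) / 2) ^ (-γ) :=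
      Real.rpow_le_rpow_of_nonpos (by linarith) hz1 (by linarith)
    have h4 : 0 ≤ (τ - z) ^ (-γ) := Real.rpow_nonneg (by linarith [hz.2]) _
    calc _ ≤ C * ((τ - z) ^ (-γ) * (z - s) ^ (-γ)) := hE τ hτ z ⟨by linarith, hz.2⟩
      _ ≤ C * ((τ - z) ^ (-γ) * ((τ - s) / 2) ^ (-γ)) := by gcongr
      _ = _ := by ring

theorem aestronglyMeasurable_deriv_right {P P' : ℝ → ℝ → ℝ}
    (hP' : ∀ t z, 0 < z → z < t → t < T → HasDerivAt (fun σ => P t σ) (P' t z) z) {t : ℝ}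
    (ht : t < T) : AEStronglyMeasurable (P' t) (volume.restrict (Ioo 0 t)) := by
  refine (stronglyMeasurable_deriv (P t)).aestronglyMeasurable.congr
    ((ae_restrict_iff' measurableSet_Ioo).2 (ae_of_all _ fun z hz => ?_))
  exact (hP' t z hz.1 hz.2 ht).deriv

theorem aestronglyMeasurable_deriv_left' {P P' : ℝ → ℝ → ℝ}
    (hP' : ∀ t z, 0 < z → z < t → t < T → HasDerivAt (fun τ => P τ z) (P' t z) t) {s : ℝ}
    (hs : 0 < s) : AEStronglyMeasurable (fun z => P' z s) (volume.restrict (Ioo s T)) := by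
  refine (stronglyMeasurable_deriv (fun τ => P τ s)).aestronglyMeasurable.congr
    ((ae_restrict_iff' measurableSet_Ioo).2 (ae_of_all _ fun z hz => ?_))
  exact (hP' z s hs hz.1 hz.2).deriv

/-- Differentiability in the first variable of the composition of a kernel with itself, when the
kernel is an inverse square root of the distance to the diagonal times a function whose partial
derivatives have an integrable singularity against it. -/
theorem exists_hasDerivAt_comp_self {f a b : ℝ → ℝ → ℝ} (hf : IsWeaklySingular T f) {S γ : ℝ}
    (hT : 0 < T) (hS : 0 < S) (hγ : 1 / 2 ≤ γ) (hγ1 : γ < 1)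
    (hft : ∀ t s, 0 < s → s < t → t < T →
      HasDerivAt (fun τ => f τ s) (a t s - f t s / (2 * (t - s))) t)
    (ha : ∀ t s, 0 < s → s < t → t < T → |a t s| ≤ S * (t - s) ^ (-γ))
    (hfs : ∀ t s, 0 < s → s < t → t < T →
      HasDerivAt (fun σ => f t σ) (b t s + f t s / (2 * (t - s))) s)
    (hb : ∀ t s, 0 < s → s < t → t < T → |b t s| ≤ S * (t - s) ^ (-γ)) :
    ∃ C : ℝ, 0 < C ∧ ∃ d : ℝ → ℝ → ℝ, ∀ t s, 0 < s → s < t → t < T →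
      HasDerivAt (fun τ => VolterraKernel.comp f f τ s) (d t s) t ∧
        |d t s| ≤ C * (t - s) ^ (-(1 / 2) : ℝ) := by
  obtain ⟨M, hM, hfM⟩ := hf.bdd
  obtain ⟨C₁, hC₁, hβ₁⟩ := exists_integral_beta_le (a := γ) (b := 1 / 2) (by linarith) hγ1
    (by norm_num) (by norm_num)
  obtain ⟨C₂, hC₂, hβ₂⟩ := exists_integral_beta_le (a := 1 / 2) (b := γ) (by norm_num)
    (by norm_num) (by linarith) hγ1
  have hi₁ : ∀ {s t : ℝ}, s ≤ t → IntervalIntegrable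
      (fun z => 2 * S * M * ((t - z) ^ (-γ) * (z - s) ^ (-(1 / 2) : ℝ))) volume s t := fun h =>
    (intervalIntegrable_beta (a := γ) (b := 1 / 2) (by linarith) hγ1 (by norm_num) (by norm_num)
      h).const_mul _
  have hi₂ : ∀ {s t : ℝ}, s ≤ t → IntervalIntegrable
      (fun z => S * M * ((t - z) ^ (-(1 / 2) : ℝ) * (z - s) ^ (-γ))) volume s t := fun h =>
    (intervalIntegrable_beta (a := 1 / 2) (b := γ) (by norm_num) (by norm_num) (by linarith) hγ1
      h).const_mul _
  set P' : ℝ → ℝ → ℝ := fun t z => a t z - f t z / (2 * (t - z)) with hP'def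
  set E : ℝ → ℝ → ℝ → ℝ := fun s t z =>
    a t z * f z s + (z - s) / (t - s) * (b t z * f z s + f t z * a z s) with hEdef
  have hP'b : ∀ t z, 0 < z → z < t → t < T →
      |P' t z| ≤ (S * T ^ (3 / 2 - γ) + M / 2) * (t - z) ^ (-(3 / 2) : ℝ) := by
    intro t z hz hzt ht
    have hl : 0 < t - z := by linarith
    have h1 := ha t z hz hzt ht
    have h2 := rpow_neg_le_mul_rpow_neg (x := t - z) (T := T) (a := γ) (b := 3 / 2) hl
      (by linarith) (by linarith)
    have h3 := hfM t z hz hzt ht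
    have h4 : |f t z / (2 * (t - z))| ≤ M / 2 * (t - z) ^ (-(3 / 2) : ℝ) := by
      rw [abs_div, abs_of_pos (by positivity : 0 < 2 * (t - z)), div_le_iff₀ (by positivity),
        show (-(3 / 2) : ℝ) = -(1 / 2) + -1 by norm_num, Real.rpow_add hl, Real.rpow_neg_one]
      refine h3.trans (le_of_eq ?_)
      field_simp
    calc |P' t z| ≤ |a t z| + |f t z / (2 * (t - z))| := abs_sub _ _
      _ ≤ S * (T ^ (3 / 2 - γ) * (t - z) ^ (-(3 / 2) : ℝ)) +
          M / 2 * (t - z) ^ (-(3 / 2) : ℝ) := by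
        refine add_le_add (h1.trans ?_) h4
        gcongr
      _ = _ := by ring
  have hEb : ∀ t s z, 0 < s → s < z → z < t → t < T → |E s t z| ≤
      2 * S * M * ((t - z) ^ (-γ) * (z - s) ^ (-(1 / 2) : ℝ)) +
        S * M * ((t - z) ^ (-(1 / 2) : ℝ) * (z - s) ^ (-γ)) := by
    intro t s z hs hsz hzt ht
    have h1 := ha t z (hs.trans hsz) hzt ht
    have h2 := hb t z (hs.trans hsz) hzt ht
    have h3 := ha z s hs hsz (hzt.trans ht)
    have h4 := hfM t z (hs.trans hsz) hzt ht
    have h5 := hfM z s hs hsz (hzt.trans ht)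
    have h6 : |(z - s) / (t - s)| ≤ 1 := by
      rw [abs_of_nonneg (div_nonneg (by linarith) (by linarith)), div_le_one (by linarith)]
      linarith
    have k1 : |a t z * f z s| ≤ S * (t - z) ^ (-γ) * (M * (z - s) ^ (-(1 / 2) : ℝ)) := by
      rw [abs_mul]; exact mul_le_mul h1 h5 (abs_nonneg _) ((abs_nonneg _).trans h1)
    have k2 : |b t z * f z s| ≤ S * (t - z) ^ (-γ) * (M * (z - s) ^ (-(1 / 2) : ℝ)) := by
      rw [abs_mul]; exact mul_le_mul h2 h5 (abs_nonneg _) ((abs_nonneg _).trans h2)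
    have k3 : |f t z * a z s| ≤ M * (t - z) ^ (-(1 / 2) : ℝ) * (S * (z - s) ^ (-γ)) := by
      rw [abs_mul]; exact mul_le_mul h4 h3 (abs_nonneg _) ((abs_nonneg _).trans h4)
    have k4 : |(z - s) / (t - s) * (b t z * f z s + f t z * a z s)| ≤
        |b t z * f z s| + |f t z * a z s| := by
      rw [abs_mul]
      calc _ ≤ 1 * |b t z * f z s + f t z * a z s| := by gcongr
        _ ≤ _ := by rw [one_mul]; exact abs_add_le _ _
    have k5 := abs_add_le (a t z * f z s) ((z - s) / (t - s) * (b t z * f z s + f t z * a z s))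
    simp only [hEdef]
    nlinarith
  have hEint : ∀ t s, 0 < s → s < t → t < T → IntervalIntegrable (E s t) volume s t := by
    intro t s hs hst ht
    refine intervalIntegrable_of_abs_le hst.le ?_
      (fun z hz => hEb t s z hs hz.1 hz.2 ht) ((hi₁ hst.le).add (hi₂ hst.le))
    have hle1 : volume.restrict (Ioo s t) ≤ volume.restrict (Ioo 0 t) :=
      Measure.restrict_mono (Ioo_subset_Ioo_left hs.le) le_rfl
    have hle2 : volume.restrict (Ioo s t) ≤ volume.restrict (Ioo s T) :=
      Measure.restrict_mono (Ioo_subset_Ioo_right ht.le) le_rfl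
    have m1 : AEStronglyMeasurable (fun z => f t z) (volume.restrict (Ioo s t)) :=
      ((continuousOn_right hf.cont ht).aestronglyMeasurable measurableSet_Ioo).mono_measure hle1
    have m2 : AEStronglyMeasurable (fun z => f z s) (volume.restrict (Ioo s t)) :=
      ((continuousOn_left hf.cont hs).aestronglyMeasurable measurableSet_Ioo).mono_measure hle2
    have r1 : Measurable fun z : ℝ => (2 * (t - z))⁻¹ := by fun_prop
    have r2 : Measurable fun z : ℝ => (2 * (z - s))⁻¹ := by fun_prop
    have m3 : AEStronglyMeasurable (fun z => a t z) (volume.restrict (Ioo s t)) := by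
      have := ((aestronglyMeasurable_deriv_left hf.cont hft ht).mono_measure hle1).add
        (m1.mul r1.aestronglyMeasurable)
      refine this.congr (ae_of_all _ fun z => ?_)
      simp [div_eq_mul_inv]
    have m4 : AEStronglyMeasurable (fun z => b t z) (volume.restrict (Ioo s t)) := by
      have := ((aestronglyMeasurable_deriv_right hfs ht).mono_measure hle1).sub
        (m1.mul r1.aestronglyMeasurable)
      refine this.congr (ae_of_all _ fun z => ?_)
      simp [div_eq_mul_inv]
    have m5 : AEStronglyMeasurable (fun z => a z s) (volume.restrict (Ioo s t)) := by
      have := ((aestronglyMeasurable_deriv_left' hft hs).mono_measure hle2).add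
        (m2.mul r2.aestronglyMeasurable)
      refine this.congr (ae_of_all _ fun z => ?_)
      simp [div_eq_mul_inv]
    have r3 : Measurable fun z : ℝ => (z - s) / (t - s) := by fun_prop
    exact (m3.mul m2).add (r3.aestronglyMeasurable.mul ((m4.mul m2).add (m1.mul m5)))
  have hparts : ∀ t s ε, 0 < s → s < t → t < T → 0 < ε → ε < 1 →
      (1 - ε) * (f t (s + (1 - ε) * (t - s)) * f (s + (1 - ε) * (t - s)) s) +
        (∫ z in s..s + (1 - ε) * (t - s), P' t z * f z s) =
      ∫ z in s..s + (1 - ε) * (t - s), E s t z := by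
    intro t s ε hs hst ht hε hε1
    have hl : 0 < t - s := by linarith
    set c := s + (1 - ε) * (t - s) with hc
    have hsc : s < c := by nlinarith [mul_pos (sub_pos.2 hε1) hl]
    have hct : c < t := by nlinarith [mul_pos hε hl]
    have hI1 := intervalIntegrable_deriv_mul hf.cont hf hft (by positivity) (by norm_num)
      hP'b hs hsc hct ht
    have hI2 : IntervalIntegrable (E s t) volume s c := by
      refine (hEint t s hs hst ht).mono_set ?_
      rw [uIcc_of_le hsc.le, uIcc_of_le hst.le]
      exact Icc_subset_Icc_right hct.le
    have hvd : ∀ z ∈ Ioo s t, HasDerivAt (fun z => (z - s) / (t - s) * (f t z * f z s))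
        (E s t z - P' t z * f z s) z := by
      intro z hz
      have h1 := ((hasDerivAt_id z).sub_const s).div_const (t - s)
      have h2 := (hfs t z (hs.trans hz.1) hz.2 ht).mul (hft z s hs hz.1 (hz.2.trans ht))
      refine (h1.mul h2).congr_deriv ?_
      have e1 : t - z ≠ 0 := by linarith [hz.2]
      have e2 : z - s ≠ 0 := by linarith [hz.1]
      have e3 : t - s ≠ 0 := hl.ne'
      simp only [hEdef, hP'def, id, Pi.mul_apply]
      field_simp
      ring
    have hcont : ContinuousOn (fun z => (z - s) / (t - s) * (f t z * f z s)) (Icc s c) := by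
      intro z hz
      rcases eq_or_lt_of_le hz.1 with rfl | hsz
      · have hlim : Tendsto (fun z => (t - s)⁻¹ * (M * (t - c) ^ (-(1 / 2) : ℝ) *
            (M * (z - s) ^ (1 / 2 : ℝ)))) (𝓝[Icc s c] s) (𝓝 0) := by
          have : ContinuousAt (fun z => (t - s)⁻¹ * (M * (t - c) ^ (-(1 / 2) : ℝ) *
              (M * (z - s) ^ (1 / 2 : ℝ)))) s := by
            refine continuousAt_const.mul (continuousAt_const.mul (continuousAt_const.mul ?_))
            exact ContinuousAt.rpow_const (by fun_prop) (Or.inr (by norm_num))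
          have h := this.tendsto
          simp only [sub_self, Real.zero_rpow (by norm_num : (1 / 2 : ℝ) ≠ 0), mul_zero] at h
          exact h.mono_left nhdsWithin_le_nhds
        rw [ContinuousWithinAt]
        simp only [sub_self, zero_div, zero_mul]
        refine squeeze_zero_norm' ?_ hlim
        filter_upwards [self_mem_nhdsWithin] with z hz
        rcases eq_or_lt_of_le hz.1 with rfl | hsz
        · simp
        have hzs : 0 < z - s := by linarith
        have htc : 0 < t - c := by linarith
        have h1 := hfM t z (hs.trans hsz) (hz.2.trans_lt hct) ht
        have h2 := hfM z s hs hsz (by linarith [hz.2])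
        have h3 : (t - z) ^ (-(1 / 2) : ℝ) ≤ (t - c) ^ (-(1 / 2) : ℝ) :=
          Real.rpow_le_rpow_of_nonpos (by linarith) (by linarith [hz.2]) (by norm_num)
        have h4 : (z - s) ^ (1 / 2 : ℝ) = (z - s) * (z - s) ^ (-(1 / 2) : ℝ) := by
          nth_rw 2 [← Real.rpow_one (z - s)]
          rw [← Real.rpow_add hzs]; norm_num
        rw [Real.norm_eq_abs, abs_mul, abs_mul, abs_div, abs_of_pos hl, abs_of_pos hzs, h4]
        calc _ ≤ (z - s) / (t - s) * ((M * (t - c) ^ (-(1 / 2) : ℝ)) *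
              (M * (z - s) ^ (-(1 / 2) : ℝ))) := by
              gcongr
              exact h1.trans (by gcongr)
          _ = _ := by ring
      · exact (hvd z ⟨hsz, hz.2.trans_lt hct⟩).continuousAt.continuousWithinAt
    have hftc := intervalIntegral.integral_eq_sub_of_hasDerivAt_of_le hsc.le hcont
      (fun z hz => hvd z ⟨hz.1, hz.2.trans hct⟩) (hI2.sub hI1)
    rw [intervalIntegral.integral_sub hI2 hI1] at hftc
    have hcs : (c - s) / (t - s) = 1 - ε := by
      rw [hc, div_eq_iff hl.ne']; ring
    rw [hcs, sub_self, zero_div, zero_mul, sub_zero] at hftc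
    linarith
  refine ⟨(2 * S * M * C₁ + S * M * C₂) * T ^ (1 - γ), by positivity,
    fun t s => ∫ z in s..t, E s t z, fun t s hs hst ht => ⟨?_, ?_⟩⟩
  · refine hasDerivAt_comp_of_tendsto (P' := P') hf hf hft (by positivity) (by norm_num) hP'b
      hs hst ht (g := fun t => ∫ z in s..t, E s t z) ?_
    have htail := (tendsto_integral_tail (T := T) (E := E s) (s := s) (t := t) (γ := γ)
      (C := 3 * S * M * T ^ (γ - 1 / 2)) (by positivity) (by linarith) hγ1 hst ht ?_).neg
    · rw [neg_zero] at htail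
      refine htail.congr' ?_
      have h1 : ∀ᶠ ε in 𝓝[>] (0 : ℝ), ε ∈ Ioo (0 : ℝ) 1 := Ioo_mem_nhdsGT one_pos
      have h2 : ∀ᶠ τ in 𝓝 t, τ ∈ Ioo s T := Ioo_mem_nhds hst ht
      filter_upwards [h1.prod_mk h2] with ⟨ε, τ⟩ ⟨hε, hτ⟩
      simp only at hε hτ ⊢
      rw [hparts τ s ε hs hτ.1 hτ.2 hε.1 hε.2]
      have hl : 0 < τ - s := by linarith [hτ.1]
      have hI := hEint τ s hs hτ.1 hτ.2
      have hmem : s + (1 - ε) * (τ - s) ∈ uIcc s τ := by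
        rw [uIcc_of_le hτ.1.le]
        exact ⟨by nlinarith [mul_pos (sub_pos.2 hε.2) hl], by nlinarith [mul_pos hε.1 hl]⟩
      have := intervalIntegral.integral_add_adjacent_intervals
        (hI.mono_set (uIcc_subset_uIcc_left hmem)) (hI.mono_set (uIcc_subset_uIcc_right hmem))
      linarith
    · intro τ hτ z hz
      have h1 : 0 < τ - z := by linarith [hz.2]
      have h2 : 0 < z - s := by linarith [hz.1]
      have e1 := rpow_neg_le_mul_rpow_neg (x := τ - z) (T := T) (a := 1 / 2) (b := γ) h1
        (by linarith [hτ.2, hz.1]) hγ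
      have e2 := rpow_neg_le_mul_rpow_neg (x := z - s) (T := T) (a := 1 / 2) (b := γ) h2
        (by linarith [hτ.2, hz.2]) hγ
      calc _ ≤ _ := hEb τ s z hs hz.1 hz.2 hτ.2
        _ ≤ 2 * S * M * ((τ - z) ^ (-γ) * (T ^ (γ - 1 / 2) * (z - s) ^ (-γ))) +
          S * M * ((T ^ (γ - 1 / 2) * (τ - z) ^ (-γ)) * (z - s) ^ (-γ)) := by gcongr
        _ = _ := by ring
  · have hl : 0 < t - s := by linarith
    refine (abs_integral_le_of_abs_le hst.le (fun z hz => hEb t s z hs hz.1 hz.2 ht)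
      ((hi₁ hst.le).add (hi₂ hst.le))).trans ?_
    rw [intervalIntegral.integral_add (hi₁ hst.le) (hi₂ hst.le),
      intervalIntegral.integral_const_mul, intervalIntegral.integral_const_mul]
    have e1 := hβ₁ s t hst
    have e2 := hβ₂ s t hst
    have e3 := rpow_neg_le_mul_rpow_neg (x := t - s) (T := T) (a := γ - 1 / 2) (b := 1 / 2) hl
      (by linarith) (by linarith)
    rw [show 1 - γ - 1 / 2 = -(γ - 1 / 2) by ring] at e1
    rw [show 1 - 1 / 2 - γ = -(γ - 1 / 2) by ring] at e2
    rw [show 1 / 2 - (γ - 1 / 2) = 1 - γ by ring] at e3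
    calc _ ≤ 2 * S * M * (C₁ * (T ^ (1 - γ) * (t - s) ^ (-(1 / 2) : ℝ))) +
          S * M * (C₂ * (T ^ (1 - γ) * (t - s) ^ (-(1 / 2) : ℝ))) := by
          gcongr
          · exact e1.trans (by gcongr)
          · exact e2.trans (by gcongr)
      _ = _ := by ring

/-- Differentiability in the first variable of a composition whose left factor is bounded, with
partial derivatives that are weakly singular. -/
theorem exists_hasDerivAt_comp {P P' Q : ℝ → ℝ → ℝ} (hT : 0 < T) (hP : IsWeaklySingular T P)
    (hB : IsWeaklySingular T B) {N C : ℝ} (hN : 0 < N) (hC : 0 < C)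
    (hPN : ∀ t s, 0 < s → s < t → t < T → |P t s| ≤ N)
    (hP' : ∀ t s, 0 < s → s < t → t < T → HasDerivAt (fun τ => P τ s) (P' t s) t ∧
      |P' t s| ≤ C * (t - s) ^ (-(1 / 2) : ℝ))
    (hQ : ∀ t s, 0 < s → s < t → t < T → HasDerivAt (fun σ => P t σ) (Q t s) s ∧
      |Q t s| ≤ C * (t - s) ^ (-(1 / 2) : ℝ)) :
    ∃ C' : ℝ, 0 < C' ∧ ∃ d : ℝ → ℝ → ℝ, ∀ t s, 0 < s → s < t → t < T →
      HasDerivAt (fun τ => VolterraKernel.comp P B τ s) (d t s) t ∧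
        |d t s| ≤ C' * (t - s) ^ (-(1 / 2) : ℝ) := by
  obtain ⟨M, hM, hBM⟩ := hB.bdd
  obtain ⟨c₀, hc₀, hβ⟩ := exists_integral_beta_le (a := 1 / 2) (b := 1 / 2) (by norm_num)
    (by norm_num) (by norm_num) (by norm_num)
  have hP'd : ∀ t s, 0 < s → s < t → t < T → HasDerivAt (fun τ => P τ s) (P' t s) t :=
    fun t s hs hst ht => (hP' t s hs hst ht).1
  have hQd : ∀ t s, 0 < s → s < t → t < T → HasDerivAt (fun σ => P t σ) (Q t s) s :=
    fun t s hs hst ht => (hQ t s hs hst ht).1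
  have hi : ∀ {s t : ℝ}, s ≤ t → IntervalIntegrable
      (fun z => C * M * ((t - z) ^ (-(1 / 2) : ℝ) * (z - s) ^ (-(1 / 2) : ℝ))) volume s t :=
    fun h => (intervalIntegrable_beta (a := 1 / 2) (b := 1 / 2) (by norm_num) (by norm_num)
      (by norm_num) (by norm_num) h).const_mul _
  have hEb : ∀ t s z, 0 < s → s < z → z < t → t < T → |P' t z * B z s| ≤
      C * M * ((t - z) ^ (-(1 / 2) : ℝ) * (z - s) ^ (-(1 / 2) : ℝ)) := by
    intro t s z hs hsz hzt ht
    have h1 := (hP' t z (hs.trans hsz) hzt ht).2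
    have h2 := hBM z s hs hsz (hzt.trans ht)
    rw [abs_mul]
    calc _ ≤ (C * (t - z) ^ (-(1 / 2) : ℝ)) * (M * (z - s) ^ (-(1 / 2) : ℝ)) :=
          mul_le_mul h1 h2 (abs_nonneg _) ((abs_nonneg _).trans h1)
      _ = _ := by ring
  have hEint : ∀ t s, 0 < s → s < t → t < T →
      IntervalIntegrable (fun z => P' t z * B z s) volume s t := by
    intro t s hs hst ht
    refine intervalIntegrable_of_abs_le hst.le ?_
      (fun z hz => hEb t s z hs hz.1 hz.2 ht) (hi hst.le)
    refine ((aestronglyMeasurable_deriv_left hP.cont hP'd ht).mono_measure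
      (Measure.restrict_mono (Ioo_subset_Ioo_left hs.le) le_rfl)).mul ?_
    exact ((continuousOn_left hB.cont hs).mono
      (Ioo_subset_Ioo_right ht.le)).aestronglyMeasurable measurableSet_Ioo
  have hQint : ∀ t s, 0 < s → s < t → t < T → IntervalIntegrable (Q t) volume s t := by
    intro t s hs hst ht
    exact intervalIntegrable_of_abs_le hst.le
      ((aestronglyMeasurable_deriv_right hQd ht).mono_measure
        (Measure.restrict_mono (Ioo_subset_Ioo_left hs.le) le_rfl))
      (fun z hz => (hQ t z (hs.trans hz.1) hz.2 ht).2)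
      ((intervalIntegrable_rpow_neg_sub (by norm_num) t s t).const_mul C)
  -- the limit of `P τ` at the diagonal
  set p : ℝ → ℝ → ℝ := fun s τ => P τ ((s + τ) / 2) + ∫ z in (s + τ) / 2..τ, Q τ z with hp
  have hpP : ∀ τ s c, 0 < s → s < τ → τ < T → (s + τ) / 2 ≤ c → c < τ →
      P τ c - p s τ = -∫ z in c..τ, Q τ z := by
    intro τ s c hs hsτ hτ hmc hcτ
    have hI := hQint τ ((s + τ) / 2) (by linarith) (by linarith) hτ
    have hmem : c ∈ uIcc ((s + τ) / 2) τ := by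
      rw [uIcc_of_le (by linarith)]; exact ⟨hmc, hcτ.le⟩
    have h1 := hI.mono_set (uIcc_subset_uIcc_left hmem)
    have h2 := hI.mono_set (uIcc_subset_uIcc_right hmem)
    have h3 := intervalIntegral.integral_eq_sub_of_hasDerivAt (f := P τ) (f' := Q τ)
      (a := (s + τ) / 2) (b := c) (fun z hz => by
        rw [uIcc_of_le hmc] at hz
        exact hQd τ z (by linarith [hz.1]) (by linarith [hz.2]) hτ) h1
    have h4 := intervalIntegral.integral_add_adjacent_intervals h1 h2
    simp only [hp]
    linarith
  have hpb : ∀ τ s, 0 < s → s < τ → τ < T → |p s τ| ≤ N + 2 * C * T ^ (1 / 2 : ℝ) := by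
    intro τ s hs hsτ hτ
    have h1 := hPN τ ((s + τ) / 2) (by linarith) (by linarith) hτ
    have h2 := abs_integral_le_of_abs_le (f := Q τ) (s := (s + τ) / 2) (t := τ) (by linarith)
      (g := fun z => C * (τ - z) ^ (-(1 / 2) : ℝ))
      (fun z hz => (hQ τ z (by linarith [hz.1]) hz.2 hτ).2)
      ((intervalIntegrable_rpow_neg_sub (by norm_num) τ _ τ).const_mul C)
    rw [intervalIntegral.integral_const_mul, integral_rpow_neg_sub (by norm_num),
      show (1 - 1 / 2 : ℝ) = 1 / 2 by norm_num] at h2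
    have h3 : (τ - (s + τ) / 2) ^ (1 / 2 : ℝ) ≤ T ^ (1 / 2 : ℝ) :=
      Real.rpow_le_rpow (by linarith) (by linarith) (by norm_num)
    have h4 : C * ((τ - (s + τ) / 2) ^ (1 / 2 : ℝ) / (1 / 2)) ≤ 2 * C * T ^ (1 / 2 : ℝ) := by
      calc _ = 2 * C * (τ - (s + τ) / 2) ^ (1 / 2 : ℝ) := by ring
        _ ≤ _ := by gcongr
    exact (abs_add_le _ _).trans (add_le_add h1 (h2.trans h4))
  refine ⟨(N + 2 * C * T ^ (1 / 2 : ℝ)) * M + C * M * c₀ * T ^ (1 / 2 : ℝ), by positivity,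
    fun t s => p s t * B t s + ∫ z in s..t, P' t z * B z s, fun t s hs hst ht => ⟨?_, ?_⟩⟩
  · refine hasDerivAt_comp_of_tendsto (P' := P') hP hB hP'd hC.le (by norm_num)
      (fun t z h1 h2 h3 => (hP' t z h1 h2 h3).2) hs hst ht
      (g := fun t => p s t * B t s + ∫ z in s..t, P' t z * B z s) ?_
    have hev : ∀ᶠ x : ℝ × ℝ in 𝓝[>] (0 : ℝ) ×ˢ 𝓝 t,
        x.1 ∈ Ioo (0 : ℝ) (1 / 2) ∧ x.2 ∈ Ioo s T := by
      have h1 : ∀ᶠ ε in 𝓝[>] (0 : ℝ), ε ∈ Ioo (0 : ℝ) (1 / 2) := Ioo_mem_nhdsGT (by norm_num)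
      have h2 : ∀ᶠ τ in 𝓝 t, τ ∈ Ioo s T := Ioo_mem_nhds hst ht
      exact h1.prod_mk h2
    have htail := tendsto_integral_tail (T := T) (E := fun τ z => P' τ z * B z s) (s := s)
      (t := t) (γ := 1 / 2) (C := C * M) (by positivity) (by norm_num) (by norm_num) hst ht
      (fun τ hτ z hz => hEb τ s z hs hz.1 hz.2 hτ.2)
    have htailQ := tendsto_integral_tail (T := T) (E := Q) (s := s)
      (t := t) (γ := 1 / 2) (C := C * T ^ (1 / 2 : ℝ)) (by positivity) (by norm_num)
      (by norm_num) hst ht (fun τ hτ z hz => by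
        have h1 := rpow_neg_le_mul_rpow_neg (x := z - s) (T := T) (a := 0) (b := 1 / 2)
          (by linarith [hz.1]) (by linarith [hz.2, hτ.2]) (by norm_num)
        rw [neg_zero, Real.rpow_zero, sub_zero] at h1
        have h2 : 0 ≤ (τ - z) ^ (-(1 / 2) : ℝ) := Real.rpow_nonneg (by linarith [hz.2]) _
        calc _ ≤ C * (τ - z) ^ (-(1 / 2) : ℝ) * 1 := by
              rw [mul_one]; exact (hQ τ z (hs.trans hz.1) hz.2 hτ.2).2
          _ ≤ C * (τ - z) ^ (-(1 / 2) : ℝ) * (T ^ (1 / 2 : ℝ) * (z - s) ^ (-(1 / 2) : ℝ)) := by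
              gcongr
          _ = _ := by ring)
    have hBt : ContinuousAt (fun z => B z s) t :=
      (continuousOn_left hB.cont hs).continuousAt (Ioo_mem_nhds hst ht)
    have hle : 𝓝[>] (0 : ℝ) ×ˢ 𝓝 t ≤ 𝓝 (0, t) := by
      rw [nhds_prod_eq]; exact prod_mono_left _ nhdsWithin_le_nhds
    have hB1 : Tendsto (fun x : ℝ × ℝ => (1 - x.1) * B (s + (1 - x.1) * (x.2 - s)) s)
        (𝓝[>] (0 : ℝ) ×ˢ 𝓝 t) (𝓝 (B t s)) := by
      have h1 : ContinuousAt (fun x : ℝ × ℝ => (1 - x.1) * B (s + (1 - x.1) * (x.2 - s)) s)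
          (0, t) := by
        refine ContinuousAt.mul (by fun_prop) ?_
        refine ContinuousAt.comp (g := fun z => B z s)
          (f := fun x : ℝ × ℝ => s + (1 - x.1) * (x.2 - s)) ?_ (by fun_prop)
        simpa using hBt
      have h2 := h1.tendsto
      simp only [sub_zero, one_mul, add_sub_cancel] at h2
      exact h2.mono_left hle
    have hB2 : Tendsto (fun x : ℝ × ℝ => B x.2 s) (𝓝[>] (0 : ℝ) ×ˢ 𝓝 t) (𝓝 (B t s)) :=
      hBt.tendsto.comp tendsto_snd
    have hdiff := hB1.sub hB2
    rw [sub_self] at hdiff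
    have hA1 := hB1.mul htailQ.neg
    have hA2 := bdd_le_mul_tendsto_zero' (f := fun x : ℝ × ℝ => p s x.2)
      (N + 2 * C * T ^ (1 / 2 : ℝ)) (hev.mono fun x hx => hpb x.2 s hs hx.2.1 hx.2.2) hdiff
    have hall := (hA1.add hA2).sub htail
    simp only [neg_zero, mul_zero, add_zero, sub_zero] at hall
    refine hall.congr' ?_
    filter_upwards [hev] with ⟨ε, τ⟩ ⟨hε, hτ⟩
    simp only at hε hτ ⊢
    have hl : 0 < τ - s := by linarith [hτ.1]
    have hmc : (s + τ) / 2 ≤ s + (1 - ε) * (τ - s) := by nlinarith [hε.2]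
    have hcτ : s + (1 - ε) * (τ - s) < τ := by nlinarith [mul_pos hε.1 hl]
    rw [← hpP τ s _ hs hτ.1 hτ.2 hmc hcτ]
    have hI := hEint τ s hs hτ.1 hτ.2
    have hmem : s + (1 - ε) * (τ - s) ∈ uIcc s τ := by
      rw [uIcc_of_le hτ.1.le]
      exact ⟨by linarith, hcτ.le⟩
    have := intervalIntegral.integral_add_adjacent_intervals
      (hI.mono_set (uIcc_subset_uIcc_left hmem)) (hI.mono_set (uIcc_subset_uIcc_right hmem))
    linear_combination -this
  · have hl : 0 < t - s := by linarith
    have h1 := hpb t s hs hst ht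
    have h2 := hBM t s hs hst ht
    have h3 := abs_integral_le_of_abs_le hst.le (fun z hz => hEb t s z hs hz.1 hz.2 ht)
      (hi hst.le)
    have h4 := hβ s t hst
    rw [show (1 - 1 / 2 - 1 / 2 : ℝ) = -0 by norm_num] at h4
    have h5 := rpow_neg_le_mul_rpow_neg (x := t - s) (T := T) (a := 0) (b := 1 / 2) hl
      (by linarith) (by norm_num)
    rw [sub_zero] at h5
    rw [intervalIntegral.integral_const_mul] at h3
    calc _ ≤ |p s t| * |B t s| + |∫ z in s..t, P' t z * B z s| := by
          rw [← abs_mul]; exact abs_add_le _ _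
      _ ≤ (N + 2 * C * T ^ (1 / 2 : ℝ)) * (M * (t - s) ^ (-(1 / 2) : ℝ)) +
          C * M * (c₀ * (T ^ (1 / 2 : ℝ) * (t - s) ^ (-(1 / 2) : ℝ))) := by
          gcongr
          refine h3.trans ?_
          gcongr
          exact h4.trans (by gcongr)
      _ = _ := by ring

/-- The kernel `f` is `(t - s) ^ (-1/2)` times a kernel with partial derivatives: its own partial
derivatives are those of the singular factor up to remainders of order `(t - s) ^ (-γ)`. -/
structure HasSqrtSingularDeriv (T S γ : ℝ) (f a b : ℝ → ℝ → ℝ) : Prop where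
  left : ∀ t s, 0 < s → s < t → t < T →
    HasDerivAt (fun τ => f τ s) (a t s - f t s / (2 * (t - s))) t
  left_bdd : ∀ t s, 0 < s → s < t → t < T → |a t s| ≤ S * (t - s) ^ (-γ)
  right : ∀ t s, 0 < s → s < t → t < T →
    HasDerivAt (fun σ => f t σ) (b t s + f t s / (2 * (t - s))) s
  right_bdd : ∀ t s, 0 < s → s < t → t < T → |b t s| ≤ S * (t - s) ^ (-γ)

theorem HasSqrtSingularDeriv.reflect {S γ : ℝ} {f a b : ℝ → ℝ → ℝ}
    (h : HasSqrtSingularDeriv T S γ f a b) :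
    HasSqrtSingularDeriv T S γ (fun t s => f (T - s) (T - t))
      (fun t s => -b (T - s) (T - t)) (fun t s => -a (T - s) (T - t)) where
  left t s hs hst ht := by
    have := (h.right (T - s) (T - t) (by linarith) (by linarith) (by linarith)).comp_const_sub T t
    rw [sub_sub_sub_cancel_left] at this
    exact this.congr_deriv (by ring)
  left_bdd t s hs hst ht := by
    have := h.right_bdd (T - s) (T - t) (by linarith) (by linarith) (by linarith)
    rwa [sub_sub_sub_cancel_left, ← abs_neg] at this
  right t s hs hst ht := by
    have := (h.left (T - s) (T - t) (by linarith) (by linarith) (by linarith)).comp_const_sub T s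
    rw [sub_sub_sub_cancel_left] at this
    exact this.congr_deriv (by ring)
  right_bdd t s hs hst ht := by
    have := h.left_bdd (T - s) (T - t) (by linarith) (by linarith) (by linarith)
    rwa [sub_sub_sub_cancel_left, ← abs_neg] at this

/-- Derivatives in the first variable of a reflected kernel are derivatives in the second
variable of the original one. -/
theorem hasDerivAt_of_reflect {C t s : ℝ} {d : ℝ → ℝ → ℝ}
    (h : ∀ t s, 0 < s → s < t → t < T →
      HasDerivAt (fun τ => A (T - s) (T - τ)) (d t s) t ∧ |d t s| ≤ C * (t - s) ^ (-(1 / 2) : ℝ))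
    (hs : 0 < s) (hst : s < t) (ht : t < T) :
    HasDerivAt (fun σ => A t σ) (-d (T - s) (T - t)) s ∧
      |-d (T - s) (T - t)| ≤ C * (t - s) ^ (-(1 / 2) : ℝ) := by
  obtain ⟨h1, h2⟩ := h (T - s) (T - t) (by linarith) (by linarith) (by linarith)
  rw [sub_sub_sub_cancel_left, ← abs_neg] at h2
  refine ⟨?_, h2⟩
  simpa only [sub_sub_cancel] using h1.comp_const_sub T s

theorem exists_hasDerivAt_resolvent_left {f a b R G : ℝ → ℝ → ℝ} {S γ : ℝ} (hT : 0 < T)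
    (hS : 0 < S) (hγ : 1 / 2 ≤ γ) (hγ1 : γ < 1) (hf : IsWeaklySingular T f)
    (hR : IsWeaklySingular T R) (h : HasSqrtSingularDeriv T S γ f a b)
    (hG : ∀ t s, 0 < s → s < t → t < T →
      G t s = VolterraKernel.comp f f t s +
        VolterraKernel.comp (VolterraKernel.comp f f) R t s) :
    ∃ C : ℝ, 0 < C ∧ ∃ d : ℝ → ℝ → ℝ, ∀ t s, 0 < s → s < t → t < T →
      HasDerivAt (fun τ => G τ s) (d t s) t ∧ |d t s| ≤ C * (t - s) ^ (-(1 / 2) : ℝ) := by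
  obtain ⟨C₁, hC₁, d₁, h₁⟩ :=
    exists_hasDerivAt_comp_self hf hT hS hγ hγ1 h.left h.left_bdd h.right h.right_bdd
  have hr := h.reflect
  obtain ⟨C₂, hC₂, d₂, h₂⟩ :=
    exists_hasDerivAt_comp_self hf.reflect hT hS hγ hγ1 hr.left hr.left_bdd hr.right hr.right_bdd
  simp only [comp_reflect] at h₂
  obtain ⟨N, hN, hfN⟩ := exists_abs_comp_le hf hf
  have hnn : ∀ {t s : ℝ}, s < t → 0 ≤ (t - s) ^ (-(1 / 2) : ℝ) := fun hst =>
    Real.rpow_nonneg (by linarith) _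
  obtain ⟨C₃, hC₃, d₃, h₃⟩ := exists_hasDerivAt_comp (C := C₁ + C₂) hT (hf.comp hf) hR hN
    (by positivity) hfN
    (fun t s hs hst ht => ⟨(h₁ t s hs hst ht).1, (h₁ t s hs hst ht).2.trans
      (mul_le_mul_of_nonneg_right (by linarith) (hnn hst))⟩)
    (fun t s hs hst ht => ⟨(hasDerivAt_of_reflect h₂ hs hst ht).1,
      (hasDerivAt_of_reflect h₂ hs hst ht).2.trans
        (mul_le_mul_of_nonneg_right (by linarith) (hnn hst))⟩)
  refine ⟨C₁ + C₃, by positivity, fun t s => d₁ t s + d₃ t s, fun t s hs hst ht => ⟨?_, ?_⟩⟩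
  · refine ((h₁ t s hs hst ht).1.add (h₃ t s hs hst ht).1).congr_of_eventuallyEq ?_
    filter_upwards [Ioo_mem_nhds hst ht] with τ hτ
    exact hG τ s hs hτ.1 hτ.2
  · rw [add_mul]
    exact (abs_add_le _ _).trans (add_le_add (h₁ t s hs hst ht).2 (h₃ t s hs hst ht).2)

/-- If `G` solves both resolvent equations with square `f * f`, it has partial derivatives with at
most inverse square root singularities. -/
theorem exists_hasDerivAt_resolvent {f a b R G : ℝ → ℝ → ℝ} {S γ : ℝ} (hT : 0 < T)
    (hS : 0 < S) (hγ : 1 / 2 ≤ γ) (hγ1 : γ < 1) (hf : IsWeaklySingular T f)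
    (hR : IsWeaklySingular T R) (h : HasSqrtSingularDeriv T S γ f a b)
    (hG : ∀ t s, 0 < s → s < t → t < T →
      G t s = VolterraKernel.comp f f t s +
        VolterraKernel.comp (VolterraKernel.comp f f) R t s)
    (hG' : ∀ t s, 0 < s → s < t → t < T →
      G t s = VolterraKernel.comp f f t s +
        VolterraKernel.comp R (VolterraKernel.comp f f) t s) :
    ∃ C : ℝ, 0 < C ∧ ∀ t s, 0 < s → s < t → t < T →
      (∃ d : ℝ, HasDerivAt (fun τ => G τ s) d t ∧ |d| ≤ C * (t - s) ^ (-(1 / 2) : ℝ)) ∧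
      ∃ d : ℝ, HasDerivAt (fun σ => G t σ) d s ∧ |d| ≤ C * (t - s) ^ (-(1 / 2) : ℝ) := by
  obtain ⟨C₁, hC₁, d₁, h₁⟩ :=
    exists_hasDerivAt_resolvent_left hT hS hγ hγ1 hf hR h hG
  obtain ⟨C₂, hC₂, d₂, h₂⟩ :=
    exists_hasDerivAt_resolvent_left (G := fun t s => G (T - s) (T - t)) hT hS hγ hγ1 hf.reflect
      hR.reflect h.reflect fun t s hs hst ht => by
        have hc : VolterraKernel.comp (fun t s => f (T - s) (T - t))
            (fun t s => f (T - s) (T - t)) =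
            fun t s => VolterraKernel.comp f f (T - s) (T - t) := by
          funext t s
          exact comp_reflect f f t s
        rw [hc, comp_reflect, hG' (T - s) (T - t) (by linarith) (by linarith) (by linarith)]
  have hnn : ∀ {t s : ℝ}, s < t → 0 ≤ (t - s) ^ (-(1 / 2) : ℝ) := fun hst =>
    Real.rpow_nonneg (by linarith) _
  exact ⟨C₁ + C₂, by positivity, fun t s hs hst ht =>
    ⟨⟨_, (h₁ t s hs hst ht).1, (h₁ t s hs hst ht).2.trans
      (mul_le_mul_of_nonneg_right (by linarith) (hnn hst))⟩,
    ⟨_, (hasDerivAt_of_reflect h₂ hs hst ht).1, (hasDerivAt_of_reflect h₂ hs hst ht).2.trans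
      (mul_le_mul_of_nonneg_right (by linarith) (hnn hst))⟩⟩⟩

theorem IsWeaklySingular.congr (hA : IsWeaklySingular T A)
    (h : ∀ t s, 0 < s → s < t → t < T → B t s = A t s) : IsWeaklySingular T B where
  cont := hA.cont.congr fun p hp => h p.1 p.2 hp.1 hp.2.1 hp.2.2
  bdd := by
    obtain ⟨C, hC, hAC⟩ := hA.bdd
    exact ⟨C, hC, fun t s hs hst ht => by rw [h t s hs hst ht]; exact hAC t s hs hst ht⟩

theorem IsWeaklySingular.zero : IsWeaklySingular T (fun _ _ => 0) :=
  .of_bounded (C := 0) continuousOn_const (by simp)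

theorem IsWeaklySingular.sum {P : ℕ → ℝ → ℝ → ℝ} (hP : ∀ n, IsWeaklySingular T (P n)) (N : ℕ) :
    IsWeaklySingular T (fun t s => ∑ n ∈ Finset.range N, P n t s) := by
  induction N with
  | zero => simpa using IsWeaklySingular.zero
  | succ N ih => simpa only [Finset.sum_range_succ] using ih.add (hP N)

theorem comp_sum_left {P : ℕ → ℝ → ℝ → ℝ} (hP : ∀ n, IsWeaklySingular T (P n))
    (hB : IsWeaklySingular T B) (N : ℕ) {t s : ℝ} (hs : 0 < s) (hst : s < t) (ht : t < T) :
    VolterraKernel.comp (fun t s => ∑ n ∈ Finset.range N, P n t s) B t s =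
      ∑ n ∈ Finset.range N, VolterraKernel.comp (P n) B t s := by
  induction N with
  | zero => simp [VolterraKernel.comp]
  | succ N ih =>
    simp only [Finset.sum_range_succ]
    rw [comp_add_left (.sum hP N) (hP N) hB hs hst ht, ih]

theorem comp_sum_right {P : ℕ → ℝ → ℝ → ℝ} (hP : ∀ n, IsWeaklySingular T (P n))
    (hB : IsWeaklySingular T B) (N : ℕ) {t s : ℝ} (hs : 0 < s) (hst : s < t) (ht : t < T) :
    VolterraKernel.comp B (fun t s => ∑ n ∈ Finset.range N, P n t s) t s =
      ∑ n ∈ Finset.range N, VolterraKernel.comp B (P n) t s := by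
  induction N with
  | zero => simp [VolterraKernel.comp]
  | succ N ih =>
    simp only [Finset.sum_range_succ]
    rw [comp_add_right hB (.sum hP N) (hP N) hs hst ht, ih]

section Iterates

variable {f : ℝ → ℝ → ℝ} {E : ℕ → ℝ → ℝ → ℝ}

theorem isWeaklySingular_iterate (hf : IsWeaklySingular T f) (h0 : E 0 = f)
    (hE : ∀ n t s, 0 < s → s < t → t < T → E (n + 1) t s = VolterraKernel.comp (E n) f t s)
    (n : ℕ) : IsWeaklySingular T (E n) := by
  induction n with
  | zero => rwa [h0]
  | succ n ih => exact (ih.comp hf).congr (hE n)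

theorem comp_iterate_one (hf : IsWeaklySingular T f) (h0 : E 0 = f)
    (hE : ∀ n t s, 0 < s → s < t → t < T → E (n + 1) t s = VolterraKernel.comp (E n) f t s)
    (n : ℕ) {t s : ℝ} (hs : 0 < s) (hst : s < t) (ht : t < T) :
    VolterraKernel.comp (E n) (E 1) t s = E (n + 2) t s := by
  have h1 : ∀ t s, 0 < s → s < t → t < T → E 1 t s = VolterraKernel.comp f f t s := by
    simpa only [h0] using hE 0
  rw [hE (n + 1) t s hs hst ht, comp_congr (hE n) (fun _ _ _ _ _ => rfl) hs hst ht,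
    comp_assoc (isWeaklySingular_iterate hf h0 hE n) hf hf hs hst ht,
    comp_congr (fun _ _ _ _ _ => rfl) h1 hs hst ht]

theorem comp_one_iterate (hf : IsWeaklySingular T f) (h0 : E 0 = f)
    (hE : ∀ n t s, 0 < s → s < t → t < T → E (n + 1) t s = VolterraKernel.comp (E n) f t s)
    (n : ℕ) : ∀ t s, 0 < s → s < t → t < T →
    VolterraKernel.comp (E 1) (E n) t s = E (n + 2) t s := by
  have hw := isWeaklySingular_iterate hf h0 hE
  induction n with
  | zero =>
    intro t s hs hst ht
    rw [h0]
    exact (hE 1 t s hs hst ht).symm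
  | succ n ih =>
    intro t s hs hst ht
    rw [comp_congr (fun _ _ _ _ _ => rfl) (hE n) hs hst ht,
      ← comp_assoc (hw 1) (hw n) hf hs hst ht, comp_congr ih (fun _ _ _ _ _ => rfl) hs hst ht]
    exact (hE (n + 2) t s hs hst ht).symm

variable {G : ℝ → ℝ → ℝ}

theorem exists_abs_sum_iterate_le (hf : IsWeaklySingular T f) (h0 : E 0 = f)
    (hE : ∀ n t s, 0 < s → s < t → t < T → E (n + 1) t s = VolterraKernel.comp (E n) f t s)
    (hG : TendstoUniformlyOn
      (fun (N : ℕ) (p : ℝ × ℝ) => ∑ n ∈ Finset.range N, E (n + 1) p.1 p.2)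
      (fun p => G p.1 p.2) atTop (triangle T)) :
    ∃ C : ℝ, (∀ t s, 0 < s → s < t → t < T → |G t s| ≤ C) ∧ ∀ᶠ N in atTop,
      ∀ t s, 0 < s → s < t → t < T → |∑ n ∈ Finset.range N, E (n + 1) t s| ≤ C := by
  have hw := isWeaklySingular_iterate hf h0 hE
  have hb : ∀ n, ∃ C : ℝ, ∀ t s, 0 < s → s < t → t < T → |E (n + 1) t s| ≤ C := fun n => by
    obtain ⟨C, -, hC⟩ := exists_abs_comp_le (hw n) hf
    exact ⟨C, fun t s hs hst ht => by rw [hE n t s hs hst ht]; exact hC t s hs hst ht⟩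
  choose c hc using hb
  have hev := Metric.tendstoUniformlyOn_iff.1 hG 1 one_pos
  obtain ⟨N, hN⟩ := hev.exists
  have hGb : ∀ t s, 0 < s → s < t → t < T → |G t s| ≤ 1 + ∑ n ∈ Finset.range N, c n := by
    intro t s hs hst ht
    have h1 := hN (t, s) ⟨hs, hst, ht⟩
    rw [Real.dist_eq] at h1
    have h2 : |∑ n ∈ Finset.range N, E (n + 1) t s| ≤ ∑ n ∈ Finset.range N, c n :=
      (Finset.abs_sum_le_sum_abs _ _).trans
        (Finset.sum_le_sum fun n _ => hc n t s hs hst ht)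
    have h3 := abs_sub_abs_le_abs_sub (G t s) (∑ n ∈ Finset.range N, E (n + 1) t s)
    linarith
  refine ⟨2 + ∑ n ∈ Finset.range N, c n, fun t s hs hst ht => ?_, ?_⟩
  · linarith [hGb t s hs hst ht]
  · filter_upwards [hev] with m hm t s hs hst ht
    have h1 := hm (t, s) ⟨hs, hst, ht⟩
    rw [dist_comm, Real.dist_eq] at h1
    have h3 := abs_sub_abs_le_abs_sub (∑ n ∈ Finset.range m, E (n + 1) t s) (G t s)
    linarith [hGb t s hs hst ht]

theorem isWeaklySingular_sum_iterate (hf : IsWeaklySingular T f) (h0 : E 0 = f)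
    (hE : ∀ n t s, 0 < s → s < t → t < T → E (n + 1) t s = VolterraKernel.comp (E n) f t s)
    (hG : TendstoUniformlyOn
      (fun (N : ℕ) (p : ℝ × ℝ) => ∑ n ∈ Finset.range N, E (n + 1) p.1 p.2)
      (fun p => G p.1 p.2) atTop (triangle T)) : IsWeaklySingular T G := by
  obtain ⟨C, hC, -⟩ := exists_abs_sum_iterate_le hf h0 hE hG
  exact .of_bounded (hG.continuousOn (.of_forall fun N =>
    (IsWeaklySingular.sum (fun n => isWeaklySingular_iterate hf h0 hE (n + 1)) N).cont)) hC

/-- The two resolvent equations for the sum of the iterates of `f`, with kernel `f * f`. -/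
theorem sum_iterate_eq (hf : IsWeaklySingular T f) (h0 : E 0 = f)
    (hE : ∀ n t s, 0 < s → s < t → t < T → E (n + 1) t s = VolterraKernel.comp (E n) f t s)
    (hG : TendstoUniformlyOn
      (fun (N : ℕ) (p : ℝ × ℝ) => ∑ n ∈ Finset.range N, E (n + 1) p.1 p.2)
      (fun p => G p.1 p.2) atTop (triangle T)) {t s : ℝ} (hs : 0 < s) (hst : s < t)
    (ht : t < T) :
    G t s = VolterraKernel.comp f f t s + VolterraKernel.comp (VolterraKernel.comp f f)
        (fun t s => f t s + G t s) t s ∧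
      G t s = VolterraKernel.comp f f t s + VolterraKernel.comp (fun t s => f t s + G t s)
        (VolterraKernel.comp f f) t s := by
  have hw := isWeaklySingular_iterate hf h0 hE
  have hGw := isWeaklySingular_sum_iterate hf h0 hE hG
  have h1 : ∀ t s, 0 < s → s < t → t < T → VolterraKernel.comp f f t s = E 1 t s :=
    fun t s hs hst ht => by rw [hE 0 t s hs hst ht, h0]
  obtain ⟨C, -, hC⟩ := exists_abs_sum_iterate_le hf h0 hE hG
  have hlim : ∀ t s, 0 < s → s < t → t < T →
      Tendsto (fun N => ∑ n ∈ Finset.range N, E (n + 1) t s) atTop (𝓝 (G t s)) :=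
    fun t s hs hst ht => hG.tendsto_at (x := (t, s)) ⟨hs, hst, ht⟩
  have htail : Tendsto (fun N => ∑ n ∈ Finset.range N, E (n + 3) t s) atTop
      (𝓝 (G t s - (E 1 t s + E 2 t s))) := by
    refine (((tendsto_add_atTop_iff_nat 2).2 (hlim t s hs hst ht)).sub_const
      (E 1 t s + E 2 t s)).congr fun N => ?_
    rw [Finset.sum_range_succ', Finset.sum_range_succ']
    ring
  have hsum : ∀ N, IsWeaklySingular T (fun t s => ∑ n ∈ Finset.range N, E (n + 1) t s) :=
    IsWeaklySingular.sum fun n => hw (n + 1)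
  have hl := tendsto_nhds_unique (tendsto_comp_left hsum (hw 1) hC hlim hs hst ht)
    (htail.congr fun N => by
      rw [comp_sum_left (fun n => hw (n + 1)) (hw 1) N hs hst ht]
      exact Finset.sum_congr rfl fun n _ => (comp_iterate_one hf h0 hE (n + 1) hs hst ht).symm)
  have hr := tendsto_nhds_unique (tendsto_comp_right hsum (hw 1) hC hlim hs hst ht)
    (htail.congr fun N => by
      rw [comp_sum_right (fun n => hw (n + 1)) (hw 1) N hs hst ht]
      exact Finset.sum_congr rfl fun n _ => (comp_one_iterate hf h0 hE (n + 1) t s hs hst ht).symm)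
  have hl0 := comp_iterate_one hf h0 hE 0 hs hst ht
  have hr0 := comp_one_iterate hf h0 hE 0 t s hs hst ht
  rw [h0] at hl0 hr0
  constructor
  · rw [comp_congr h1 (fun _ _ _ _ _ => rfl) hs hst ht, h1 t s hs hst ht,
      comp_add_right (hw 1) hf hGw hs hst ht, hr, hr0]
    ring
  · rw [comp_congr (fun _ _ _ _ _ => rfl) h1 hs hst ht, h1 t s hs hst ht,
      comp_add_left hf hGw (hw 1) hs hst ht, hl, hl0]
    ring

end Iterates

theorem inv_sqrt_eq_rpow {x : ℝ} (hx : 0 ≤ x) : (√x)⁻¹ = x ^ (-(1 / 2) : ℝ) := by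
  rw [Real.sqrt_eq_rpow, Real.rpow_neg hx]

theorem abs_div_sqrt_le {S α γ x y : ℝ} (hS : 0 ≤ S) (hx : 0 < x) (hxT : x ≤ T)
    (hγ : α + 1 / 2 ≤ γ) (hy : |y| ≤ S / x ^ α) :
    |y / √x| ≤ S * T ^ (γ - (α + 1 / 2)) * x ^ (-γ) := by
  rw [abs_div, abs_of_nonneg (Real.sqrt_nonneg x), div_eq_mul_inv, inv_sqrt_eq_rpow hx.le]
  calc |y| * x ^ (-(1 / 2) : ℝ) ≤ S / x ^ α * x ^ (-(1 / 2) : ℝ) := by gcongr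
    _ = S * x ^ (-(α + 1 / 2)) := by
      rw [div_eq_mul_inv, ← Real.rpow_neg hx.le, mul_assoc, ← Real.rpow_add hx]
      congr 2
      ring
    _ ≤ S * (T ^ (γ - (α + 1 / 2)) * x ^ (-γ)) :=
      mul_le_mul_of_nonneg_left (rpow_neg_le_mul_rpow_neg hx hxT hγ) hS
    _ = _ := by ring

theorem hasDerivAt_of_mul_sqrt {g r : ℝ → ℝ} {x d r' : ℝ} (hr : HasDerivAt r r' x)
    (hpos : 0 < r x) (h : HasDerivAt (fun y => g y * √(r y)) d x) :
    HasDerivAt g (d / √(r x) - r' * (g x / (2 * r x))) x := by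
  have hsq : 0 < √(r x) := Real.sqrt_pos.2 hpos
  have h1 := h.div (hr.sqrt hpos.ne') hsq.ne'
  refine (h1.congr_of_eventuallyEq ?_).congr_deriv ?_
  · filter_upwards [hr.continuousAt.eventually (lt_mem_nhds hpos)] with y hy
    exact (mul_div_cancel_right₀ _ (Real.sqrt_pos.2 hy).ne').symm
  · rw [Real.sq_sqrt hpos.le]
    have : r x = √(r x) * √(r x) := (Real.mul_self_sqrt hpos.le).symm
    generalize √(r x) = q at *
    rw [this]
    field_simp

theorem hasSqrtSingularDeriv_of_mul_sqrt {f Dt Ds : ℝ → ℝ → ℝ} {S α γ : ℝ} (hS : 0 ≤ S)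
    (hγ : α + 1 / 2 ≤ γ)
    (hDt : ∀ t s : ℝ, 0 < s → s < t → t < T →
      HasDerivAt (fun τ => f τ s * √(τ - s)) (Dt t s) t ∧ |Dt t s| ≤ S / (t - s) ^ α)
    (hDs : ∀ t s : ℝ, 0 < s → s < t → t < T →
      HasDerivAt (fun σ => f t σ * √(t - σ)) (Ds t s) s ∧ |Ds t s| ≤ S / (t - s) ^ α) :
    HasSqrtSingularDeriv T (S * T ^ (γ - (α + 1 / 2))) γ f
      (fun t s => Dt t s / √(t - s)) (fun t s => Ds t s / √(t - s)) where
  left t s hs hst ht :=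
    (hasDerivAt_of_mul_sqrt ((hasDerivAt_id t).sub_const s) (sub_pos.2 hst)
      (hDt t s hs hst ht).1).congr_deriv (by simp)
  left_bdd t s hs hst ht :=
    abs_div_sqrt_le hS (sub_pos.2 hst) (by linarith) hγ (hDt t s hs hst ht).2
  right t s hs hst ht :=
    (hasDerivAt_of_mul_sqrt ((hasDerivAt_id s).const_sub t) (sub_pos.2 hst)
      (hDs t s hs hst ht).1).congr_deriv (by simp)
  right_bdd t s hs hst ht :=
    abs_div_sqrt_le hS (sub_pos.2 hst) (by linarith) hγ (hDs t s hs hst ht).2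

/-- Integration over `(0, T)` of kernels vanishing off the triangle is their composition. -/
theorem integral_eq_comp {t s : ℝ} (hs : 0 < s) (hst : s < t) (ht : t < T)
    (hA : ∀ z, t ≤ z → A t z = 0) (hB : ∀ z, z ≤ s → B z s = 0) :
    ∫ z in (0 : ℝ)..T, A t z * B z s = VolterraKernel.comp A B t s := by
  rw [VolterraKernel.comp, intervalIntegral.integral_of_le (by linarith),
    intervalIntegral.integral_of_le hst.le]
  refine setIntegral_eq_of_subset_of_forall_sdiff_eq_zero measurableSet_Ioc
    (Ioc_subset_Ioc hs.le ht.le) fun z hz => ?_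
  rcases le_or_gt z s with h | h
  · rw [hB z h, mul_zero]
  · rw [hA z (le_of_lt (not_le.1 fun h' => hz.2 ⟨h, h'⟩)), zero_mul]

end VolterraKernel

open VolterraKernel

/-- With `K`, `H₁`, `H_n` as in the iterated-kernel construction and
`G = Σ_{n≥2} H_n` (converging uniformly on `[0,T]²`), if
`h₁(t,s) = H₁(t,s)√(t-s)` has partial derivatives bounded by `S/(t-s)^α` with
`α < 1/2`, then `G` has partial derivatives on `C_T` bounded by `S̄/(t-s)^{1/2}`. -/
theorem stmt9 (T M S α : ℝ) (hT : 0 < T) (hM : 0 < M) (hS : 0 < S) (hα : α < 1/2)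
    (K : ℝ → ℝ → ℝ)
    (hKcont : ContinuousOn (fun p : ℝ × ℝ => K p.1 p.2)
      {p : ℝ × ℝ | 0 < p.2 ∧ p.2 < p.1 ∧ p.1 < T})
    (hKbd : ∀ t s : ℝ, 0 < s → s < t → t < T → |K t s| ≤ M / Real.sqrt (t - s))
    (H : ℕ → ℝ → ℝ → ℝ)
    (hH1 : ∀ t s : ℝ, H 1 t s = K t s * Set.indicator (Set.Ioo 0 t) (fun _ => (1:ℝ)) s)
    (hHrec : ∀ n : ℕ, 2 ≤ n → ∀ t s : ℝ,
      H n t s = ∫ z in (0:ℝ)..T, H (n-1) t z * H 1 z s)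
    (G : ℝ → ℝ → ℝ)
    (hG : ∀ t s : ℝ, HasSum (fun n : ℕ => H (n+2) t s) (G t s))
    (hGunif : TendstoUniformlyOn
      (fun (N : ℕ) (p : ℝ × ℝ) => ∑ n ∈ Finset.range N, H (n+2) p.1 p.2)
      (fun p : ℝ × ℝ => G p.1 p.2) Filter.atTop (Set.Icc 0 T ×ˢ Set.Icc 0 T))
    (Dt Ds : ℝ → ℝ → ℝ)
    (hDt : ∀ t s : ℝ, 0 < s → s < t → t < T →
      HasDerivAt (fun τ => H 1 τ s * Real.sqrt (τ - s)) (Dt t s) t ∧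
        |Dt t s| ≤ S / (t - s) ^ α)
    (hDs : ∀ t s : ℝ, 0 < s → s < t → t < T →
      HasDerivAt (fun σ => H 1 t σ * Real.sqrt (t - σ)) (Ds t s) s ∧
        |Ds t s| ≤ S / (t - s) ^ α) :
    ∃ S' : ℝ, 0 < S' ∧ ∀ t s : ℝ, 0 < s → s < t → t < T →
      (∃ d : ℝ, HasDerivAt (fun τ => G τ s) d t ∧ |d| ≤ S' / Real.sqrt (t - s)) ∧
      (∃ d : ℝ, HasDerivAt (fun σ => G t σ) d s ∧ |d| ≤ S' / Real.sqrt (t - s)) := by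
  have hzero : ∀ t s, t ≤ s → H 1 t s = 0 := fun t s h => by
    rw [hH1, Set.indicator_of_notMem fun hs => absurd hs.2 h.not_gt, mul_zero]
  have hK : IsWeaklySingular T K := ⟨hKcont, M, hM, fun t s hs hst ht => by
    rw [← inv_sqrt_eq_rpow (by linarith), ← div_eq_mul_inv]
    exact hKbd t s hs hst ht⟩
  have hf : IsWeaklySingular T (H 1) := hK.congr fun t s hs hst _ => by
    rw [hH1, Set.indicator_of_mem (Set.mem_Ioo.2 ⟨hs, hst⟩), mul_one]
  have hvanish : ∀ n t s, t ≤ s → H (n + 1) t s = 0 := by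
    intro n
    induction n with
    | zero => exact hzero
    | succ n ih =>
      intro t s hts
      rw [hHrec (n + 1 + 1) (by omega)]
      refine intervalIntegral.integral_zero_ae (.of_forall fun z _ => ?_)
      rcases le_total t z with h | h
      · rw [Nat.add_sub_cancel, ih t z h, zero_mul]
      · rw [hzero z s (h.trans hts), mul_zero]
  have hE : ∀ n t s, 0 < s → s < t → t < T →
      H (n + 1 + 1) t s = VolterraKernel.comp (H (n + 1)) (H 1) t s := by
    intro n t s hs hst ht
    rw [hHrec (n + 1 + 1) (by omega), Nat.add_sub_cancel]
    exact integral_eq_comp hs hst ht (hvanish n t) (fun z => hzero z s)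
  have hG' : TendstoUniformlyOn
      (fun (N : ℕ) (p : ℝ × ℝ) => ∑ n ∈ Finset.range N, H (n + 1 + 1) p.1 p.2)
      (fun p => G p.1 p.2) Filter.atTop (triangle T) :=
    hGunif.mono fun p hp => ⟨⟨(hp.1.trans hp.2.1).le, hp.2.2.le⟩,
      ⟨hp.1.le, (hp.2.1.trans hp.2.2).le⟩⟩
  have hR := hf.add (isWeaklySingular_sum_iterate (E := fun n => H (n + 1)) hf rfl hE hG')
  obtain ⟨C, hC, h⟩ := exists_hasDerivAt_resolvent hT (by positivity)
    (γ := max α 0 + 1 / 2) (by linarith [le_max_right α 0])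
    (by linarith [max_lt hα (by norm_num : (0 : ℝ) < 1 / 2)]) hf hR
    (hasSqrtSingularDeriv_of_mul_sqrt hS.le (by linarith [le_max_left α 0]) hDt hDs)
    (fun t s hs hst ht =>
      (sum_iterate_eq (E := fun n => H (n + 1)) hf rfl hE hG' hs hst ht).1)
    (fun t s hs hst ht =>
      (sum_iterate_eq (E := fun n => H (n + 1)) hf rfl hE hG' hs hst ht).2)
  refine ⟨C, hC, fun t s hs hst ht => ?_⟩
  rw [div_eq_mul_inv, inv_sqrt_eq_rpow (by linarith)]
  exact h t s hs hst ht
end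

section
/- Let γ ∈ (0,1] and let g₁, g₂ be bounded Hölder continuous functions of order γ on C_T := {(t,s) ∈ (0,T)×(0,T) : s < t}. Then the function h(t,s) = ∫_s^t g₁(t,z) g₂(z,s) / ( √(t−z) · √(z−s) ) dz is Hölder continuous of order γ on C_T. -/
open MeasureTheory

lemma integrableOn_inv_sqrt_one_sub_mul_sqrt :
    IntegrableOn (fun u : ℝ => (√(1 - u) * √u)⁻¹) (Set.Ioo 0 1) := by
  have h₁ : IntervalIntegrable (fun u : ℝ => u ^ (-(1 / 2) : ℝ)) volume 0 1 :=
    intervalIntegral.intervalIntegrable_rpow' (by norm_num)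
  have h₂ : IntervalIntegrable (fun u : ℝ => (1 - u) ^ (-(1 / 2) : ℝ)) volume 0 1 := by
    simpa using (h₁.comp_sub_left 1).symm
  have h := ((intervalIntegrable_iff_integrableOn_Ioo_of_le zero_le_one).1 (h₁.add h₂))
  refine Integrable.mono' h (by fun_prop) ?_
  filter_upwards [ae_restrict_mem measurableSet_Ioo] with u hu
  obtain ⟨hu₀, hu₁⟩ := hu
  have ha : 0 < √u := Real.sqrt_pos.2 hu₀
  have hb : 0 < √(1 - u) := Real.sqrt_pos.2 (by linarith)
  have ha₁ : √u ≤ 1 := Real.sqrt_le_one.2 hu₁.le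
  have hb₁ : √(1 - u) ≤ 1 := Real.sqrt_le_one.2 (by linarith)
  have hsum : √u ^ 2 + √(1 - u) ^ 2 = 1 := by
    rw [Real.sq_sqrt hu₀.le, Real.sq_sqrt (by linarith)]; ring
  rw [Real.rpow_neg hu₀.le, Real.rpow_neg (by linarith), ← Real.sqrt_eq_rpow,
    ← Real.sqrt_eq_rpow, Real.norm_of_nonneg (by positivity),
    inv_add_inv ha.ne' hb.ne', mul_comm, inv_eq_one_div]
  gcongr
  nlinarith

lemma integral_div_sqrt_mul_sqrt_eq {s t : ℝ} (hst : s < t) (f : ℝ → ℝ) :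
    ∫ z in s..t, f z / (√(t - z) * √(z - s)) =
      ∫ u in Set.Ioo (0 : ℝ) 1, f (s + (t - s) * u) * (√(1 - u) * √u)⁻¹ := by
  have hpos : 0 < t - s := sub_pos.2 hst
  have hcv := intervalIntegral.mul_integral_comp_add_mul (a := 0) (b := 1)
    (f := fun z => f z / (√(t - z) * √(z - s))) (t - s) s
  simp only [mul_zero, add_zero, mul_one, add_sub_cancel] at hcv
  rw [← hcv, ← intervalIntegral.integral_const_mul,
    intervalIntegral.integral_of_le zero_le_one, integral_Ioc_eq_integral_Ioo]
  refine integral_congr_ae (.of_forall fun u => ?_)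
  have h₁ : t - (s + (t - s) * u) = (t - s) * (1 - u) := by ring
  have h₂ : s + (t - s) * u - s = (t - s) * u := by ring
  simp only
  rw [h₁, h₂, Real.sqrt_mul hpos.le, Real.sqrt_mul hpos.le, mul_mul_mul_comm,
    Real.mul_self_sqrt hpos.le, div_eq_mul_inv, mul_inv]
  field_simp

lemma continuousOn_of_abs_sub_le_mul_dist_rpow {X : Type*} [PseudoMetricSpace X] {E : Set X}
    {f : X → ℝ} {C γ : ℝ} (hγ : 0 < γ)
    (hf : ∀ p ∈ E, ∀ q ∈ E, |f p - f q| ≤ C * dist p q ^ γ) : ContinuousOn f E := by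
  intro q hq
  rw [ContinuousWithinAt, tendsto_iff_dist_tendsto_zero]
  have hlim : Filter.Tendsto (fun p => C * dist p q ^ γ) (nhdsWithin q E) (nhds 0) := by
    have hcont : Continuous fun p => C * dist p q ^ γ :=
      continuous_const.mul ((continuous_id.dist continuous_const).rpow_const fun _ => .inr hγ.le)
    simpa [Real.zero_rpow hγ.ne'] using (hcont.tendsto q).mono_left nhdsWithin_le_nhds
  refine squeeze_zero' (.of_forall fun _ => dist_nonneg) ?_ hlim
  filter_upwards [self_mem_nhdsWithin] with p hp
  exact hf p hp q hq

lemma abs_mul_sub_mul_le {a b a' b' A B α β : ℝ} (ha : |a| ≤ A) (hb' : |b'| ≤ B)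
    (haa' : |a - a'| ≤ α) (hbb' : |b - b'| ≤ β) :
    |a * b - a' * b'| ≤ A * β + α * B := by
  calc |a * b - a' * b'| = |a * (b - b') + (a - a') * b'| := by ring_nf
    _ ≤ |a| * |b - b'| + |a - a'| * |b'| := by
      simpa only [abs_mul] using abs_add_le (a * (b - b')) ((a - a') * b')
    _ ≤ A * β + α * B := by
      have := abs_nonneg a
      have := abs_nonneg (a - a')
      gcongr <;> linarith

lemma dist_convex_combination_le (p q : ℝ × ℝ) {u : ℝ} (hu : u ∈ Set.Ioo (0 : ℝ) 1) :
    dist (p.2 + (p.1 - p.2) * u) (q.2 + (q.1 - q.2) * u) ≤ dist p q := by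
  have h₁ : |p.1 - q.1| ≤ dist p q := le_max_left _ _
  have h₂ : |p.2 - q.2| ≤ dist p q := le_max_right _ _
  rw [abs_le] at h₁ h₂
  obtain ⟨hu₀, hu₁⟩ := hu
  rw [Real.dist_eq, abs_le]
  constructor <;> nlinarith

/-- If `g₁, g₂` are bounded and Hölder continuous of order `γ` on the
open triangle `C_T = {(t,s) : 0 < s < t < T}`, then
`h(t,s) = ∫_s^t g₁(t,z) g₂(z,s)/(√(t-z) √(z-s)) dz` is Hölder continuous of order `γ`
on `C_T`. -/
theorem stmt10 (T γ : ℝ) (hT : 0 < T) (hγ0 : 0 < γ) (hγ1 : γ ≤ 1)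
    (g₁ g₂ : ℝ → ℝ → ℝ)
    (hbd1 : ∃ C : ℝ, ∀ t s : ℝ, 0 < s → s < t → t < T → |g₁ t s| ≤ C)
    (hbd2 : ∃ C : ℝ, ∀ t s : ℝ, 0 < s → s < t → t < T → |g₂ t s| ≤ C)
    (hhold1 : ∃ C : ℝ, 0 ≤ C ∧
      ∀ p ∈ {p : ℝ × ℝ | 0 < p.2 ∧ p.2 < p.1 ∧ p.1 < T},
      ∀ q ∈ {p : ℝ × ℝ | 0 < p.2 ∧ p.2 < p.1 ∧ p.1 < T},
        |g₁ p.1 p.2 - g₁ q.1 q.2| ≤ C * dist p q ^ γ)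
    (hhold2 : ∃ C : ℝ, 0 ≤ C ∧
      ∀ p ∈ {p : ℝ × ℝ | 0 < p.2 ∧ p.2 < p.1 ∧ p.1 < T},
      ∀ q ∈ {p : ℝ × ℝ | 0 < p.2 ∧ p.2 < p.1 ∧ p.1 < T},
        |g₂ p.1 p.2 - g₂ q.1 q.2| ≤ C * dist p q ^ γ) :
    ∃ C : ℝ, 0 ≤ C ∧
      ∀ p ∈ {p : ℝ × ℝ | 0 < p.2 ∧ p.2 < p.1 ∧ p.1 < T},
      ∀ q ∈ {p : ℝ × ℝ | 0 < p.2 ∧ p.2 < p.1 ∧ p.1 < T},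
        |(∫ z in p.2..p.1, g₁ p.1 z * g₂ z p.2 / (Real.sqrt (p.1 - z) * Real.sqrt (z - p.2)))
          - (∫ z in q.2..q.1, g₁ q.1 z * g₂ z q.2 / (Real.sqrt (q.1 - z) * Real.sqrt (z - q.2)))|
          ≤ C * dist p q ^ γ := by
  obtain ⟨A, hA⟩ := hbd1
  obtain ⟨B, hB⟩ := hbd2
  obtain ⟨K, hK₀, hK⟩ := hhold1
  obtain ⟨L, hL₀, hL⟩ := hhold2
  set E : Set (ℝ × ℝ) := {p : ℝ × ℝ | 0 < p.2 ∧ p.2 < p.1 ∧ p.1 < T}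
  set w : ℝ → ℝ := fun u => (√(1 - u) * √u)⁻¹
  have hw : IntegrableOn w (Set.Ioo 0 1) := integrableOn_inv_sqrt_one_sub_mul_sqrt
  have hw₀ (u : ℝ) : 0 ≤ w u := by positivity
  have hleft : ∀ p ∈ E, ∀ u ∈ Set.Ioo (0 : ℝ) 1, (p.1, p.2 + (p.1 - p.2) * u) ∈ E := by
    rintro p ⟨h₁, h₂, h₃⟩ u ⟨hu₀, hu₁⟩
    refine ⟨?_, ?_, h₃⟩ <;> dsimp only <;> nlinarith
  have hright : ∀ p ∈ E, ∀ u ∈ Set.Ioo (0 : ℝ) 1, (p.2 + (p.1 - p.2) * u, p.2) ∈ E := by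
    rintro p ⟨h₁, h₂, h₃⟩ u ⟨hu₀, hu₁⟩
    refine ⟨h₁, ?_, ?_⟩ <;> dsimp only <;> nlinarith
  have hbound₁ : ∀ p ∈ E, |g₁ p.1 p.2| ≤ A := fun p hp => hA _ _ hp.1 hp.2.1 hp.2.2
  have hbound₂ : ∀ p ∈ E, |g₂ p.1 p.2| ≤ B := fun p hp => hB _ _ hp.1 hp.2.1 hp.2.2
  have hA₀ : 0 ≤ A := (abs_nonneg _).trans
    (hbound₁ (2 * T / 3, T / 3) ⟨by dsimp; linarith, by dsimp; linarith, by dsimp; linarith⟩)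
  have hB₀ : 0 ≤ B := (abs_nonneg _).trans
    (hbound₂ (2 * T / 3, T / 3) ⟨by dsimp; linarith, by dsimp; linarith, by dsimp; linarith⟩)
  set F : ℝ × ℝ → ℝ → ℝ := fun p u =>
    g₁ p.1 (p.2 + (p.1 - p.2) * u) * g₂ (p.2 + (p.1 - p.2) * u) p.2
  have hint : ∀ p ∈ E, IntegrableOn (fun u => F p u * w u) (Set.Ioo 0 1) := by
    intro p hp
    have hc₁ : ContinuousOn (fun u => g₁ p.1 (p.2 + (p.1 - p.2) * u)) (Set.Ioo 0 1) :=
      (continuousOn_of_abs_sub_le_mul_dist_rpow hγ0 hK).comp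
        (f := fun u => (p.1, p.2 + (p.1 - p.2) * u)) (by fun_prop) (hleft p hp)
    have hc₂ : ContinuousOn (fun u => g₂ (p.2 + (p.1 - p.2) * u) p.2) (Set.Ioo 0 1) :=
      (continuousOn_of_abs_sub_le_mul_dist_rpow hγ0 hL).comp
        (f := fun u => (p.2 + (p.1 - p.2) * u, p.2)) (by fun_prop) (hright p hp)
    refine Integrable.bdd_mul (c := A * B) hw
      ((hc₁.mul hc₂).aestronglyMeasurable measurableSet_Ioo) ?_
    filter_upwards [ae_restrict_mem measurableSet_Ioo] with u hu
    rw [Real.norm_eq_abs, abs_mul]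
    exact mul_le_mul (hbound₁ _ (hleft p hp u hu)) (hbound₂ _ (hright p hp u hu))
      (abs_nonneg _) hA₀
  refine ⟨(A * L + K * B) * ∫ u in Set.Ioo 0 1, w u,
    mul_nonneg (by positivity) (integral_nonneg hw₀), fun p hp q hq => ?_⟩
  rw [integral_div_sqrt_mul_sqrt_eq hp.2.1 (fun z => g₁ p.1 z * g₂ z p.2),
    integral_div_sqrt_mul_sqrt_eq hq.2.1 (fun z => g₁ q.1 z * g₂ z q.2),
    ← integral_sub (hint p hp) (hint q hq), ← Real.norm_eq_abs, mul_right_comm,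
    ← integral_const_mul]
  refine norm_integral_le_of_norm_le (hw.const_mul _) ?_
  filter_upwards [ae_restrict_mem measurableSet_Ioo] with u hu
  have hz := dist_convex_combination_le p q hu
  have hd₁ : dist (p.1, p.2 + (p.1 - p.2) * u) (q.1, q.2 + (q.1 - q.2) * u) ≤ dist p q :=
    max_le (le_max_left _ _) hz
  have hd₂ : dist (p.2 + (p.1 - p.2) * u, p.2) (q.2 + (q.1 - q.2) * u, q.2) ≤ dist p q :=
    max_le hz (le_max_right _ _)
  have hg₁ := (hK _ (hleft p hp u hu) _ (hleft q hq u hu)).trans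
    (mul_le_mul_of_nonneg_left (Real.rpow_le_rpow dist_nonneg hd₁ hγ0.le) hK₀)
  have hg₂ := (hL _ (hright p hp u hu) _ (hright q hq u hu)).trans
    (mul_le_mul_of_nonneg_left (Real.rpow_le_rpow dist_nonneg hd₂ hγ0.le) hL₀)
  have hdiff := abs_mul_sub_mul_le (hbound₁ _ (hleft p hp u hu)) (hbound₂ _ (hright q hq u hu))
    hg₁ hg₂
  rw [← sub_mul, norm_mul, Real.norm_eq_abs, Real.norm_of_nonneg (hw₀ u)]
  refine mul_le_mul_of_nonneg_right (hdiff.trans_eq ?_) (hw₀ u)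
  ring
end

section
/- Let ξ ∈ C^{1+β}([0,T]) with β > 1/2 (i.e. ξ is C¹ with ξ' Hölder continuous of order β), and let f ∈ C^{1/2}([0,T]) (Hölder continuous of order 1/2). Define for 0 < s < t < T the kernel K(t,s) = ((ξ(t) − ξ(s))/(t − s)) · e^{−(ξ(t)−ξ(s))²/(4(t−s))} / (t − s)^{1/2}. Then the function g(t) := ∫_0^t K(t,s) f(s) ds is Hölder continuous of order 1/2 on [0,T]. -/
open MeasureTheory

/-- The integral of `τ ^ (-1/2)` over `[a, b]` is at most `2 * (b - a) ^ (1/2)`. -/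
theorem integral_rpow_neg_half_le {a b : ℝ} (ha : 0 ≤ a) (hab : a ≤ b) :
    ∫ τ in a..b, τ ^ (-(1 / 2) : ℝ) ≤ 2 * (b - a) ^ ((1 : ℝ) / 2) := by
  rw [integral_rpow (Or.inl (by norm_num))]
  have h := Real.rpow_add_le_add_rpow ha (sub_nonneg.2 hab)
    (by norm_num : (0 : ℝ) ≤ 1 / 2) (by norm_num)
  rw [add_sub_cancel] at h
  norm_num at h ⊢
  linarith

/-- Hölder continuity of order `1/2` of `t ↦ ∫ τ in 0..t, G t τ` when `G t τ` and its increments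
in `t` are weighted by `τ ^ (-1/2)`. -/
theorem abs_integral_sub_integral_le {T A B : ℝ} (hA : 0 ≤ A) (hB : 0 ≤ B) {G : ℝ → ℝ → ℝ}
    (hcont : ∀ t ∈ Set.Icc 0 T, ContinuousOn (G t) (Set.Ioc 0 t))
    (hbound : ∀ t ∈ Set.Icc 0 T, ∀ τ ∈ Set.Ioc 0 t, |G t τ| ≤ A * τ ^ (-(1 / 2) : ℝ))
    (hdiff : ∀ t ∈ Set.Icc 0 T, ∀ t' ∈ Set.Icc 0 T, t ≤ t' → ∀ τ ∈ Set.Ioc 0 t,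
      |G t' τ - G t τ| ≤ B * (t' - t) ^ ((1 : ℝ) / 2) * τ ^ (-(1 / 2) : ℝ))
    {t t' : ℝ} (ht : t ∈ Set.Icc 0 T) (ht' : t' ∈ Set.Icc 0 T) (htt' : t ≤ t') :
    |(∫ τ in 0..t', G t' τ) - ∫ τ in 0..t, G t τ| ≤
      (2 * A + 2 * B * T ^ ((1 : ℝ) / 2)) * (t' - t) ^ ((1 : ℝ) / 2) := by
  have hw (a b : ℝ) : IntervalIntegrable (fun τ : ℝ ↦ τ ^ (-(1 / 2) : ℝ)) volume a b :=
    intervalIntegral.intervalIntegrable_rpow' (by norm_num)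
  have hint (u : ℝ) (hu : u ∈ Set.Icc 0 T) : IntervalIntegrable (G u) volume 0 u := by
    refine ((hw 0 u).const_mul A).mono_fun' ?_ ?_
    · rw [Set.uIoc_of_le hu.1]
      exact (hcont u hu).aestronglyMeasurable measurableSet_Ioc
    · rw [Set.uIoc_of_le hu.1]
      filter_upwards [ae_restrict_mem measurableSet_Ioc] with τ hτ using hbound u hu τ hτ
  have hi' := hint t' ht'
  have h1 : IntervalIntegrable (G t') volume 0 t :=
    hi'.mono_set (Set.uIcc_subset_uIcc_left (by rw [Set.uIcc_of_le ht'.1]; exact ⟨ht.1, htt'⟩))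
  have h2 : IntervalIntegrable (G t') volume t t' :=
    hi'.mono_set (Set.uIcc_subset_uIcc_right (by rw [Set.uIcc_of_le ht'.1]; exact ⟨ht.1, htt'⟩))
  rw [← intervalIntegral.integral_add_adjacent_intervals h1 h2, add_sub_right_comm,
    ← intervalIntegral.integral_sub h1 (hint t ht)]
  have hh : 0 ≤ (t' - t) ^ ((1 : ℝ) / 2) := Real.rpow_nonneg (sub_nonneg.2 htt') _
  have e1 : |∫ τ in 0..t, (G t' τ - G t τ)| ≤
      B * (t' - t) ^ ((1 : ℝ) / 2) * (2 * T ^ ((1 : ℝ) / 2)) := by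
    refine (intervalIntegral.norm_integral_le_of_norm_le (f := fun τ ↦ G t' τ - G t τ)
      (g := fun τ ↦ B * (t' - t) ^ ((1 : ℝ) / 2) * τ ^ (-(1 / 2) : ℝ)) ht.1
      (Filter.Eventually.of_forall fun τ hτ ↦ hdiff t ht t' ht' htt' τ hτ)
      ((hw 0 t).const_mul _)).trans ?_
    rw [intervalIntegral.integral_const_mul]
    refine mul_le_mul_of_nonneg_left ?_ (mul_nonneg hB hh)
    refine (integral_rpow_neg_half_le le_rfl ht.1).trans ?_
    rw [sub_zero]
    exact mul_le_mul_of_nonneg_left (Real.rpow_le_rpow ht.1 ht.2 (by norm_num)) (by norm_num)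
  have e2 : |∫ τ in t..t', G t' τ| ≤ A * (2 * (t' - t) ^ ((1 : ℝ) / 2)) := by
    refine (intervalIntegral.norm_integral_le_of_norm_le (f := G t')
      (g := fun τ ↦ A * τ ^ (-(1 / 2) : ℝ)) htt'
      (Filter.Eventually.of_forall fun τ hτ ↦ hbound t' ht' τ ⟨ht.1.trans_lt hτ.1, hτ.2⟩)
      ((hw t t').const_mul _)).trans ?_
    rw [intervalIntegral.integral_const_mul]
    exact mul_le_mul_of_nonneg_left (integral_rpow_neg_half_le ht.1 htt') hA
  refine (abs_add_le _ _).trans ((add_le_add e1 e2).trans (le_of_eq ?_))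
  ring

theorem abs_mul_exp_neg_sub_le {c : ℝ} (hc : 0 ≤ c) (x y : ℝ) :
    |x * Real.exp (-(c * x ^ 2)) - y * Real.exp (-(c * y ^ 2))| ≤ 2 * |x - y| := by
  have hder (z : ℝ) : HasDerivAt (fun z ↦ z * Real.exp (-(c * z ^ 2)))
      ((1 - 2 * (c * z ^ 2)) * Real.exp (-(c * z ^ 2))) z := by
    refine ((hasDerivAt_id z).mul
      ((((hasDerivAt_id z).pow 2).const_mul c).neg.exp)).congr_deriv ?_
    simp only [Pi.neg_apply, Pi.pow_apply, id]
    push_cast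
    ring
  refine convex_univ.norm_image_sub_le_of_norm_hasDerivWithin_le
    (fun z _ ↦ (hder z).hasDerivWithinAt) (fun z _ ↦ ?_) (Set.mem_univ y) (Set.mem_univ x)
  have hu : 0 ≤ c * z ^ 2 := by positivity
  rw [norm_mul, Real.norm_eq_abs, Real.norm_eq_abs, Real.abs_exp, Real.exp_neg,
    mul_inv_le_iff₀ (Real.exp_pos _)]
  have := Real.add_one_le_exp (c * z ^ 2)
  rw [abs_le]
  constructor <;> linarith

theorem abs_sub_le_of_hasDerivAt_of_bound {a b M : ℝ} {φ φ' : ℝ → ℝ} (hab : a ≤ b)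
    (hφ : ∀ x ∈ Set.Icc a b, HasDerivAt φ (φ' x) x) (hM : ∀ x ∈ Set.Icc a b, |φ' x| ≤ M) :
    |φ b - φ a| ≤ M * (b - a) := by
  have h := (convex_Icc a b).norm_image_sub_le_of_norm_hasDerivWithin_le
    (fun x hx ↦ (hφ x hx).hasDerivWithinAt) hM (Set.left_mem_Icc.2 hab) (Set.right_mem_Icc.2 hab)
  rwa [Real.norm_eq_abs, Real.norm_eq_abs, abs_of_nonneg (sub_nonneg.2 hab)] at h

theorem continuousOn_of_abs_sub_le_rpow {s : Set ℝ} {f : ℝ → ℝ} {C r : ℝ} (hr : 0 < r)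
    (hf : ∀ x ∈ s, ∀ y ∈ s, |f x - f y| ≤ C * |x - y| ^ r) : ContinuousOn f s := by
  intro x hx
  rw [ContinuousWithinAt, tendsto_iff_norm_sub_tendsto_zero]
  refine squeeze_zero' (Filter.Eventually.of_forall fun _ ↦ norm_nonneg _)
    (eventually_mem_nhdsWithin.mono fun y hy ↦ hf y hy x hx) ?_
  have hc : Continuous fun y : ℝ ↦ C * |y - x| ^ r :=
    continuous_const.mul (((continuous_id.sub continuous_const).abs).rpow_const
      fun _ ↦ Or.inr hr.le)
  have := hc.tendsto x
  simp only [sub_self, abs_zero, Real.zero_rpow hr.ne', mul_zero] at this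
  exact this.mono_left nhdsWithin_le_nhds

theorem exists_abs_le_of_continuousOn {a b : ℝ} {f : ℝ → ℝ} (hf : ContinuousOn f (Set.Icc a b)) :
    ∃ M : ℝ, 0 ≤ M ∧ ∀ x ∈ Set.Icc a b, |f x| ≤ M := by
  obtain ⟨M, hM⟩ := isCompact_Icc.exists_bound_of_continuousOn hf
  exact ⟨max M 0, le_max_right _ _, fun x hx ↦ (hM x hx).trans (le_max_left _ _)⟩

/-- If `ξ ∈ C^{1+β}([0,T])` with `β > 1/2` and `f ∈ C^{1/2}([0,T])`,
then `g(t) = ∫_0^t K(t,s) f(s) ds`, with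
`K(t,s) = ((ξ(t)-ξ(s))/(t-s)) e^{-(ξ(t)-ξ(s))²/(4(t-s))}/(t-s)^{1/2}`,
is Hölder continuous of order `1/2` on `[0,T]`. -/
theorem stmt11
    (T β : ℝ) (hT : 0 < T) (hβ : 1/2 < β)
    (ξ ξ' : ℝ → ℝ)
    (hξderiv : ∀ t ∈ Set.Icc (0:ℝ) T, HasDerivAt ξ (ξ' t) t)
    (hξ'holder : ∃ C : ℝ, 0 ≤ C ∧ ∀ s ∈ Set.Icc (0:ℝ) T, ∀ t ∈ Set.Icc (0:ℝ) T,
      |ξ' s - ξ' t| ≤ C * |s - t| ^ β)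
    (f : ℝ → ℝ)
    (hf : ∃ C : ℝ, 0 ≤ C ∧ ∀ s ∈ Set.Icc (0:ℝ) T, ∀ t ∈ Set.Icc (0:ℝ) T,
      |f s - f t| ≤ C * |s - t| ^ ((1:ℝ)/2)) :
    ∃ C : ℝ, 0 ≤ C ∧ ∀ t ∈ Set.Icc (0:ℝ) T, ∀ t' ∈ Set.Icc (0:ℝ) T,
      |(∫ s in (0:ℝ)..t, ((ξ t - ξ s)/(t - s)) *
          (Real.exp (-((ξ t - ξ s)^2/(4*(t - s)))) / Real.sqrt (t - s)) * f s)
        - (∫ s in (0:ℝ)..t', ((ξ t' - ξ s)/(t' - s)) *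
          (Real.exp (-((ξ t' - ξ s)^2/(4*(t' - s)))) / Real.sqrt (t' - s)) * f s)|
        ≤ C * |t - t'| ^ ((1:ℝ)/2) := by
  obtain ⟨C₁, hC₁, hξ'⟩ := hξ'holder
  obtain ⟨C₂, hC₂, hf⟩ := hf
  have hβ0 : 0 < β := by linarith
  have hfc := continuousOn_of_abs_sub_le_rpow (by norm_num) hf
  have hξc : ContinuousOn ξ (Set.Icc 0 T) := fun t ht ↦
    (hξderiv t ht).continuousAt.continuousWithinAt
  obtain ⟨M, hM0, hM⟩ := exists_abs_le_of_continuousOn (continuousOn_of_abs_sub_le_rpow hβ0 hξ')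
  obtain ⟨N, hN0, hN⟩ := exists_abs_le_of_continuousOn hfc
  set a : ℝ → ℝ → ℝ := fun t τ ↦ (ξ t - ξ (t - τ)) / τ
  set E : ℝ → ℝ → ℝ := fun t τ ↦ a t τ * Real.exp (-(τ / 4 * a t τ ^ 2))
  set G : ℝ → ℝ → ℝ := fun t τ ↦ ((ξ t - ξ (t - τ)) / τ) *
    (Real.exp (-((ξ t - ξ (t - τ)) ^ 2 / (4 * τ))) / Real.sqrt τ) * f (t - τ)
  have hG (t τ : ℝ) (hτ : 0 < τ) : G t τ = E t τ * f (t - τ) * τ ^ (-(1 / 2) : ℝ) := by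
    have h1 : (ξ t - ξ (t - τ)) ^ 2 / (4 * τ) = τ / 4 * a t τ ^ 2 := by
      simp only [a]; field_simp
    simp only [G, E]
    rw [h1, Real.sqrt_eq_rpow, Real.rpow_neg hτ.le, div_eq_mul_inv (Real.exp _)]
    simp only [a]
    ring
  have hsub (t : ℝ) :
      (∫ s in (0:ℝ)..t, ((ξ t - ξ s)/(t - s)) *
        (Real.exp (-((ξ t - ξ s)^2/(4*(t - s)))) / Real.sqrt (t - s)) * f s) =
      ∫ τ in (0:ℝ)..t, G t τ := by
    have h := intervalIntegral.integral_comp_sub_left (a := 0) (b := t) (G t) t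
    simp only [sub_self, sub_zero, G, sub_sub_cancel] at h
    exact h
  have hmem (t : ℝ) (ht : t ∈ Set.Icc 0 T) (τ : ℝ) (hτ : τ ∈ Set.Ioc 0 t) :
      t - τ ∈ Set.Icc 0 T :=
    ⟨sub_nonneg.2 hτ.2, (sub_le_self t hτ.1.le).trans ht.2⟩
  have ha (t : ℝ) (ht : t ∈ Set.Icc 0 T) (τ : ℝ) (hτ : τ ∈ Set.Ioc 0 t) : |a t τ| ≤ M := by
    have hsubset : Set.Icc (t - τ) t ⊆ Set.Icc 0 T :=
      Set.Icc_subset_Icc (hmem t ht τ hτ).1 ht.2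
    have h := abs_sub_le_of_hasDerivAt_of_bound (sub_le_self t hτ.1.le)
      (fun x hx ↦ hξderiv x (hsubset hx)) (fun x hx ↦ hM x (hsubset hx))
    rw [sub_sub_cancel] at h
    simp only [a]
    rwa [abs_div, abs_of_pos hτ.1, div_le_iff₀ hτ.1]
  have hE (t : ℝ) (ht : t ∈ Set.Icc 0 T) (τ : ℝ) (hτ : τ ∈ Set.Ioc 0 t) : |E t τ| ≤ M := by
    simp only [E]
    rw [abs_mul, Real.abs_exp]
    refine (mul_le_of_le_one_right (abs_nonneg _) ?_).trans (ha t ht τ hτ)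
    have := hτ.1
    exact Real.exp_le_one_iff.2 (neg_nonpos.2 (by positivity))
  set D : ℝ := C₁ * T ^ (β - 1 / 2)
  have hD : 0 ≤ D := mul_nonneg hC₁ (Real.rpow_nonneg hT.le _)
  have hadiff (t : ℝ) (ht : t ∈ Set.Icc 0 T) (t' : ℝ) (ht' : t' ∈ Set.Icc 0 T) (htt' : t ≤ t')
      (τ : ℝ) (hτ : τ ∈ Set.Ioc 0 t) :
      |a t' τ - a t τ| ≤ D * (t' - t) ^ ((1 : ℝ) / 2) := by
    have hh : 0 ≤ t' - t := sub_nonneg.2 htt'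
    have hpow : (t' - t) ^ β ≤ T ^ (β - 1 / 2) * (t' - t) ^ ((1 : ℝ) / 2) := by
      calc (t' - t) ^ β = (t' - t) ^ (β - 1 / 2) * (t' - t) ^ ((1 : ℝ) / 2) := by
            rw [← Real.rpow_add_of_nonneg hh (by linarith) (by norm_num), sub_add_cancel]
        _ ≤ _ := mul_le_mul_of_nonneg_right
            (Real.rpow_le_rpow hh (by linarith [ht.1, ht'.2]) (by linarith))
            (Real.rpow_nonneg hh _)
    have hx1 (x : ℝ) (hx : x ∈ Set.Icc (t - τ) t) : x ∈ Set.Icc 0 T :=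
      ⟨by linarith [hτ.2, hx.1], hx.2.trans ht.2⟩
    have hx2 (x : ℝ) (hx : x ∈ Set.Icc (t - τ) t) : x + (t' - t) ∈ Set.Icc 0 T :=
      ⟨by linarith [(hx1 x hx).1], by linarith [hx.2, ht'.2]⟩
    have h := abs_sub_le_of_hasDerivAt_of_bound (φ := fun x ↦ ξ (x + (t' - t)) - ξ x)
      (φ' := fun x ↦ ξ' (x + (t' - t)) - ξ' x) (M := D * (t' - t) ^ ((1 : ℝ) / 2))
      (sub_le_self t hτ.1.le)
      (fun x hx ↦ ((hξderiv _ (hx2 x hx)).comp_add_const x (t' - t)).sub (hξderiv x (hx1 x hx)))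
      (fun x hx ↦ by
        refine (hξ' _ (hx2 x hx) _ (hx1 x hx)).trans ?_
        rw [add_sub_cancel_left, abs_of_nonneg hh]
        exact (mul_le_mul_of_nonneg_left hpow hC₁).trans (le_of_eq (by simp only [D]; ring)))
    have e1 : t + (t' - t) = t' := by ring
    have e2 : t - τ + (t' - t) = t' - τ := by ring
    rw [sub_sub_cancel] at h
    simp only [e1, e2] at h
    simp only [a]
    rw [← sub_div, abs_div, abs_of_pos hτ.1, div_le_iff₀ hτ.1]
    rwa [sub_sub_sub_comm]
  have hcont (t : ℝ) (ht : t ∈ Set.Icc 0 T) : ContinuousOn (G t) (Set.Ioc 0 t) := by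
    have hm : Set.MapsTo (fun τ ↦ t - τ) (Set.Ioc 0 t) (Set.Icc 0 T) := hmem t ht
    have hs : ContinuousOn (fun τ : ℝ ↦ t - τ) (Set.Ioc 0 t) := by fun_prop
    have h1 : ContinuousOn (fun τ ↦ ξ t - ξ (t - τ)) (Set.Ioc 0 t) :=
      continuousOn_const.sub (hξc.comp hs hm)
    have h2 : ContinuousOn (fun τ ↦ f (t - τ)) (Set.Ioc 0 t) := hfc.comp hs hm
    refine ((h1.div continuousOn_id fun τ hτ ↦ hτ.1.ne').mul
      (((h1.pow 2).div (continuousOn_const.mul continuousOn_id) fun τ hτ ↦ ?_).neg.rexp.div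
        Real.continuous_sqrt.continuousOn fun τ hτ ↦ (Real.sqrt_pos.2 hτ.1).ne')).mul h2
    exact mul_ne_zero four_ne_zero hτ.1.ne'
  have hbound (t : ℝ) (ht : t ∈ Set.Icc 0 T) (τ : ℝ) (hτ : τ ∈ Set.Ioc 0 t) :
      |G t τ| ≤ M * N * τ ^ (-(1 / 2) : ℝ) := by
    have hw : 0 ≤ τ ^ (-(1 / 2) : ℝ) := Real.rpow_nonneg hτ.1.le _
    rw [hG t τ hτ.1, abs_mul, abs_mul, abs_of_nonneg hw]
    exact mul_le_mul_of_nonneg_right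
      (mul_le_mul (hE t ht τ hτ) (hN _ (hmem t ht τ hτ)) (abs_nonneg _) hM0) hw
  have hdiff (t : ℝ) (ht : t ∈ Set.Icc 0 T) (t' : ℝ) (ht' : t' ∈ Set.Icc 0 T) (htt' : t ≤ t')
      (τ : ℝ) (hτ : τ ∈ Set.Ioc 0 t) :
      |G t' τ - G t τ| ≤
        (2 * D * N + M * C₂) * (t' - t) ^ ((1 : ℝ) / 2) * τ ^ (-(1 / 2) : ℝ) := by
    have hw : 0 ≤ τ ^ (-(1 / 2) : ℝ) := Real.rpow_nonneg hτ.1.le _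
    have hτ' : τ ∈ Set.Ioc 0 t' := ⟨hτ.1, hτ.2.trans htt'⟩
    rw [hG t τ hτ.1, hG t' τ hτ.1, ← sub_mul, abs_mul, abs_of_nonneg hw]
    refine mul_le_mul_of_nonneg_right ?_ hw
    have hEd : |E t' τ - E t τ| ≤ 2 * (D * (t' - t) ^ ((1 : ℝ) / 2)) :=
      (abs_mul_exp_neg_sub_le (div_nonneg hτ.1.le (by norm_num)) _ _).trans
        (mul_le_mul_of_nonneg_left (hadiff t ht t' ht' htt' τ hτ) (by norm_num))
    have hfd : |f (t' - τ) - f (t - τ)| ≤ C₂ * (t' - t) ^ ((1 : ℝ) / 2) := by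
      have h := hf _ (hmem t' ht' τ hτ') _ (hmem t ht τ hτ)
      rwa [sub_sub_sub_cancel_right, abs_of_nonneg (sub_nonneg.2 htt')] at h
    calc |E t' τ * f (t' - τ) - E t τ * f (t - τ)|
        = |(E t' τ - E t τ) * f (t' - τ) + E t τ * (f (t' - τ) - f (t - τ))| := by
          congr 1; ring
      _ ≤ |E t' τ - E t τ| * |f (t' - τ)| + |E t τ| * |f (t' - τ) - f (t - τ)| := by
          rw [← abs_mul, ← abs_mul]; exact abs_add_le _ _
      _ ≤ 2 * (D * (t' - t) ^ ((1 : ℝ) / 2)) * N + M * (C₂ * (t' - t) ^ ((1 : ℝ) / 2)) :=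
          add_le_add
            (mul_le_mul hEd (hN _ (hmem t' ht' τ hτ')) (abs_nonneg _) ((abs_nonneg _).trans hEd))
            (mul_le_mul (hE t ht τ hτ) hfd (abs_nonneg _) hM0)
      _ = _ := by ring
  have hA : 0 ≤ M * N := mul_nonneg hM0 hN0
  have hB : 0 ≤ 2 * D * N + M * C₂ := by positivity
  refine ⟨2 * (M * N) + 2 * (2 * D * N + M * C₂) * T ^ ((1 : ℝ) / 2), by positivity,
    fun t ht t' ht' ↦ ?_⟩
  rw [hsub t, hsub t']
  rcases le_total t t' with h | h
  · rw [abs_sub_comm, abs_sub_comm t t', abs_of_nonneg (sub_nonneg.2 h)]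
    exact abs_integral_sub_integral_le hA hB hcont hbound hdiff ht ht' h
  · rw [abs_of_nonneg (sub_nonneg.2 h)]
    exact abs_integral_sub_integral_le hA hB hcont hbound hdiff ht' ht h
end

section
/- Let ξ ∈ C^{1+β}([0,T']) with β > 1/2, and define for 0 < s < t < T' the kernel K₂(s,t) = (√π/2) · ((ξ(t) − ξ(s))/(t − s)) · e^{−(ξ(t)−ξ(s))²/(4(t−s))}/(t − s)^{1/2}. Let N₂ ∈ C([0,T']) and let f₂ ∈ C([0,T']) be a solution of the Volterra equation π f₂(t) = N₂(t) + ∫_0^t K₂(s,t) f₂(s) ds on (0,T'). Then there exists a function G₂(t,s), Hölder continuous of order 1/2 on the closed triangle {(t,s) : 0 ≤ s ≤ t ≤ T'}, such that f₂(t) = N₂(t)/π + (1/π²) ∫_0^t ( K₂(s,t) + G₂(t,s) ) N₂(s) ds for every t ∈ (0,T'). -/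
open MeasureTheory

/-- The closed triangle `{(t, s) : 0 ≤ s ≤ t ≤ T}`. -/
def closedTriangle (T : ℝ) : Set (ℝ × ℝ) := {p | 0 ≤ p.2 ∧ p.2 ≤ p.1 ∧ p.1 ≤ T}

/-- The point dividing the segment from `p.2` to `p.1` in the ratio `θ : 1 - θ`. -/
def segPoint (p : ℝ × ℝ) (θ : ℝ) : ℝ := p.2 + θ * (p.1 - p.2)

/-- Sup and order-`1/2` Hölder bounds on the triangle, with exponential weight
`exp (l * (t - s))`. -/
structure TriangleBound (T l M H : ℝ) (b : ℝ × ℝ → ℝ) : Prop where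
  nonneg_sup : 0 ≤ M
  nonneg_holder : 0 ≤ H
  sup_le : ∀ p ∈ closedTriangle T, |b p| ≤ M * Real.exp (l * (p.1 - p.2))
  holder_le : ∀ p ∈ closedTriangle T, ∀ q ∈ closedTriangle T, q.1 - q.2 ≤ p.1 - p.2 →
    |b p - b q| ≤ H * Real.exp (l * (p.1 - p.2)) * √(dist p q)

/-- Composition of two kernels `b(t, u)` and `c(u, s)`, with the intermediate variable rescaled to
`[0, 1]` and weighted by `w`. -/
noncomputable def weightedComp (w : ℝ → ℝ) (b c : ℝ × ℝ → ℝ) (p : ℝ × ℝ) : ℝ :=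
  ∫ θ in (0:ℝ)..1, w θ * (b (p.1, segPoint p θ) * c (segPoint p θ, p.2))

lemma segPoint_left {T : ℝ} {p : ℝ × ℝ} (hp : p ∈ closedTriangle T) {θ : ℝ}
    (hθ : θ ∈ Set.Icc (0:ℝ) 1) : (p.1, segPoint p θ) ∈ closedTriangle T := by
  obtain ⟨h1, h2, h3⟩ := hp
  obtain ⟨h4, h5⟩ := hθ
  have := mul_nonneg h4 (sub_nonneg.2 h2)
  have := mul_nonneg (sub_nonneg.2 h5) (sub_nonneg.2 h2)
  refine ⟨?_, ?_, h3⟩ <;> simp only [segPoint] <;> nlinarith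

lemma segPoint_right {T : ℝ} {p : ℝ × ℝ} (hp : p ∈ closedTriangle T) {θ : ℝ}
    (hθ : θ ∈ Set.Icc (0:ℝ) 1) : (segPoint p θ, p.2) ∈ closedTriangle T := by
  obtain ⟨h1, h2, h3⟩ := hp
  obtain ⟨h4, h5⟩ := hθ
  have := mul_nonneg h4 (sub_nonneg.2 h2)
  have := mul_nonneg (sub_nonneg.2 h5) (sub_nonneg.2 h2)
  refine ⟨h1, ?_, ?_⟩ <;> simp only [segPoint] <;> nlinarith

lemma abs_segPoint_sub_le (p q : ℝ × ℝ) {θ : ℝ} (hθ : θ ∈ Set.Icc (0:ℝ) 1) :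
    |segPoint p θ - segPoint q θ| ≤ dist p q := by
  have h1 : |p.1 - q.1| ≤ dist p q := by
    rw [← Real.dist_eq, Prod.dist_eq]; exact le_max_left _ _
  have h2 : |p.2 - q.2| ≤ dist p q := by
    rw [← Real.dist_eq, Prod.dist_eq]; exact le_max_right _ _
  obtain ⟨h3, h4⟩ := hθ
  rw [abs_le] at *
  simp only [segPoint]
  constructor <;> nlinarith

lemma dist_segPoint_left (p q : ℝ × ℝ) {θ : ℝ} (hθ : θ ∈ Set.Icc (0:ℝ) 1) :
    dist (p.1, segPoint p θ) (q.1, segPoint q θ) ≤ dist p q := by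
  rw [Prod.dist_eq]
  refine max_le ?_ ?_
  · rw [Prod.dist_eq]; exact le_max_left _ _
  · rw [Real.dist_eq]; exact abs_segPoint_sub_le p q hθ

lemma dist_segPoint_right (p q : ℝ × ℝ) {θ : ℝ} (hθ : θ ∈ Set.Icc (0:ℝ) 1) :
    dist (segPoint p θ, p.2) (segPoint q θ, q.2) ≤ dist p q := by
  rw [Prod.dist_eq]
  refine max_le ?_ ?_
  · rw [Real.dist_eq]; exact abs_segPoint_sub_le p q hθ
  · rw [Prod.dist_eq]; exact le_max_right _ _

lemma abs_sqrt_sub_sqrt_le {x y : ℝ} (hy : 0 ≤ y) (h : y ≤ x) : |√x - √y| ≤ √(x - y) := by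
  rw [abs_of_nonneg (sub_nonneg.2 (Real.sqrt_le_sqrt h)), sub_le_iff_le_add]
  apply Real.sqrt_le_iff.2 ⟨by positivity, ?_⟩
  nlinarith [Real.sq_sqrt hy, Real.sq_sqrt (sub_nonneg.2 h),
    mul_nonneg (Real.sqrt_nonneg y) (Real.sqrt_nonneg (x - y))]

lemma abs_diff_sub_diff_le (p q : ℝ × ℝ) : |(p.1 - p.2) - (q.1 - q.2)| ≤ 2 * dist p q := by
  have h1 : |p.1 - q.1| ≤ dist p q := by
    rw [← Real.dist_eq, Prod.dist_eq]; exact le_max_left _ _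
  have h2 : |p.2 - q.2| ≤ dist p q := by
    rw [← Real.dist_eq, Prod.dist_eq]; exact le_max_right _ _
  rw [abs_le] at *
  constructor <;> linarith

namespace TriangleBound

variable {T l M H A : ℝ} {b c : ℝ × ℝ → ℝ} {w : ℝ → ℝ}

lemma abs_sub_le (hb : TriangleBound T l M H b) (hl : 0 ≤ l) {p q : ℝ × ℝ}
    (hp : p ∈ closedTriangle T) (hq : q ∈ closedTriangle T) :
    |b p - b q| ≤ H * Real.exp (l * T) * √(dist p q) := by
  have key : ∀ p ∈ closedTriangle T, ∀ q ∈ closedTriangle T, q.1 - q.2 ≤ p.1 - p.2 →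
      |b p - b q| ≤ H * Real.exp (l * T) * √(dist p q) := by
    intro p hp q hq h
    refine (hb.holder_le p hp q hq h).trans ?_
    have := hb.nonneg_holder
    have : p.1 - p.2 ≤ T := by have := hp.1; have := hp.2.2; linarith
    gcongr
  rcases le_total (q.1 - q.2) (p.1 - p.2) with h | h
  · exact key p hp q hq h
  · rw [abs_sub_comm, dist_comm]; exact key q hq p hp h

lemma abs_le (hb : TriangleBound T l M H b) (hl : 0 ≤ l) {p : ℝ × ℝ}
    (hp : p ∈ closedTriangle T) : |b p| ≤ M * Real.exp (l * T) := by
  refine (hb.sup_le p hp).trans ?_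
  have := hb.nonneg_sup
  have : p.1 - p.2 ≤ T := by have := hp.1; have := hp.2.2; linarith
  gcongr

lemma continuousOn (hb : TriangleBound T l M H b) (hl : 0 ≤ l) :
    ContinuousOn b (closedTriangle T) := by
  intro p hp
  rw [ContinuousWithinAt, tendsto_iff_dist_tendsto_zero]
  have h0 : Filter.Tendsto (fun q : ℝ × ℝ => H * Real.exp (l * T) * √(dist q p))
      (nhdsWithin p (closedTriangle T)) (nhds 0) := by
    have : Continuous (fun q : ℝ × ℝ => H * Real.exp (l * T) * √(dist q p)) := by fun_prop
    have h := this.tendsto p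
    simp only [dist_self, Real.sqrt_zero, mul_zero] at h
    exact h.mono_left nhdsWithin_le_nhds
  refine squeeze_zero' (Filter.Eventually.of_forall fun _ => dist_nonneg) ?_ h0
  filter_upwards [self_mem_nhdsWithin] with q hq
  rw [Real.dist_eq]
  exact hb.abs_sub_le hl hq hp

lemma mono {M' H' l' : ℝ} (hb : TriangleBound T l M H b) (hl : l ≤ l') (hM : M ≤ M')
    (hH : H ≤ H') : TriangleBound T l' M' H' b := by
  have hM0 := hb.nonneg_sup
  have hH0 := hb.nonneg_holder
  refine ⟨hM0.trans hM, hH0.trans hH, fun p hp => (hb.sup_le p hp).trans ?_,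
    fun p hp q hq h => (hb.holder_le p hp q hq h).trans ?_⟩
  · have := sub_nonneg.2 hp.2.1
    have := hM0.trans hM
    gcongr
  · have := sub_nonneg.2 hp.2.1
    have := hH0.trans hH
    gcongr

lemma continuousOn_comp_segPoint (hb : TriangleBound T l M H b) (hc : TriangleBound T 0 A A c)
    (hl : 0 ≤ l) {p : ℝ × ℝ} (hp : p ∈ closedTriangle T) :
    ContinuousOn (fun θ => b (p.1, segPoint p θ) * c (segPoint p θ, p.2)) (Set.Icc 0 1) := by
  have hs : Continuous (segPoint p) := by unfold segPoint; fun_prop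
  refine ContinuousOn.mul ?_ ?_
  · exact (hb.continuousOn hl).comp
      (by fun_prop : Continuous fun θ => (p.1, segPoint p θ)).continuousOn
      (fun θ hθ => segPoint_left hp hθ)
  · exact (hc.continuousOn le_rfl).comp
      (by fun_prop : Continuous fun θ => (segPoint p θ, p.2)).continuousOn
      (fun θ hθ => segPoint_right hp hθ)

lemma intervalIntegrable_comp (hb : TriangleBound T l M H b) (hc : TriangleBound T 0 A A c)
    (hl : 0 ≤ l) (hw : IntervalIntegrable w volume 0 1) {p : ℝ × ℝ} (hp : p ∈ closedTriangle T) :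
    IntervalIntegrable (fun θ => w θ * (b (p.1, segPoint p θ) * c (segPoint p θ, p.2)))
      volume 0 1 :=
  hw.mul_continuousOn (by
    rw [Set.uIcc_of_le zero_le_one]; exact hb.continuousOn_comp_segPoint hc hl hp)

lemma abs_weightedComp_le (hb : TriangleBound T l M H b) (hc : TriangleBound T 0 A A c)
    (hw : IntervalIntegrable w volume 0 1) (hw0 : ∀ θ, 0 ≤ w θ)
    {p : ℝ × ℝ} (hp : p ∈ closedTriangle T) :
    |weightedComp w b c p| ≤ M * A * (∫ θ in (0:ℝ)..1, w θ * Real.exp (-(l * (θ * (p.1 - p.2))))) *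
      Real.exp (l * (p.1 - p.2)) := by
  have hi : IntervalIntegrable (fun θ => w θ * Real.exp (-(l * (θ * (p.1 - p.2))))) volume 0 1 :=
    hw.mul_continuousOn (by fun_prop)
  have hM := hb.nonneg_sup
  have hA := hc.nonneg_sup
  rw [weightedComp, ← Real.norm_eq_abs]
  rw [← intervalIntegral.integral_const_mul, ← intervalIntegral.integral_mul_const]
  refine intervalIntegral.norm_integral_le_of_norm_le zero_le_one ?_
    ((hi.const_mul (M * A)).mul_const _)
  refine Filter.Eventually.of_forall fun θ hθ => ?_
  have hθ' : θ ∈ Set.Icc (0:ℝ) 1 := ⟨hθ.1.le, hθ.2⟩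
  have h1 := hb.sup_le _ (segPoint_left hp hθ')
  have h2 := hc.sup_le _ (segPoint_right hp hθ')
  simp only [zero_mul, Real.exp_zero, mul_one] at h2
  rw [Real.norm_eq_abs, abs_mul, abs_mul, abs_of_nonneg (hw0 θ)]
  calc w θ * (|b (p.1, segPoint p θ)| * |c (segPoint p θ, p.2)|)
      ≤ w θ * (M * Real.exp (l * (p.1 - segPoint p θ)) * A) := by
        have := hw0 θ
        gcongr
    _ = M * A * (w θ * Real.exp (-(l * (θ * (p.1 - p.2))))) * Real.exp (l * (p.1 - p.2)) := by
        have : l * (p.1 - segPoint p θ) = -(l * (θ * (p.1 - p.2))) + l * (p.1 - p.2) := by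
          simp only [segPoint]; ring
        rw [this, Real.exp_add]; ring

lemma abs_weightedComp_sub_le (hb : TriangleBound T l M H b) (hc : TriangleBound T 0 A A c)
    (hl : 0 ≤ l) (hw : IntervalIntegrable w volume 0 1) (hw0 : ∀ θ, 0 ≤ w θ)
    {p q : ℝ × ℝ} (hp : p ∈ closedTriangle T) (hq : q ∈ closedTriangle T)
    (hpq : q.1 - q.2 ≤ p.1 - p.2) :
    |weightedComp w b c p - weightedComp w b c q| ≤
      A * (H * (∫ θ in (0:ℝ)..1, w θ * Real.exp (-(l * (θ * (p.1 - p.2))))) +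
        M * ∫ θ in (0:ℝ)..1, w θ) * Real.exp (l * (p.1 - p.2)) * √(dist p q) := by
  have hi : IntervalIntegrable (fun θ => w θ * Real.exp (-(l * (θ * (p.1 - p.2))))) volume 0 1 :=
    hw.mul_continuousOn (by fun_prop)
  have hM := hb.nonneg_sup
  have hH := hb.nonneg_holder
  have hA := hc.nonneg_sup
  rw [weightedComp, weightedComp, ← intervalIntegral.integral_sub
    (hb.intervalIntegrable_comp hc hl hw hp) (hb.intervalIntegrable_comp hc hl hw hq),
    ← Real.norm_eq_abs, ← intervalIntegral.integral_const_mul,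
    ← intervalIntegral.integral_const_mul,
    ← intervalIntegral.integral_add (hi.const_mul H) (hw.const_mul M),
    ← intervalIntegral.integral_const_mul,
    ← intervalIntegral.integral_mul_const, ← intervalIntegral.integral_mul_const]
  refine intervalIntegral.norm_integral_le_of_norm_le zero_le_one ?_
    (((((hi.const_mul H).add (hw.const_mul M)).const_mul A).mul_const _).mul_const _)
  refine Filter.Eventually.of_forall fun θ hθ => ?_
  have hθ' : θ ∈ Set.Icc (0:ℝ) 1 := ⟨hθ.1.le, hθ.2⟩
  have hτp := sub_nonneg.2 hp.2.1
  have hτq := sub_nonneg.2 hq.2.1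
  have e1 : p.1 - segPoint p θ = (1 - θ) * (p.1 - p.2) := by simp only [segPoint]; ring
  have e2 : q.1 - segPoint q θ = (1 - θ) * (q.1 - q.2) := by simp only [segPoint]; ring
  have e3 : segPoint p θ - p.2 = θ * (p.1 - p.2) := by simp only [segPoint]; ring
  have e4 : segPoint q θ - q.2 = θ * (q.1 - q.2) := by simp only [segPoint]; ring
  have h1θ : 0 ≤ 1 - θ := by linarith [hθ.2]
  have h1 := hb.holder_le _ (segPoint_left hp hθ') _ (segPoint_left hq hθ') (by
    simp only [e1, e2]; gcongr)
  have h2 := hc.holder_le _ (segPoint_right hp hθ') _ (segPoint_right hq hθ') (by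
    simp only [e3, e4]; have := hθ'.1; gcongr)
  have h3 := hc.sup_le _ (segPoint_right hp hθ')
  have h4 := hb.sup_le _ (segPoint_left hq hθ')
  simp only [zero_mul, Real.exp_zero, mul_one, e1, e2] at h1 h2 h3 h4
  have d1 := Real.sqrt_le_sqrt (dist_segPoint_left p q hθ')
  have d2 := Real.sqrt_le_sqrt (dist_segPoint_right p q hθ')
  have h4' : |b (q.1, segPoint q θ)| ≤ M * Real.exp (l * (p.1 - p.2)) := by
    refine h4.trans ?_
    have : (1 - θ) * (q.1 - q.2) ≤ p.1 - p.2 := by nlinarith [hθ'.1]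
    gcongr
  have hexp : Real.exp (l * ((1 - θ) * (p.1 - p.2))) =
      Real.exp (-(l * (θ * (p.1 - p.2)))) * Real.exp (l * (p.1 - p.2)) := by
    rw [← Real.exp_add]; congr 1; ring
  rw [hexp] at h1
  have hwθ := hw0 θ
  rw [Real.norm_eq_abs, ← mul_sub, abs_mul, abs_of_nonneg hwθ]
  have split : b (p.1, segPoint p θ) * c (segPoint p θ, p.2) -
      b (q.1, segPoint q θ) * c (segPoint q θ, q.2) =
      (b (p.1, segPoint p θ) - b (q.1, segPoint q θ)) * c (segPoint p θ, p.2) +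
      b (q.1, segPoint q θ) * (c (segPoint p θ, p.2) - c (segPoint q θ, q.2)) := by ring
  rw [split]
  calc w θ * _ ≤ w θ * (H * (Real.exp (-(l * (θ * (p.1 - p.2)))) * Real.exp (l * (p.1 - p.2))) *
        √(dist p q) * A + M * Real.exp (l * (p.1 - p.2)) * (A * √(dist p q))) := by
        refine mul_le_mul_of_nonneg_left ((abs_add_le _ _).trans ?_) hwθ
        rw [abs_mul, abs_mul]
        refine add_le_add (mul_le_mul (h1.trans ?_) h3 (abs_nonneg _) (by positivity))
          (mul_le_mul h4' (h2.trans ?_) (abs_nonneg _) (by positivity)) <;> gcongr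
    _ = _ := by ring

end TriangleBound

lemma abs_exp_neg_sub_exp_neg_le {x y : ℝ} (hx : 0 ≤ x) (hy : 0 ≤ y) :
    |Real.exp (-x) - Real.exp (-y)| ≤ |x - y| := by
  wlog h : x ≤ y generalizing x y
  · rw [abs_sub_comm, abs_sub_comm x]; exact this hy hx (le_of_not_ge h)
  have h1 : Real.exp (-y) ≤ Real.exp (-x) := Real.exp_le_exp.2 (by linarith)
  rw [abs_of_nonneg (sub_nonneg.2 h1), abs_of_nonpos (by linarith)]
  have h2 : Real.exp (-y) = Real.exp (-x) * Real.exp (x - y) := by rw [← Real.exp_add]; ring_nf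
  have h3 := Real.add_one_le_exp (x - y)
  have h4 : Real.exp (-x) ≤ 1 := Real.exp_le_one_iff.2 (by linarith)
  have h5 := Real.exp_pos (-x)
  rw [h2]
  nlinarith

lemma dist_le_of_mem_closedTriangle {T : ℝ} {p q : ℝ × ℝ} (hp : p ∈ closedTriangle T)
    (hq : q ∈ closedTriangle T) : dist p q ≤ T := by
  obtain ⟨h1, h2, h3⟩ := hp
  obtain ⟨h4, h5, h6⟩ := hq
  rw [Prod.dist_eq, Real.dist_eq, Real.dist_eq]
  refine max_le (abs_le.2 ⟨?_, ?_⟩) (abs_le.2 ⟨?_, ?_⟩) <;> linarith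

/-- The mean of `ψ` over the segment between the coordinates of `p`. -/
noncomputable def segMean (ψ : ℝ → ℝ) (p : ℝ × ℝ) : ℝ := ∫ θ in (0:ℝ)..1, ψ (segPoint p θ)

/-- The bounded factor of the kernel `K₂`, written through `ψ = ξ'`. -/
noncomputable def kernelFactor (ψ : ℝ → ℝ) (p : ℝ × ℝ) : ℝ :=
  √Real.pi / 2 * (segMean ψ p * Real.exp (-(|p.1 - p.2| * segMean ψ p ^ 2 / 4)))

lemma continuous_segMean {ψ : ℝ → ℝ} (hψ : Continuous ψ) : Continuous (segMean ψ) := by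
  unfold segMean
  apply intervalIntegral.continuous_parametric_intervalIntegral_of_continuous'
  unfold segPoint
  fun_prop

lemma continuous_kernelFactor {ψ : ℝ → ℝ} (hψ : Continuous ψ) : Continuous (kernelFactor ψ) := by
  have := continuous_segMean hψ
  unfold kernelFactor
  fun_prop

lemma abs_segMean_le {ψ : ℝ → ℝ} {B : ℝ} (hB : ∀ x, |ψ x| ≤ B) (p : ℝ × ℝ) :
    |segMean ψ p| ≤ B := by
  have := intervalIntegral.norm_integral_le_of_norm_le_const (a := 0) (b := 1) (C := B)
    (f := fun θ => ψ (segPoint p θ)) (fun θ _ => hB _)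
  simpa [segMean] using this

lemma abs_segMean_sub_le {ψ : ℝ → ℝ} {C : ℝ} (hψ : Continuous ψ) (hC : 0 ≤ C)
    (hψC : ∀ x y, |ψ x - ψ y| ≤ C * √|x - y|) (p q : ℝ × ℝ) :
    |segMean ψ p - segMean ψ q| ≤ C * √(dist p q) := by
  have hi : ∀ p : ℝ × ℝ, IntervalIntegrable (fun θ => ψ (segPoint p θ)) volume 0 1 := fun p =>
    Continuous.intervalIntegrable (by unfold segPoint; fun_prop) _ _
  rw [segMean, segMean, ← intervalIntegral.integral_sub (hi p) (hi q)]
  have := intervalIntegral.norm_integral_le_of_norm_le_const (a := 0) (b := 1)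
    (C := C * √(dist p q)) (f := fun θ => ψ (segPoint p θ) - ψ (segPoint q θ)) (fun θ hθ => by
      rw [Set.uIoc_of_le zero_le_one] at hθ
      refine (hψC _ _).trans ?_
      have := abs_segPoint_sub_le p q (θ := θ) ⟨hθ.1.le, hθ.2⟩
      gcongr)
  simpa using this

lemma abs_kernelFactor_le {ψ : ℝ → ℝ} {B : ℝ} (hB : ∀ x, |ψ x| ≤ B) (p : ℝ × ℝ) :
    |kernelFactor ψ p| ≤ √Real.pi / 2 * B := by
  have h := abs_segMean_le hB p
  have hB0 : 0 ≤ B := (abs_nonneg _).trans h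
  have he : Real.exp (-(|p.1 - p.2| * segMean ψ p ^ 2 / 4)) ≤ 1 :=
    Real.exp_le_one_iff.2 (by simp only [Left.neg_nonpos_iff]; positivity)
  rw [kernelFactor, abs_mul, abs_mul, abs_of_nonneg (by positivity), Real.abs_exp]
  calc _ ≤ √Real.pi / 2 * (B * 1) := by gcongr
    _ = _ := by ring

lemma exists_triangleBound_kernelFactor {ψ : ℝ → ℝ} {B C T : ℝ} (hT : 0 ≤ T) (hψ : Continuous ψ)
    (hB : ∀ x, |ψ x| ≤ B) (hC : 0 ≤ C) (hψC : ∀ x y, |ψ x - ψ y| ≤ C * √|x - y|) :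
    ∃ A, TriangleBound T 0 A A (kernelFactor ψ) := by
  have hB0 : 0 ≤ B := (abs_nonneg _).trans (hB 0)
  set D : ℝ := √Real.pi / 2 * (C + B * (2 * √T * B ^ 2 + T * (2 * B * C))) with hD
  have hD0 : 0 ≤ D := by positivity
  refine ⟨max (√Real.pi / 2 * B) D, le_max_of_le_right hD0, le_max_of_le_right hD0,
    fun p _ => ?_, fun p hp q hq _ => ?_⟩
  · simpa using Or.inl (abs_kernelFactor_le hB p)
  simp only [zero_mul, Real.exp_zero, mul_one]
  refine le_trans ?_ (mul_le_mul_of_nonneg_right (le_max_right _ _) (Real.sqrt_nonneg _))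
  set m := segMean ψ p with hm
  set n := segMean ψ q with hn
  set δ := √(dist p q) with hδ
  have hmB : |m| ≤ B := abs_segMean_le hB p
  have hnB : |n| ≤ B := abs_segMean_le hB q
  have hmn : |m - n| ≤ C * δ := abs_segMean_sub_le hψ hC hψC p q
  have hpa : |p.1 - p.2| = p.1 - p.2 := abs_of_nonneg (sub_nonneg.2 hp.2.1)
  have hqa : |q.1 - q.2| = q.1 - q.2 := abs_of_nonneg (sub_nonneg.2 hq.2.1)
  have hqT : q.1 - q.2 ≤ T := by have := hq.1; have := hq.2.2; linarith
  have hτ : |(p.1 - p.2) - (q.1 - q.2)| ≤ 2 * √T * δ := by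
    refine (abs_diff_sub_diff_le p q).trans ?_
    have h1 : dist p q = δ * δ := (Real.mul_self_sqrt dist_nonneg).symm
    have h2 : δ ≤ √T := Real.sqrt_le_sqrt (dist_le_of_mem_closedTriangle hp hq)
    rw [h1]
    have : 0 ≤ δ := Real.sqrt_nonneg _
    nlinarith
  have hx : |(p.1 - p.2) * m ^ 2 / 4 - (q.1 - q.2) * n ^ 2 / 4| ≤
      (2 * √T * B ^ 2 + T * (2 * B * C)) * δ := by
    have e : (p.1 - p.2) * m ^ 2 / 4 - (q.1 - q.2) * n ^ 2 / 4 =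
        (((p.1 - p.2) - (q.1 - q.2)) * m ^ 2 + (q.1 - q.2) * ((m + n) * (m - n))) / 4 := by ring
    have h1 : |((p.1 - p.2) - (q.1 - q.2)) * m ^ 2| ≤ 2 * √T * δ * B ^ 2 := by
      rw [abs_mul, abs_pow]; gcongr
    have h2 : |(q.1 - q.2) * ((m + n) * (m - n))| ≤ T * ((2 * B) * (C * δ)) := by
      rw [abs_mul, abs_mul, hqa]
      have : |m + n| ≤ 2 * B := (abs_add_le _ _).trans (by linarith)
      gcongr
    rw [e, abs_div, abs_of_pos (by norm_num : (0:ℝ) < 4)]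
    have := abs_add_le (((p.1 - p.2) - (q.1 - q.2)) * m ^ 2) ((q.1 - q.2) * ((m + n) * (m - n)))
    have := abs_nonneg (((p.1 - p.2) - (q.1 - q.2)) * m ^ 2 + (q.1 - q.2) * ((m + n) * (m - n)))
    linarith
  have hτp := sub_nonneg.2 hp.2.1
  have hτq := sub_nonneg.2 hq.2.1
  have he := (abs_exp_neg_sub_exp_neg_le (x := (p.1 - p.2) * m ^ 2 / 4)
    (y := (q.1 - q.2) * n ^ 2 / 4) (by positivity) (by positivity)).trans hx
  have he1 : Real.exp (-((p.1 - p.2) * m ^ 2 / 4)) ≤ 1 :=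
    Real.exp_le_one_iff.2 (by simp only [Left.neg_nonpos_iff]; positivity)
  rw [kernelFactor, kernelFactor, ← hm, ← hn, hpa, hqa, ← mul_sub, abs_mul,
    abs_of_nonneg (by positivity : 0 ≤ √Real.pi / 2), hD, mul_assoc]
  refine mul_le_mul_of_nonneg_left ?_ (by positivity)
  have split : m * Real.exp (-((p.1 - p.2) * m ^ 2 / 4)) -
      n * Real.exp (-((q.1 - q.2) * n ^ 2 / 4)) =
      (m - n) * Real.exp (-((p.1 - p.2) * m ^ 2 / 4)) + n *
      (Real.exp (-((p.1 - p.2) * m ^ 2 / 4)) - Real.exp (-((q.1 - q.2) * n ^ 2 / 4))) := by ring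
  rw [split]
  refine (abs_add_le _ _).trans ?_
  rw [abs_mul, abs_mul, Real.abs_exp]
  calc _ ≤ C * δ * 1 + B * ((2 * √T * B ^ 2 + T * (2 * B * C)) * δ) := by gcongr
    _ = _ := by ring

lemma intervalIntegrable_inv_sqrt (a b : ℝ) :
    IntervalIntegrable (fun x : ℝ => (√x)⁻¹) volume a b := by
  have h := (intervalIntegral.intervalIntegrable_rpow' (a := a) (b := b)
    (by norm_num : (-1:ℝ) < -(1/2))).norm
  refine h.mono_fun (by fun_prop) ?_
  refine Filter.Eventually.of_forall fun x => ?_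
  rcases le_total 0 x with hx | hx
  · simp [Real.sqrt_eq_rpow, Real.rpow_neg hx]
  · simp [Real.sqrt_eq_zero_of_nonpos hx]

lemma integral_inv_sqrt : ∫ θ in (0:ℝ)..1, (√θ)⁻¹ = 2 := by
  have : Set.EqOn (fun θ : ℝ => (√θ)⁻¹) (fun θ => θ ^ (-(1/2) : ℝ)) (Set.uIcc 0 1) := by
    intro θ hθ
    rw [Set.uIcc_of_le zero_le_one] at hθ
    simp only [Real.sqrt_eq_rpow, Real.rpow_neg hθ.1]
  rw [intervalIntegral.integral_congr this, integral_rpow (Or.inl (by norm_num))]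
  norm_num

lemma exists_exp_weight {T ε : ℝ} (hT : 0 < T) (hε : 0 < ε) : ∃ l : ℝ, 0 ≤ l ∧
    ∀ x ∈ Set.Icc 0 T, √x * (∫ θ in (0:ℝ)..1, (√θ)⁻¹ * Real.exp (-(l * (θ * x)))) ≤ ε := by
  set κ := ε / 4 with hκ
  have hκ0 : 0 < κ := by positivity
  refine ⟨T / κ ^ 4, by positivity, fun x hx => ?_⟩
  have hw := intervalIntegrable_inv_sqrt 0 1
  have hg : IntervalIntegrable (fun θ : ℝ => κ * θ ^ (-(3/4) : ℝ)) volume 0 1 :=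
    (intervalIntegral.intervalIntegrable_rpow' (by norm_num)).const_mul _
  rw [← intervalIntegral.integral_const_mul]
  have hint : (∫ θ in (0:ℝ)..1, κ * θ ^ (-(3/4) : ℝ)) = ε := by
    rw [intervalIntegral.integral_const_mul, integral_rpow (Or.inl (by norm_num))]
    norm_num
    rw [hκ]; ring
  rw [← hint]
  refine intervalIntegral.integral_mono_on_of_le_Ioo zero_le_one
    ((hw.mul_continuousOn (by fun_prop)).const_mul _) hg fun θ hθ => ?_
  have hθ0 : 0 < θ := hθ.1
  obtain ⟨hx0, hxT⟩ := hx
  set y := x ^ (1/4 : ℝ) with hy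
  set r := θ ^ (1/4 : ℝ) with hr
  set τ := T ^ (1/4 : ℝ) with hτ
  have hpow : ∀ z : ℝ, 0 ≤ z → (z ^ (1/4 : ℝ)) ^ 4 = z := fun z hz => by
    rw [← Real.rpow_natCast, ← Real.rpow_mul hz]; norm_num
  have hy0 : 0 ≤ y := by positivity
  have hr0 : 0 < r := by positivity
  have hτ0 : 0 < τ := by positivity
  have ex : x = y ^ 4 := (hpow x hx0).symm
  have eθ : θ = r ^ 4 := (hpow θ hθ0.le).symm
  have eT : T = τ ^ 4 := (hpow T hT.le).symm
  have hyτ : y ≤ τ := Real.rpow_le_rpow hx0 hxT (by norm_num)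
  have e1 : √x = y ^ 2 := by
    rw [ex, show y ^ 4 = (y ^ 2) ^ 2 by ring, Real.sqrt_sq (by positivity)]
  have e2 : √θ = r ^ 2 := by
    rw [eθ, show r ^ 4 = (r ^ 2) ^ 2 by ring, Real.sqrt_sq (by positivity)]
  have e3 : θ ^ (-(3/4) : ℝ) = (r ^ 3)⁻¹ := by
    rw [Real.rpow_neg hθ0.le, hr, ← Real.rpow_natCast, ← Real.rpow_mul hθ0.le]; norm_num
  have e4 : T / κ ^ 4 * (θ * x) = (τ * r * y / κ) ^ 4 := by
    rw [eT, eθ, ex]; ring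
  rw [e1, e2, e3, e4]
  set v := τ * r * y / κ with hv
  have hv0 : 0 ≤ v := by positivity
  have hve : v * Real.exp (-(v ^ 4)) ≤ 1 := by
    rw [Real.exp_neg, ← div_eq_mul_inv, div_le_one (Real.exp_pos _)]
    have := Real.add_one_le_exp (v ^ 4)
    nlinarith [sq_nonneg (v ^ 2 - 1/2), sq_nonneg (v - 1/2)]
  have hyv : y * τ * r = κ * v := by rw [hv]; field_simp
  have hyt : y ^ 2 * r ≤ κ * v := by
    rw [← hyv]; nlinarith [mul_nonneg hy0 hr0.le]
  have : y ^ 2 * ((r ^ 2)⁻¹ * Real.exp (-v ^ 4)) =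
      (y ^ 2 * r) * Real.exp (-v ^ 4) * (r ^ 3)⁻¹ := by field_simp
  rw [this]
  refine mul_le_mul_of_nonneg_right ?_ (by positivity)
  calc y ^ 2 * r * Real.exp (-v ^ 4) ≤ κ * v * Real.exp (-v ^ 4) := by gcongr
    _ = κ * (v * Real.exp (-(v ^ 4))) := by ring
    _ ≤ κ * 1 := by gcongr
    _ = κ := mul_one _

lemma intervalIntegrable_beta :
    IntervalIntegrable (fun θ : ℝ => (√(1 - θ))⁻¹ * (√θ)⁻¹) volume 0 1 := by
  have h1 := intervalIntegrable_inv_sqrt 0 1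
  have h2 : IntervalIntegrable (fun θ : ℝ => (√(1 - θ))⁻¹) volume 0 1 := by
    simpa using ((intervalIntegrable_inv_sqrt 0 1).comp_sub_left 1).symm
  refine (h1.add h2).mono_fun' (by fun_prop) ?_
  rw [Set.uIoc_of_le zero_le_one]
  filter_upwards [ae_restrict_mem measurableSet_Ioc] with θ hθ
  obtain ⟨h0, h1⟩ := hθ
  have ha := Real.sqrt_pos.2 h0
  have ha2 := Real.sq_sqrt h0.le
  have hb := Real.sqrt_nonneg (1 - θ)
  have hb2 := Real.sq_sqrt (sub_nonneg.2 h1)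
  rw [Real.norm_of_nonneg (by positivity)]
  rcases hb.eq_or_lt with hb0 | hb0
  · rw [← hb0]; simp
  · have : (√(1 - θ))⁻¹ * (√θ)⁻¹ * 1 ≤ (√(1 - θ))⁻¹ * (√θ)⁻¹ * (√θ + √(1 - θ)) := by
      gcongr
      nlinarith [mul_pos ha hb0]
    calc _ ≤ _ := (mul_one _).symm.le
      _ ≤ _ := this
      _ = _ := by field_simp; ring

namespace TriangleBound

variable {T l M H A : ℝ} {b c : ℝ × ℝ → ℝ} {w : ℝ → ℝ}

lemma const_mul (hb : TriangleBound T l M H b) {k : ℝ} (hk : 0 ≤ k) :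
    TriangleBound T l (k * M) (k * H) (fun p => k * b p) := by
  refine ⟨mul_nonneg hk hb.nonneg_sup, mul_nonneg hk hb.nonneg_holder, fun p hp => ?_,
    fun p hp q hq h => ?_⟩
  · rw [abs_mul, abs_of_nonneg hk, mul_assoc]
    exact mul_le_mul_of_nonneg_left (hb.sup_le p hp) hk
  · rw [← mul_sub, abs_mul, abs_of_nonneg hk, mul_assoc, mul_assoc, ← mul_assoc H]
    exact mul_le_mul_of_nonneg_left (hb.holder_le p hp q hq h) hk

lemma weightedComp_unweighted (hb : TriangleBound T 0 A A b) (hc : TriangleBound T 0 A A c)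
    (hw : IntervalIntegrable w volume 0 1) (hw0 : ∀ θ, 0 ≤ w θ) :
    TriangleBound T 0 (2 * A ^ 2 * ∫ θ in (0:ℝ)..1, w θ) (2 * A ^ 2 * ∫ θ in (0:ℝ)..1, w θ)
      (weightedComp w b c) := by
  have hA := hb.nonneg_sup
  have hW : 0 ≤ ∫ θ in (0:ℝ)..1, w θ :=
    intervalIntegral.integral_nonneg zero_le_one fun θ _ => hw0 θ
  refine ⟨by positivity, by positivity, fun p hp => ?_, fun p hp q hq hpq => ?_⟩
  · refine (hb.abs_weightedComp_le hc hw hw0 hp).trans ?_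
    simp only [zero_mul, neg_zero, Real.exp_zero, mul_one]
    nlinarith [mul_nonneg (mul_nonneg hA hA) hW]
  · refine (hb.abs_weightedComp_sub_le hc le_rfl hw hw0 hp hq hpq).trans (le_of_eq ?_)
    simp only [zero_mul, neg_zero, Real.exp_zero, mul_one]
    ring

/-- One step of the Neumann series halves the weighted bounds, once `l` is large. -/
lemma sqrt_mul_weightedComp (hA : TriangleBound T 0 A A c) (hl : 0 ≤ l)
    (hsmall : ∀ x ∈ Set.Icc 0 T,
      A * (√x * (∫ θ in (0:ℝ)..1, (√θ)⁻¹ * Real.exp (-(l * (θ * x))))) ≤ 1 / 4)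
    (hH : A * (4 + 2 * √T) ≤ H / 4)
    (hb : TriangleBound T l M (M * H) b) :
    TriangleBound T l (M / 2) (M / 2 * H)
      (fun p => √(p.1 - p.2) * weightedComp (fun θ => (√θ)⁻¹) b c p) := by
  have hA0 := hA.nonneg_sup
  have hM0 := hb.nonneg_sup
  have hMH := hb.nonneg_holder
  have hH0 : 0 ≤ H := by have : 0 ≤ A * (4 + 2 * √T) := by positivity
                         linarith
  have hw0 : ∀ θ : ℝ, 0 ≤ (√θ)⁻¹ := fun θ => by positivity
  have hw := intervalIntegrable_inv_sqrt 0 1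
  refine ⟨by positivity, by positivity, fun p hp => ?_, fun p hp q hq hpq => ?_⟩
  · have hτ := sub_nonneg.2 hp.2.1
    have hτT : p.1 - p.2 ≤ T := by have := hp.1; have := hp.2.2; linarith
    have h1 := hb.abs_weightedComp_le hA hw hw0 hp
    have h2 := hsmall _ ⟨hτ, hτT⟩
    rw [abs_mul, abs_of_nonneg (Real.sqrt_nonneg _)]
    refine (mul_le_mul_of_nonneg_left h1 (Real.sqrt_nonneg _)).trans ?_
    set I := ∫ θ in (0:ℝ)..1, (√θ)⁻¹ * Real.exp (-(l * (θ * (p.1 - p.2))))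
    calc √(p.1 - p.2) * (M * A * I * Real.exp (l * (p.1 - p.2)))
        = M * (A * (√(p.1 - p.2) * I)) * Real.exp (l * (p.1 - p.2)) := by ring
      _ ≤ M * (1 / 2) * Real.exp (l * (p.1 - p.2)) := by gcongr; linarith
      _ = _ := by ring
  · have hτ := sub_nonneg.2 hp.2.1
    have hτq := sub_nonneg.2 hq.2.1
    have hτT : p.1 - p.2 ≤ T := by have := hp.1; have := hp.2.2; linarith
    have h2 := hsmall _ ⟨hτ, hτT⟩
    have h3 := hb.abs_weightedComp_sub_le hA hl hw hw0 hp hq hpq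
    have h4 := hb.abs_weightedComp_le hA hw hw0 hq
    have h5 : (∫ θ in (0:ℝ)..1, (√θ)⁻¹ * Real.exp (-(l * (θ * (q.1 - q.2))))) ≤ 2 := by
      rw [← integral_inv_sqrt]
      refine intervalIntegral.integral_mono_on zero_le_one (hw.mul_continuousOn (by fun_prop)) hw
        fun θ hθ => mul_le_of_le_one_right (hw0 θ) (Real.exp_le_one_iff.2 ?_)
      have := hθ.1
      simp only [Left.neg_nonpos_iff]; positivity
    have h5' : 0 ≤ ∫ θ in (0:ℝ)..1, (√θ)⁻¹ * Real.exp (-(l * (θ * (q.1 - q.2)))) :=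
      intervalIntegral.integral_nonneg zero_le_one fun θ _ => by positivity
    have h6 : |√(p.1 - p.2) - √(q.1 - q.2)| ≤ 2 * √(dist p q) := by
      refine (abs_sqrt_sub_sqrt_le hτq hpq).trans ?_
      have : (2:ℝ) * √(dist p q) = √(4 * dist p q) := by
        rw [Real.sqrt_mul (by norm_num), show (4:ℝ) = 2 ^ 2 by norm_num,
          Real.sqrt_sq (by norm_num)]
      rw [this]
      apply Real.sqrt_le_sqrt
      have := (le_abs_self _).trans (abs_diff_sub_diff_le p q)
      have := dist_nonneg (x := p) (y := q)
      linarith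
    rw [integral_inv_sqrt] at h3
    set I := ∫ θ in (0:ℝ)..1, (√θ)⁻¹ * Real.exp (-(l * (θ * (p.1 - p.2))))
    set E := Real.exp (l * (p.1 - p.2)) with hE
    have hE0 : 0 ≤ E := (Real.exp_pos _).le
    have h4' : |weightedComp (fun θ => (√θ)⁻¹) b c q| ≤ M * A * 2 * E := by
      refine h4.trans ?_
      rw [hE]
      gcongr
    have split : ∀ x y u v : ℝ, x * u - y * v = x * (u - v) + (x - y) * v := by intros; ring
    rw [split]
    refine (abs_add_le _ _).trans ?_
    rw [abs_mul, abs_mul, abs_of_nonneg (Real.sqrt_nonneg _)]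
    have hs : √(p.1 - p.2) ≤ √T := Real.sqrt_le_sqrt hτT
    calc _ ≤ √(p.1 - p.2) * (A * (M * H * I + M * 2) * E * √(dist p q)) +
          (2 * √(dist p q)) * (M * A * 2 * E) := by gcongr
      _ = M * (H * (A * (√(p.1 - p.2) * I)) + A * (4 + 2 * √(p.1 - p.2))) * E * √(dist p q) := by
          ring
      _ ≤ M * (H * (1 / 4) + A * (4 + 2 * √T)) * E * √(dist p q) := by gcongr
      _ ≤ M * (H * (1 / 4) + H / 4) * E * √(dist p q) := by gcongr
      _ = _ := by ring

end TriangleBound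

lemma integral_mul_div_sqrt_eq (b c : ℝ × ℝ → ℝ) {s t : ℝ} (h : s ≤ t) :
    ∫ u in s..t, b (t, u) * (c (u, s) / √(u - s)) =
      √(t - s) * weightedComp (fun θ => (√θ)⁻¹) b c (t, s) := by
  have h1 := intervalIntegral.smul_integral_comp_add_mul (a := 0) (b := 1)
    (fun u => b (t, u) * (c (u, s) / √(u - s))) (t - s) s
  rw [mul_zero, add_zero, mul_one, add_sub_cancel] at h1
  rw [← h1, smul_eq_mul, weightedComp, ← intervalIntegral.integral_const_mul,
    ← intervalIntegral.integral_const_mul]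
  refine intervalIntegral.integral_congr fun θ _ => ?_
  have hτ := sub_nonneg.2 h
  have e1 : segPoint (t, s) θ = s + (t - s) * θ := by simp only [segPoint]; ring
  have e2 : s + (t - s) * θ - s = (t - s) * θ := by ring
  have e3 : (t - s) * (√(t - s))⁻¹ = √(t - s) := by
    rw [← div_eq_mul_inv, Real.div_sqrt]
  simp only [e1, e2, div_eq_mul_inv, Real.sqrt_mul hτ, mul_inv]
  linear_combination b (t, s + (t - s) * θ) * c (s + (t - s) * θ, s) * (√θ)⁻¹ * e3

lemma integral_div_sqrt_mul_div_sqrt_eq (b c : ℝ × ℝ → ℝ) {s t : ℝ} (h : s < t) :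
    ∫ u in s..t, b (t, u) / √(t - u) * (c (u, s) / √(u - s)) =
      weightedComp (fun θ => (√(1 - θ))⁻¹ * (√θ)⁻¹) b c (t, s) := by
  have h1 := intervalIntegral.smul_integral_comp_add_mul (a := 0) (b := 1)
    (fun u => b (t, u) / √(t - u) * (c (u, s) / √(u - s))) (t - s) s
  rw [mul_zero, add_zero, mul_one, add_sub_cancel] at h1
  rw [← h1, smul_eq_mul, weightedComp, ← intervalIntegral.integral_const_mul]
  refine intervalIntegral.integral_congr fun θ _ => ?_
  have hτ := sub_pos.2 h
  have e1 : segPoint (t, s) θ = s + (t - s) * θ := by simp only [segPoint]; ring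
  have e2 : s + (t - s) * θ - s = (t - s) * θ := by ring
  have e4 : t - (s + (t - s) * θ) = (t - s) * (1 - θ) := by ring
  have e3 : (t - s) * ((√(t - s))⁻¹ * (√(t - s))⁻¹) = 1 := by
    rw [← mul_inv, Real.mul_self_sqrt hτ.le, mul_inv_cancel₀ hτ.ne']
  simp only [e1, e2, e4, div_eq_mul_inv, Real.sqrt_mul hτ.le, mul_inv]
  linear_combination b (t, s + (t - s) * θ) * c (s + (t - s) * θ, s) * (√θ)⁻¹ *
    (√(1 - θ))⁻¹ * e3

/-- Fubini on a triangle for a kernel with an inverse square root singularity. -/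
lemma integral_mul_integral_div_sqrt {t A : ℝ} (ht : 0 ≤ t) {k f : ℝ → ℝ} {a : ℝ × ℝ → ℝ}
    (ha : Continuous a) (hA : ∀ p, |a p| ≤ A) (hk : IntervalIntegrable k volume 0 t)
    (hf : ContinuousOn f (Set.Icc 0 t)) :
    ∫ u in (0:ℝ)..t, k u * (∫ s in (0:ℝ)..u, a (u, s) / √(u - s) * f s) =
      ∫ s in (0:ℝ)..t, (∫ u in s..t, k u * (a (u, s) / √(u - s))) * f s := by
  have hzero : ∀ u s : ℝ, u ≤ s → a (u, s) / √(u - s) = 0 := fun u s h => by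
    rw [Real.sqrt_eq_zero_of_nonpos (sub_nonpos.2 h), div_zero]
  have hL : ∫ u in (0:ℝ)..t, k u * (∫ s in (0:ℝ)..u, a (u, s) / √(u - s) * f s) =
      ∫ u in Set.Ioc 0 t, ∫ s in Set.Ioc 0 t, k u * (a (u, s) / √(u - s) * f s) := by
    rw [intervalIntegral.integral_of_le ht]
    refine setIntegral_congr_fun measurableSet_Ioc fun u hu => ?_
    rw [integral_const_mul, intervalIntegral.integral_of_le hu.1.le]
    congr 1
    refine (setIntegral_eq_of_subset_of_forall_sdiff_eq_zero measurableSet_Ioc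
      (Set.Ioc_subset_Ioc_right hu.2) fun s hs => ?_).symm
    have : u ≤ s := by
      by_contra! h
      exact hs.2 ⟨hs.1.1, h.le⟩
    rw [hzero u s this, zero_mul]
  have hR : ∫ s in (0:ℝ)..t, (∫ u in s..t, k u * (a (u, s) / √(u - s))) * f s =
      ∫ s in Set.Ioc 0 t, ∫ u in Set.Ioc 0 t, k u * (a (u, s) / √(u - s) * f s) := by
    rw [intervalIntegral.integral_of_le ht]
    refine setIntegral_congr_fun measurableSet_Ioc fun s hs => ?_
    simp only [← mul_assoc]
    rw [integral_mul_const, intervalIntegral.integral_of_le hs.2]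
    congr 1
    refine (setIntegral_eq_of_subset_of_forall_sdiff_eq_zero measurableSet_Ioc
      (Set.Ioc_subset_Ioc_left hs.1.le) fun u hu => ?_).symm
    have : u ≤ s := by
      by_contra! h
      exact hu.2 ⟨h, hu.1.2⟩
    rw [hzero u s this, mul_zero]
  rw [hL, hR]
  refine integral_integral_swap ?_
  obtain ⟨F, hF⟩ := isCompact_Icc.exists_bound_of_continuousOn hf
  have hk' : Integrable ((Set.Ioc 0 t).indicator k) :=
    (integrable_indicator_iff measurableSet_Ioc).2
      ((intervalIntegrable_iff_integrableOn_Ioc_of_le ht).1 hk)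
  have hg' : Integrable ((Set.Ioc (-t) t).indicator fun x : ℝ => (√(-x))⁻¹) := by
    rw [integrable_indicator_iff measurableSet_Ioc,
      ← intervalIntegrable_iff_integrableOn_Ioc_of_le (by linarith)]
    simpa using ((intervalIntegrable_inv_sqrt (-t) t).comp_sub_left 0).symm
  have hconv := (hk'.convolution_integrand (ContinuousLinearMap.mul ℝ ℝ) hg').swap
  have hconv' : Integrable (fun p : ℝ × ℝ => (Set.Ioc 0 t).indicator k p.1 *
      (Set.Ioc (-t) t).indicator (fun x : ℝ => (√(-x))⁻¹) (p.2 - p.1))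
      ((volume.restrict (Set.Ioc 0 t)).prod (volume.restrict (Set.Ioc 0 t))) := by
    rw [Measure.prod_restrict]
    exact hconv.restrict
  have hfm : AEStronglyMeasurable f (volume.restrict (Set.Ioc 0 t)) :=
    (hf.mono Set.Ioc_subset_Icc_self).aestronglyMeasurable measurableSet_Ioc
  have hmem : ∀ᵐ p : ℝ × ℝ ∂((volume.restrict (Set.Ioc 0 t)).prod
      (volume.restrict (Set.Ioc 0 t))), p ∈ Set.Ioc 0 t ×ˢ Set.Ioc 0 t := by
    rw [Measure.prod_restrict]
    exact ae_restrict_mem (measurableSet_Ioc.prod measurableSet_Ioc)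
  have hint := hconv'.bdd_mul (f := fun p : ℝ × ℝ => a p * f p.2) (c := A * F)
    (ha.aestronglyMeasurable.mul hfm.comp_snd) (by
      filter_upwards [hmem] with p hp
      rw [norm_mul]
      exact mul_le_mul (hA p) (hF _ (Set.Ioc_subset_Icc_self hp.2)) (norm_nonneg _)
        ((abs_nonneg _).trans (hA p)))
  refine hint.congr ?_
  filter_upwards [hmem] with p hp
  have h1 : p.2 - p.1 ∈ Set.Ioc (-t) t := by
    have := hp.1.1; have := hp.1.2; have := hp.2.1; have := hp.2.2
    constructor <;> linarith
  simp only [Set.indicator_of_mem hp.1, Set.indicator_of_mem h1, Function.uncurry, neg_sub,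
    div_eq_mul_inv]
  ring

/-- The kernels of the Neumann series after the first two terms. -/
noncomputable def iteratedKernel (a : ℝ × ℝ → ℝ) : ℕ → ℝ × ℝ → ℝ
  | 0 => fun p => Real.pi⁻¹ * weightedComp (fun θ => (√(1 - θ))⁻¹ * (√θ)⁻¹) a a p
  | n + 1 => fun p => Real.pi⁻¹ *
      (√(p.1 - p.2) * weightedComp (fun θ => (√θ)⁻¹) (iteratedKernel a n) a p)

lemma exists_triangleBound_iteratedKernel {T A : ℝ} (hT : 0 < T) {a : ℝ × ℝ → ℝ}
    (ha : TriangleBound T 0 A A a) : ∃ l M H : ℝ, 0 ≤ l ∧ ∀ n,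
      TriangleBound T l (M / 2 ^ n) (M / 2 ^ n * H) (iteratedKernel a n) := by
  have hA := ha.nonneg_sup
  obtain ⟨l, hl, hsmall⟩ := exists_exp_weight hT (ε := 1 / (4 * (A + 1))) (by positivity)
  have h0 := (ha.weightedComp_unweighted ha intervalIntegrable_beta
    (fun θ => by positivity)).const_mul (k := Real.pi⁻¹) (by positivity)
  set M := Real.pi⁻¹ * (2 * A ^ 2 * ∫ θ in (0:ℝ)..1, (√(1 - θ))⁻¹ * (√θ)⁻¹)
  have hM := h0.nonneg_sup
  set H := 4 * (A * (4 + 2 * √T)) + 1 with hH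
  have hH1 : 1 ≤ H := by
    have : 0 ≤ A * (4 + 2 * √T) := by positivity
    linarith
  refine ⟨l, M, H, hl, fun n => ?_⟩
  induction n with
  | zero =>
    simp only [pow_zero, div_one]
    exact h0.mono hl le_rfl (le_mul_of_one_le_right hM hH1)
  | succ n ih =>
    have step := TriangleBound.sqrt_mul_weightedComp (H := H) ha hl (fun x hx => by
      calc _ ≤ A * (1 / (4 * (A + 1))) := mul_le_mul_of_nonneg_left (hsmall x hx) hA
        _ ≤ 1 / 4 := by
          rw [mul_one_div, div_le_div_iff₀ (by positivity) (by norm_num)]; linarith)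
      (by rw [hH]; linarith) ih
    have hpi : Real.pi⁻¹ ≤ 1 := inv_le_one_of_one_le₀ (by linarith [Real.pi_gt_three])
    have e : M / 2 ^ n / 2 = M / 2 ^ (n + 1) := by rw [pow_succ]; field_simp
    have := (step.const_mul (k := Real.pi⁻¹) (by positivity)).mono le_rfl
      (mul_le_of_le_one_left step.nonneg_sup hpi) (mul_le_of_le_one_left step.nonneg_holder hpi)
    rw [e] at this
    exact this

lemma pi_mul_integral_eq {T t A : ℝ} (ht : t ∈ Set.Ioo 0 T) {k f N : ℝ → ℝ} {a : ℝ × ℝ → ℝ}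
    (ha : Continuous a) (hA : ∀ p, |a p| ≤ A) (hk : IntervalIntegrable k volume 0 t)
    (hf : ContinuousOn f (Set.Icc 0 T)) (hN : ContinuousOn N (Set.Icc 0 T))
    (hV : ∀ u ∈ Set.Ioo 0 T,
      Real.pi * f u = N u + ∫ s in (0:ℝ)..u, a (u, s) / √(u - s) * f s) :
    Real.pi * ∫ u in (0:ℝ)..t, k u * f u = (∫ u in (0:ℝ)..t, k u * N u) +
      ∫ s in (0:ℝ)..t, (∫ u in s..t, k u * (a (u, s) / √(u - s))) * f s := by
  have hsub : Set.uIcc 0 t ⊆ Set.Icc 0 T := by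
    rw [Set.uIcc_of_le ht.1.le]; exact Set.Icc_subset_Icc_right ht.2.le
  have hkf := hk.mul_continuousOn (hf.mono hsub)
  have hkN := hk.mul_continuousOn (hN.mono hsub)
  rw [← integral_mul_integral_div_sqrt ht.1.le ha hA hk
    (hf.mono (Set.Icc_subset_Icc_right ht.2.le)), ← intervalIntegral.integral_const_mul,
    ← sub_eq_iff_eq_add', ← intervalIntegral.integral_sub (hkf.const_mul _) hkN,
    intervalIntegral.integral_of_le ht.1.le, intervalIntegral.integral_of_le ht.1.le]
  refine setIntegral_congr_fun measurableSet_Ioc fun u hu => ?_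
  have := hV u ⟨hu.1, hu.2.trans_lt ht.2⟩
  linear_combination k u * this

lemma iteratedKernel_expansion {T t A : ℝ} (ht : t ∈ Set.Ioo 0 T) {f N : ℝ → ℝ} {a : ℝ × ℝ → ℝ}
    (ha : Continuous a) (hA : ∀ p, |a p| ≤ A)
    (hf : ContinuousOn f (Set.Icc 0 T)) (hN : ContinuousOn N (Set.Icc 0 T))
    (hV : ∀ u ∈ Set.Ioo 0 T,
      Real.pi * f u = N u + ∫ s in (0:ℝ)..u, a (u, s) / √(u - s) * f s)
    (hh : ∀ n, IntervalIntegrable (fun s => iteratedKernel a n (t, s)) volume 0 t) (n : ℕ) :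
    f t = N t / Real.pi + 1 / Real.pi ^ 2 * ((∫ s in (0:ℝ)..t, a (t, s) / √(t - s) * N s) +
      ∑ j ∈ Finset.range n, ∫ s in (0:ℝ)..t, iteratedKernel a j (t, s) * N s) +
      1 / Real.pi * ∫ s in (0:ℝ)..t, iteratedKernel a n (t, s) * f s := by
  have hpi := Real.pi_ne_zero
  have hK : IntervalIntegrable (fun s => a (t, s) / √(t - s)) volume 0 t := by
    have : IntervalIntegrable (fun s => (√(t - s))⁻¹) volume 0 t := by
      simpa using ((intervalIntegrable_inv_sqrt 0 t).comp_sub_left t).symm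
    simp only [div_eq_mul_inv]
    exact this.continuousOn_mul (by fun_prop)
  induction n with
  | zero =>
    have h := pi_mul_integral_eq ht ha hA hK hf hN hV
    have e : ∫ s in (0:ℝ)..t, (∫ u in s..t, a (t, u) / √(t - u) * (a (u, s) / √(u - s))) * f s =
        Real.pi * ∫ s in (0:ℝ)..t, iteratedKernel a 0 (t, s) * f s := by
      rw [← intervalIntegral.integral_const_mul, intervalIntegral.integral_of_le ht.1.le,
        intervalIntegral.integral_of_le ht.1.le, integral_Ioc_eq_integral_Ioo,
        integral_Ioc_eq_integral_Ioo]
      refine setIntegral_congr_fun measurableSet_Ioo fun s hs => ?_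
      simp only [integral_div_sqrt_mul_div_sqrt_eq a a hs.2, iteratedKernel]
      field_simp
    have h2 := hV t ht
    rw [e] at h
    simp only [Finset.range_zero, Finset.sum_empty, add_zero]
    generalize ∫ s in (0:ℝ)..t, a (t, s) / √(t - s) * N s = I at h ⊢
    field_simp
    linear_combination Real.pi * h2 + h
  | succ n ih =>
    have h := pi_mul_integral_eq ht ha hA (hh n) hf hN hV
    have e : ∫ s in (0:ℝ)..t, (∫ u in s..t, iteratedKernel a n (t, u) *
        (a (u, s) / √(u - s))) * f s =
        Real.pi * ∫ s in (0:ℝ)..t, iteratedKernel a (n + 1) (t, s) * f s := by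
      rw [← intervalIntegral.integral_const_mul, intervalIntegral.integral_of_le ht.1.le,
        intervalIntegral.integral_of_le ht.1.le]
      refine setIntegral_congr_fun measurableSet_Ioc fun s hs => ?_
      simp only [integral_mul_div_sqrt_eq (iteratedKernel a n) a hs.2]
      rw [iteratedKernel]
      field_simp
    rw [e] at h
    rw [Finset.sum_range_succ]
    rw [ih]
    field_simp
    linear_combination h

lemma exists_clamped_extension {T β : ℝ} (hT : 0 < T) (hβ : 1 / 2 < β) {g : ℝ → ℝ}
    (hg : ∃ C : ℝ, 0 ≤ C ∧ ∀ s ∈ Set.Icc (0:ℝ) T, ∀ t ∈ Set.Icc (0:ℝ) T,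
      |g s - g t| ≤ C * |s - t| ^ β) :
    ∃ (ψ : ℝ → ℝ) (B C : ℝ), (∀ x ∈ Set.Icc 0 T, ψ x = g x) ∧ Continuous ψ ∧
      (∀ x, |ψ x| ≤ B) ∧ 0 ≤ C ∧ ∀ x y, |ψ x - ψ y| ≤ C * √|x - y| := by
  obtain ⟨C, hC, hgC⟩ := hg
  have key : ∀ s ∈ Set.Icc (0:ℝ) T, ∀ t ∈ Set.Icc (0:ℝ) T,
      |g s - g t| ≤ C * T ^ (β - 1 / 2) * √|s - t| := by
    intro s hs t ht
    refine (hgC s hs t ht).trans ?_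
    have hd : |s - t| ≤ T := abs_le.2 ⟨by linarith [hs.1, ht.2], by linarith [hs.2, ht.1]⟩
    have : |s - t| ^ β = |s - t| ^ (β - 1 / 2) * √|s - t| := by
      rw [Real.sqrt_eq_rpow, ← Real.rpow_add_of_nonneg (abs_nonneg _) (by linarith) (by norm_num)]
      ring_nf
    rw [this, mul_assoc]
    have h2 : |s - t| ^ (β - 1 / 2) ≤ T ^ (β - 1 / 2) :=
      Real.rpow_le_rpow (abs_nonneg _) hd (by linarith)
    gcongr
  set D := C * T ^ (β - 1 / 2) with hD
  have hD0 : 0 ≤ D := by positivity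
  set P : ℝ → ℝ := fun x => (Set.projIcc 0 T hT.le x : ℝ)
  have hP : ∀ x, P x ∈ Set.Icc 0 T := fun x => (Set.projIcc 0 T hT.le x).2
  have hPlip : ∀ x y, |P x - P y| ≤ |x - y| := fun x y => by
    have := (LipschitzWith.projIcc hT.le).dist_le_mul x y
    simpa [Subtype.dist_eq, Real.dist_eq] using this
  have hψ : ∀ x y, |g (P x) - g (P y)| ≤ D * √|x - y| := fun x y => by
    refine (key _ (hP x) _ (hP y)).trans ?_
    have := hPlip x y
    gcongr
  refine ⟨fun x => g (P x), |g 0| + D * √T, D, fun x hx => ?_, ?_, fun x => ?_, hD0, hψ⟩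
  · simp only [P, Set.projIcc_of_mem hT.le hx]
  · refine continuous_iff_continuousAt.2 fun y => ?_
    rw [ContinuousAt, tendsto_iff_dist_tendsto_zero]
    have h0 : Filter.Tendsto (fun x : ℝ => D * √|x - y|) (nhds y) (nhds 0) := by
      have : Continuous (fun x : ℝ => D * √|x - y|) := by fun_prop
      simpa using this.tendsto y
    exact squeeze_zero (fun _ => dist_nonneg) (fun x => by rw [Real.dist_eq]; exact hψ x y) h0
  · have h0 : (0:ℝ) ∈ Set.Icc 0 T := ⟨le_rfl, hT.le⟩
    have h1 := key _ (hP x) 0 h0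
    have h2 : √|P x - 0| ≤ √T := by
      apply Real.sqrt_le_sqrt
      rw [sub_zero, abs_of_nonneg (hP x).1]
      exact (hP x).2
    have h3 := mul_le_mul_of_nonneg_left h2 hD0
    have h4 := abs_sub_abs_le_abs_sub (g (P x)) (g 0)
    simp only
    linarith

lemma segMean_eq_divided_difference {T : ℝ} {ξ ξ' ψ : ℝ → ℝ}
    (hξ : ∀ t ∈ Set.Icc (0:ℝ) T, HasDerivAt ξ (ξ' t) t) (hψ : Continuous ψ)
    (hψξ : ∀ x ∈ Set.Icc 0 T, ψ x = ξ' x) {s t : ℝ} (hs : 0 ≤ s) (hst : s < t) (ht : t ≤ T) :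
    segMean ψ (t, s) = (ξ t - ξ s) / (t - s) := by
  have h1 := intervalIntegral.smul_integral_comp_add_mul (a := 0) (b := 1) ψ (t - s) s
  rw [mul_zero, add_zero, mul_one, add_sub_cancel] at h1
  have h2 : ∫ x in s..t, ψ x = ξ t - ξ s := by
    refine intervalIntegral.integral_eq_sub_of_hasDerivAt (fun x hx => ?_)
      (hψ.intervalIntegrable _ _)
    rw [Set.uIcc_of_le hst.le] at hx
    have hx' : x ∈ Set.Icc 0 T := ⟨hs.trans hx.1, hx.2.trans ht⟩
    rw [hψξ x hx']
    exact hξ x hx'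
  rw [eq_div_iff (sub_pos.2 hst).ne', ← h2, ← h1, smul_eq_mul, mul_comm]
  congr 1
  simp only [segMean, segPoint, mul_comm]

lemma kernel_eq_kernelFactor_div_sqrt {T : ℝ} {ξ ξ' ψ : ℝ → ℝ}
    (hξ : ∀ t ∈ Set.Icc (0:ℝ) T, HasDerivAt ξ (ξ' t) t) (hψ : Continuous ψ)
    (hψξ : ∀ x ∈ Set.Icc 0 T, ψ x = ξ' x) {s t : ℝ} (hs : 0 ≤ s) (hst : s ≤ t) (ht : t ≤ T) :
    (√Real.pi / 2) * ((ξ t - ξ s) / (t - s)) *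
      (Real.exp (-((ξ t - ξ s) ^ 2 / (4 * (t - s)))) / √(t - s)) =
    kernelFactor ψ (t, s) / √(t - s) := by
  rcases hst.eq_or_lt with rfl | hlt
  · simp
  have hτ := sub_pos.2 hlt
  have e : |t - s| * ((ξ t - ξ s) / (t - s)) ^ 2 / 4 = (ξ t - ξ s) ^ 2 / (4 * (t - s)) := by
    rw [abs_of_pos hτ]; field_simp
  rw [kernelFactor, segMean_eq_divided_difference hξ hψ hψξ hs hlt ht]
  simp only [e]
  ring

/-- If `ξ ∈ C^{1+β}([0,T'])` with `β > 1/2`, `N₂` is continuous, and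
`f₂` is a continuous solution of the Volterra equation
`π f₂(t) = N₂(t) + ∫_0^t K₂(s,t) f₂(s) ds` with the kernel
`K₂(s,t) = (√π/2)((ξ(t)-ξ(s))/(t-s)) e^{-(ξ(t)-ξ(s))²/(4(t-s))}/(t-s)^{1/2}`, then there
is a function `G₂`, Hölder continuous of order `1/2` on the closed triangle
`{0 ≤ s ≤ t ≤ T'}`, with
`f₂(t) = N₂(t)/π + (1/π²) ∫_0^t (K₂(s,t) + G₂(t,s)) N₂(s) ds` on `(0,T')`. -/
theorem stmt13 (T' β : ℝ) (hT' : 0 < T') (hβ : 1/2 < β)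
    (ξ ξ' : ℝ → ℝ)
    (hξderiv : ∀ t ∈ Set.Icc (0:ℝ) T', HasDerivAt ξ (ξ' t) t)
    (hξ'holder : ∃ C : ℝ, 0 ≤ C ∧ ∀ s ∈ Set.Icc (0:ℝ) T', ∀ t ∈ Set.Icc (0:ℝ) T',
      |ξ' s - ξ' t| ≤ C * |s - t| ^ β)
    (N₂ f₂ : ℝ → ℝ)
    (hN₂ : ContinuousOn N₂ (Set.Icc 0 T'))
    (hf₂ : ContinuousOn f₂ (Set.Icc 0 T'))
    (hVolterra : ∀ t ∈ Set.Ioo (0:ℝ) T',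
      Real.pi * f₂ t = N₂ t + ∫ s in (0:ℝ)..t,
        (Real.sqrt Real.pi / 2) * ((ξ t - ξ s)/(t - s)) *
          (Real.exp (-((ξ t - ξ s)^2/(4*(t - s)))) / Real.sqrt (t - s)) * f₂ s) :
    ∃ G₂ : ℝ → ℝ → ℝ,
      (∃ C : ℝ, 0 ≤ C ∧
        ∀ p ∈ {p : ℝ × ℝ | 0 ≤ p.2 ∧ p.2 ≤ p.1 ∧ p.1 ≤ T'},
        ∀ q ∈ {p : ℝ × ℝ | 0 ≤ p.2 ∧ p.2 ≤ p.1 ∧ p.1 ≤ T'},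
          |G₂ p.1 p.2 - G₂ q.1 q.2| ≤ C * dist p q ^ ((1:ℝ)/2)) ∧
      ∀ t ∈ Set.Ioo (0:ℝ) T',
        f₂ t = N₂ t / Real.pi + (1/Real.pi^2) * ∫ s in (0:ℝ)..t,
          ((Real.sqrt Real.pi / 2) * ((ξ t - ξ s)/(t - s)) *
            (Real.exp (-((ξ t - ξ s)^2/(4*(t - s)))) / Real.sqrt (t - s)) + G₂ t s) * N₂ s := by
  obtain ⟨ψ, B, C, hψξ, hψ, hψB, hC, hψC⟩ := exists_clamped_extension hT' hβ hξ'holder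
  obtain ⟨A, hA⟩ := exists_triangleBound_kernelFactor hT'.le hψ hψB hC hψC
  have ha := continuous_kernelFactor hψ
  have haB := abs_kernelFactor_le hψB
  set a := kernelFactor ψ
  obtain ⟨l, M, H, hl, hh⟩ := exists_triangleBound_iteratedKernel hT' hA
  have hM0 : 0 ≤ M := by simpa using (hh 0).nonneg_sup
  have hMH0 : 0 ≤ M * H := by simpa using (hh 0).nonneg_holder
  set E := Real.exp (l * T') with hE
  have hE0 : 0 < E := Real.exp_pos _
  have hgeo : ∀ x : ℝ, HasSum (fun n : ℕ => x / 2 ^ n) (2 * x) := fun x => by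
    have := hasSum_geometric_two' (2 * x)
    simpa using this
  have hsup : ∀ n, ∀ p ∈ closedTriangle T', |iteratedKernel a n p| ≤ M * E / 2 ^ n :=
    fun n p hp => ((hh n).abs_le hl hp).trans_eq (by ring)
  have hsummable : ∀ p ∈ closedTriangle T', Summable fun n => iteratedKernel a n p := fun p hp =>
    (hgeo (M * E)).summable.of_norm_bounded fun n => hsup n p hp
  refine ⟨fun t s => ∑' n, iteratedKernel a n (t, s), ⟨2 * (M * H * E), by positivity, ?_⟩, ?_⟩
  · intro p hp q hq
    rw [← Real.sqrt_eq_rpow, ← (hsummable p hp).tsum_sub (hsummable q hq), mul_assoc]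
    refine tsum_of_norm_bounded
      (f := fun n => iteratedKernel a n (p.1, p.2) - iteratedKernel a n (q.1, q.2))
      (hgeo (M * H * E * √(dist p q))) fun n => ?_
    exact ((hh n).abs_sub_le hl hp hq).trans_eq (by ring)
  intro t ht
  have hsub : Set.uIcc 0 t ⊆ Set.Icc 0 T' := by
    rw [Set.uIcc_of_le ht.1.le]; exact Set.Icc_subset_Icc_right ht.2.le
  have hmem : ∀ s ∈ Set.uIcc 0 t, (t, s) ∈ closedTriangle T' := fun s hs => by
    rw [Set.uIcc_of_le ht.1.le] at hs
    exact ⟨hs.1, hs.2, ht.2.le⟩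
  have hcont : ∀ n, ContinuousOn (fun s => iteratedKernel a n (t, s)) (Set.uIcc 0 t) := fun n =>
    ((hh n).continuousOn hl).comp (by fun_prop) hmem
  have hkernel : ∀ u ∈ Set.Ioo 0 T', ∀ s ∈ Set.uIcc 0 u,
      (√Real.pi / 2) * ((ξ u - ξ s) / (u - s)) *
        (Real.exp (-((ξ u - ξ s) ^ 2 / (4 * (u - s)))) / √(u - s)) = a (u, s) / √(u - s) :=
    fun u hu s hs => by
      rw [Set.uIcc_of_le hu.1.le] at hs
      exact kernel_eq_kernelFactor_div_sqrt hξderiv hψ hψξ hs.1 hs.2 hu.2.le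
  have hV : ∀ u ∈ Set.Ioo 0 T',
      Real.pi * f₂ u = N₂ u + ∫ s in (0:ℝ)..u, a (u, s) / √(u - s) * f₂ s := fun u hu => by
    rw [hVolterra u hu]
    congr 1
    exact intervalIntegral.integral_congr fun s hs => by simp only [hkernel u hu s hs]
  have hexp := iteratedKernel_expansion ht ha haB hf₂ hN₂ hV fun n => (hcont n).intervalIntegrable
  have hK : IntervalIntegrable (fun s => a (t, s) / √(t - s) * N₂ s) volume 0 t := by
    have : IntervalIntegrable (fun s => (√(t - s))⁻¹) volume 0 t := by
      simpa using ((intervalIntegrable_inv_sqrt 0 t).comp_sub_left t).symm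
    simp only [div_eq_mul_inv]
    exact (this.continuousOn_mul (by fun_prop)).mul_continuousOn (hN₂.mono hsub)
  obtain ⟨F, hF⟩ := isCompact_Icc.exists_bound_of_continuousOn hf₂
  obtain ⟨N, hN⟩ := isCompact_Icc.exists_bound_of_continuousOn hN₂
  have hsum : HasSum (fun n => ∫ s in (0:ℝ)..t, iteratedKernel a n (t, s) * N₂ s)
      (∫ s in (0:ℝ)..t, (∑' n, iteratedKernel a n (t, s)) * N₂ s) := by
    refine intervalIntegral.hasSum_integral_of_dominated_convergence
      (fun n _ => M * E * N / 2 ^ n) (fun n => ?_) (fun n => ?_) ?_ ?_ ?_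
    · exact ((((hcont n).mul (hN₂.mono hsub)).mono
        Set.uIoc_subset_uIcc).aestronglyMeasurable measurableSet_uIoc)
    · refine Filter.Eventually.of_forall fun s hs => ?_
      have hs' := Set.uIoc_subset_uIcc hs
      rw [norm_mul]
      calc _ ≤ M * E / 2 ^ n * N :=
            mul_le_mul (hsup n _ (hmem s hs')) (hN s (hsub hs')) (norm_nonneg _) (by positivity)
        _ = _ := by ring
    · exact Filter.Eventually.of_forall fun s _ => (hgeo _).summable
    · exact intervalIntegrable_const
    · exact Filter.Eventually.of_forall fun s hs =>
        (hsummable _ (hmem s (Set.uIoc_subset_uIcc hs))).hasSum.mul_right _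
  have hrem : Filter.Tendsto (fun n => ∫ s in (0:ℝ)..t, iteratedKernel a n (t, s) * f₂ s)
      Filter.atTop (nhds 0) := by
    have h0 := (hgeo (M * E * F * |t - 0|)).summable.tendsto_atTop_zero
    refine squeeze_zero_norm (fun n => ?_) h0
    refine (intervalIntegral.norm_integral_le_of_norm_le_const
      (C := M * E / 2 ^ n * F) fun s hs => ?_).trans_eq (by ring)
    have hs' := Set.uIoc_subset_uIcc hs
    rw [norm_mul]
    exact mul_le_mul (hsup n _ (hmem s hs')) (hF s (hsub hs')) (norm_nonneg _) (by positivity)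
  have hlim := (((hsum.tendsto_sum_nat.const_add
    (∫ s in (0:ℝ)..t, a (t, s) / √(t - s) * N₂ s)).const_mul (1 / Real.pi ^ 2)).const_add
    (N₂ t / Real.pi)).add (hrem.const_mul (1 / Real.pi))
  have hconst := tendsto_nhds_unique (hlim.congr fun n => (hexp n).symm) tendsto_const_nhds
  rw [← hconst, mul_zero, add_zero]
  congr 2
  have hGcont : ContinuousOn (fun s => ∑' n, iteratedKernel a n (t, s)) (Set.uIcc 0 t) :=
    continuousOn_tsum hcont (hgeo (M * E)).summable fun n s hs => hsup n _ (hmem s hs)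
  have hG : IntervalIntegrable (fun s => (∑' n, iteratedKernel a n (t, s)) * N₂ s) volume 0 t :=
    (hGcont.mul (hN₂.mono hsub)).intervalIntegrable
  rw [← intervalIntegral.integral_add hK hG]
  refine intervalIntegral.integral_congr fun s hs => ?_
  simp only [hkernel t ht s hs, add_mul]
end
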